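/- arXiv:2104.12104 — 2 statements merged into one kernel-verified Lean document; each statement's English description precedes it below -/
import Mathlib

section
/- Let (X,d,T) be a topological dynamical system and μ a T-invariant Borel probability measure. Then for μ-a.e. x ∈ X, lim_{δ→0} liminf_{n→∞} -(1/n) log μ(B_{d_{FK_n}}(x,δ)) = lim_{δ→0} limsup_{n→∞} -(1/n) log μ(B_{d_{FK_n}}(x,δ)) = h_μ(T,x), where h_μ(T,x) is the Brin–Katok local entropy; in particular, the integral of this limit equals h_μ(T). -/
open Filter Metric Set

variable {X : Type*} [MetricSpace X]

/-- The maximal cardinality of an `(n,δ)`-match of `x` and `y`: an order-preserving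
bijection `π : D(π) → R(π)` between subsets of `{0,…,n-1}` such that
`d(T^i x, T^{π i} y) < δ` for all `i ∈ D(π)`, encoded by a pair of strictly
increasing enumerations of `D(π)` and `R(π)`. -/
noncomputable def fkFit (T : X → X) (n : ℕ) (δ : ℝ) (x y : X) : ℕ :=
  sSup {k : ℕ | ∃ i j : Fin k → Fin n, StrictMono i ∧ StrictMono j ∧
    ∀ s, dist (T^[(i s : ℕ)] x) (T^[(j s : ℕ)] y) < δ}

/-- `f̄_{n,δ}(x,y) = 1 - (max match)/n`. -/
noncomputable def fkF (T : X → X) (n : ℕ) (δ : ℝ) (x y : X) : ℝ :=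
  1 - (fkFit T n δ x y : ℝ) / n

/-- The Feldman–Katok metric `d_{FK_n}`. -/
noncomputable def dFKn (T : X → X) (n : ℕ) (x y : X) : ℝ :=
  sInf {δ : ℝ | 0 < δ ∧ fkF T n δ x y < δ}

/-- The Feldman–Katok pseudometric `d_{FK}`. -/
noncomputable def dFK (T : X → X) (x y : X) : ℝ :=
  sInf {δ : ℝ | 0 < δ ∧ Filter.limsup (fun n => fkF T n δ x y) atTop < δ}

open MeasureTheory ENNReal

/-- `P` is a finite measurable partition of `X`. -/
def IsFinPartition {Y : Type*} [MeasurableSpace Y] {k : ℕ} (P : Fin k → Set Y) : Prop :=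
  (∀ i, MeasurableSet (P i)) ∧ Pairwise (Function.onFun Disjoint P) ∧ (⋃ i, P i) = Set.univ

/-- The Shannon entropy `H_μ(⋁_{i=0}^{n-1} T^{-i} P)` of the `n`-th dynamical
refinement of the partition `P`. -/
noncomputable def dynEnt {Y : Type*} [MeasurableSpace Y] (μ : Measure Y) (T : Y → Y)
    {k : ℕ} (P : Fin k → Set Y) (n : ℕ) : ℝ :=
  ∑ f : Fin n → Fin k, Real.negMulLog (μ (⋂ i : Fin n, T^[(i : ℕ)] ⁻¹' P (f i))).toReal

/-- The Kolmogorov–Sinai (measure-theoretic) entropy `h_μ(T)`, defined as the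
supremum over finite measurable partitions `P` of
`h_μ(T,P) = lim_n H_μ(⋁ T^{-i}P)/n = inf_n H_μ(⋁ T^{-i}P)/n` (by subadditivity). -/
noncomputable def ksEntropy {Y : Type*} [MeasurableSpace Y] (μ : Measure Y) (T : Y → Y) :
    ℝ≥0∞ :=
  ⨆ (k : ℕ) (P : Fin k → Set Y) (_ : IsFinPartition P),
    ⨅ n : ℕ, ENNReal.ofReal (dynEnt μ T P (n + 1) / (n + 1))

/-- The Bowen ball `B_n(x,δ) = {y : max_{0 ≤ i < n} d(T^i x, T^i y) < δ}`. -/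
def bowenBall (T : X → X) (n : ℕ) (x : X) (δ : ℝ) : Set X :=
  {y | ∀ i < n, dist (T^[i] x) (T^[i] y) < δ}

/-- The Feldman–Katok ball `B_{d_{FK_n}}(x,δ)`. -/
def fkBall (T : X → X) (n : ℕ) (x : X) (δ : ℝ) : Set X := {y | dFKn T n x y < δ}

/-- `-log a`, valued in `ℝ≥0∞` (with `-log 0 = ∞`), for `a ∈ ℝ≥0∞`, `a ≤ 1`. -/
noncomputable def nlog (a : ℝ≥0∞) : ℝ≥0∞ :=
  if a = 0 then ⊤ else ENNReal.ofReal (-Real.log a.toReal)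

/-- The Brin–Katok local entropy `h_μ(T,x)`, defined via Bowen balls as
`lim_{δ→0} liminf_n -(1/n) log μ(B_n(x,δ)) = ⨆_{δ>0} liminf_n -(1/n) log μ(B_n(x,δ))`. -/
noncomputable def localEnt [MeasurableSpace X] (μ : Measure X) (T : X → X) (x : X) :
    ℝ≥0∞ :=
  ⨆ (δ : ℝ) (_ : 0 < δ),
    Filter.liminf (fun n : ℕ => nlog (μ (bowenBall T n x δ)) / (n : ℝ≥0∞)) atTop

open Filter Metric Set MeasureTheory ENNReal

/-! ### Elementary facts on `nlog` -/

theorem bk_nlog_anti {a b : ℝ≥0∞} (hb : b ≠ ⊤) (h : a ≤ b) : nlog b ≤ nlog a := by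
  unfold nlog
  by_cases ha : a = 0
  · simp [ha]
  · have hb0 : b ≠ 0 := fun hb0 => ha (le_antisymm (hb0 ▸ h) (zero_le))
    simp only [ha, hb0, if_false]
    apply ENNReal.ofReal_le_ofReal
    have hapos : 0 < a.toReal := ENNReal.toReal_pos ha (ne_top_of_le_ne_top hb h)
    have := Real.log_le_log hapos (ENNReal.toReal_mono hb h)
    linarith

theorem bk_nlog_le_iff {a : ℝ≥0∞} (ha : a ≠ ⊤) {r : ℝ} (hr : 0 ≤ r) :
    nlog a ≤ ENNReal.ofReal r ↔ ENNReal.ofReal (Real.exp (-r)) ≤ a := by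
  unfold nlog
  by_cases h0 : a = 0
  · simp [h0, Real.exp_pos]
  · have hapos : 0 < a.toReal := ENNReal.toReal_pos h0 ha
    simp only [h0, if_false]
    rw [ENNReal.ofReal_le_ofReal_iff hr, ENNReal.ofReal_le_iff_le_toReal ha,
      ← Real.le_log_iff_exp_le hapos]
    constructor <;> intro h <;> linarith

theorem bk_nlog_le_add {a b : ℝ≥0∞} (ha : a ≤ 1) (hb : b ≠ ⊤) {r : ℝ} (hr : 0 ≤ r)
    (h : ENNReal.ofReal (Real.exp (-r)) * a ≤ b) : nlog b ≤ nlog a + ENNReal.ofReal r := by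
  by_cases h0 : a = 0
  · simp [nlog, h0]
  · have hat : a ≠ ⊤ := ne_top_of_le_ne_top one_ne_top ha
    have hapos : 0 < a.toReal := ENNReal.toReal_pos h0 hat
    have hlog : 0 ≤ -Real.log a.toReal := by
      have := Real.log_nonpos hapos.le (by simpa using ENNReal.toReal_mono one_ne_top ha)
      linarith
    have e : nlog a = ENNReal.ofReal (-Real.log a.toReal) := by simp [nlog, h0]
    rw [e, ← ENNReal.ofReal_add hlog hr, bk_nlog_le_iff hb (by positivity)]
    refine le_trans (le_of_eq ?_) h
    rw [neg_add, neg_neg, Real.exp_add, Real.exp_log hapos, mul_comm,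
      ENNReal.ofReal_mul (Real.exp_pos _).le, ENNReal.ofReal_toReal hat]

theorem bk_measurable_nlog : Measurable nlog := by
  unfold nlog
  refine Measurable.ite (measurableSet_singleton 0) measurable_const ?_
  fun_prop

/-! ### Visit counts and the maximal inequality -/

/-- number of `i < n` with `T^i x ∈ U` -/
noncomputable def bkCnt {Y : Type*} (T : Y → Y) (U : Set Y) (n : ℕ) (x : Y) : ℕ :=
  ∑ i ∈ Finset.range n, U.indicator (fun _ => 1) (T^[i] x)

theorem bkCnt_add {Y : Type*} (T : Y → Y) (U : Set Y) (m n : ℕ) (x : Y) :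
    bkCnt T U (m + n) x = bkCnt T U m x + bkCnt T U n (T^[m] x) := by
  unfold bkCnt
  rw [Finset.sum_range_add]
  congr 1
  refine Finset.sum_congr rfl fun i _ => ?_
  rw [← Function.iterate_add_apply, add_comm]

theorem bkCnt_one {Y : Type*} (T : Y → Y) (U : Set Y) (x : Y) :
    bkCnt T U 1 x = U.indicator (fun _ => 1) x := by simp [bkCnt]

theorem bkCnt_le {Y : Type*} (T : Y → Y) (U : Set Y) (n : ℕ) (x : Y) :
    bkCnt T U n x ≤ n := by
  unfold bkCnt
  calc _ ≤ ∑ i ∈ Finset.range n, 1 := Finset.sum_le_sum fun i _ => by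
        by_cases h : T^[i] x ∈ U <;> simp [h]
    _ = n := by simp

theorem bkCnt_mono {Y : Type*} (T : Y → Y) (U : Set Y) {m n : ℕ} (h : m ≤ n) (x : Y) :
    bkCnt T U m x ≤ bkCnt T U n x := by
  obtain ⟨k, rfl⟩ := Nat.exists_eq_add_of_le h
  rw [bkCnt_add]; omega

theorem bkCnt_eq_card {Y : Type*} (T : Y → Y) (U : Set Y) (n : ℕ) (x : Y)
    [DecidablePred fun i : Fin n => T^[(i : ℕ)] x ∈ U] :
    bkCnt T U n x = (Finset.univ.filter fun i : Fin n => T^[(i : ℕ)] x ∈ U).card := by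
  classical
  unfold bkCnt
  rw [Finset.card_filter, Finset.sum_range]
  refine Finset.sum_congr rfl fun i _ => ?_
  by_cases h : T^[(i : ℕ)] x ∈ U <;> simp [h]

theorem bk_maximal_pt {Y : Type*} (T : Y → Y) (U : Set Y) (η : ℝ) (hη : 0 ≤ η) (N : ℕ) :
    ∀ K x, η * bkCnt T {x | ∃ n, 1 ≤ n ∧ n ≤ N ∧ η * n < bkCnt T U n x} K x
      ≤ bkCnt T U (K + N) x := by
  set A := {x | ∃ n, 1 ≤ n ∧ n ≤ N ∧ η * n < bkCnt T U n x} with hA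
  intro K
  induction K using Nat.strong_induction_on with
  | _ K ih =>
    intro x
    rcases Nat.eq_zero_or_pos K with rfl | hK
    · rw [show bkCnt T A 0 x = 0 by simp [bkCnt]]
      simp
    by_cases hx : x ∈ A
    · obtain ⟨n, hn1, hnN, hlt⟩ := hx
      by_cases hnK : K ≤ n
      · calc η * bkCnt T A K x ≤ η * n := by
              gcongr
              exact (bkCnt_le T A K x).trans hnK
          _ ≤ bkCnt T U n x := hlt.le
          _ ≤ _ := by exact_mod_cast bkCnt_mono T U (by omega) x
      · push Not at hnK
        obtain ⟨k, rfl⟩ := Nat.exists_eq_add_of_le hnK.le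
        have h1 := ih k (by omega) (T^[n] x)
        have h2 : (bkCnt T A n x : ℝ) ≤ n := by exact_mod_cast bkCnt_le T A n x
        rw [bkCnt_add, add_assoc, bkCnt_add]
        push_cast
        nlinarith [mul_le_mul_of_nonneg_left h2 hη]
    · obtain ⟨k, rfl⟩ := Nat.exists_eq_add_of_le' hK
      have h1 := ih k (by omega) (T^[1] x)
      rw [add_comm k 1, bkCnt_add, add_assoc, bkCnt_add, bkCnt_one]
      simp only [hx, not_false_eq_true, indicator_of_notMem, zero_add]
      push_cast
      have : (0 : ℝ) ≤ (bkCnt T U 1 x : ℝ) := by positivity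
      linarith

section meas
variable {Y : Type*} [MeasurableSpace Y] {μ : Measure Y} {T : Y → Y}

theorem bkCnt_measurable (hT : Measurable T) {U : Set Y} (hU : MeasurableSet U) (n : ℕ) :
    Measurable (bkCnt T U n) := by
  unfold bkCnt
  refine Finset.measurable_sum _ fun i _ => ?_
  exact (measurable_const.indicator hU).comp (hT.iterate i)

theorem bk_lintegral_cnt (hμ : MeasurePreserving T μ μ) {U : Set Y} (hU : MeasurableSet U)
    (n : ℕ) : ∫⁻ x, (bkCnt T U n x : ℝ≥0∞) ∂μ = n * μ U := by
  have : ∀ x, (bkCnt T U n x : ℝ≥0∞)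
      = ∑ i ∈ Finset.range n, (T^[i] ⁻¹' U).indicator (fun _ => (1 : ℝ≥0∞)) x := by
    intro x
    unfold bkCnt
    rw [Nat.cast_sum]
    refine Finset.sum_congr rfl fun i _ => ?_
    by_cases h : T^[i] x ∈ U <;> simp [h]
  simp_rw [this]
  rw [lintegral_finsetSum]
  · have : ∀ i ∈ Finset.range n,
        ∫⁻ x, (T^[i] ⁻¹' U).indicator (fun _ => (1 : ℝ≥0∞)) x ∂μ = μ U := by
      intro i _
      rw [lintegral_indicator ((hμ.iterate i).measurable hU)]
      simp [(hμ.iterate i).measure_preimage hU.nullMeasurableSet]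
    rw [Finset.sum_congr rfl this]; simp
  · intro i _
    exact measurable_const.indicator ((hμ.iterate i).measurable hU)

theorem bk_maximal [IsProbabilityMeasure μ] (hμ : MeasurePreserving T μ μ) {U : Set Y}
    (hU : MeasurableSet U) {η : ℝ} (hη : 0 < η) :
    ENNReal.ofReal η * μ {x | ∃ n, η * n < bkCnt T U n x} ≤ μ U := by
  set A : ℕ → Set Y := fun N => {x | ∃ n, 1 ≤ n ∧ n ≤ N ∧ η * n < bkCnt T U n x} with hA
  have hAm : ∀ N, MeasurableSet (A N) := by
    intro N
    have : A N = ⋃ n, ⋃ (_ : 1 ≤ n ∧ n ≤ N), {x | η * n < (bkCnt T U n x : ℝ)} := by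
      ext x; simp [hA, and_assoc]
    rw [this]
    refine MeasurableSet.iUnion fun n => MeasurableSet.iUnion fun _ => ?_
    have := bkCnt_measurable hμ.measurable hU n
    exact measurableSet_lt measurable_const (by fun_prop)
  have hmono : Monotone A := fun M N h x ⟨n, h1, h2, h3⟩ => ⟨n, h1, h2.trans h, h3⟩
  have hun : {x | ∃ n, η * n < bkCnt T U n x} = ⋃ N, A N := by
    ext x
    simp only [mem_ofPred_eq, hA, mem_iUnion]
    constructor
    · rintro ⟨n, hn⟩
      refine ⟨n, n, ?_, le_rfl, hn⟩
      rcases Nat.eq_zero_or_pos n with rfl | h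
      · simp [bkCnt] at hn
      · exact h
    · rintro ⟨N, n, -, -, h⟩; exact ⟨n, h⟩
  rw [hun, hmono.measure_iUnion, ENNReal.mul_iSup]
  refine iSup_le fun N => ?_
  have key : ∀ K : ℕ, K * (ENNReal.ofReal η * μ (A N)) ≤ (K + N) * μ U := by
    intro K
    have h1 : ∫⁻ x, ENNReal.ofReal η * (bkCnt T (A N) K x : ℝ≥0∞) ∂μ
        ≤ ∫⁻ x, (bkCnt T U (K + N) x : ℝ≥0∞) ∂μ := by
      refine lintegral_mono fun x => ?_
      have := bk_maximal_pt T U η hη.le N K x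
      have := ENNReal.ofReal_le_ofReal this
      rwa [ENNReal.ofReal_mul hη.le, ENNReal.ofReal_natCast, ENNReal.ofReal_natCast] at this
    have hm := bkCnt_measurable hμ.measurable (hAm N) K
    rw [lintegral_const_mul _ (by fun_prop), bk_lintegral_cnt hμ (hAm N),
      bk_lintegral_cnt hμ hU] at h1
    push_cast at h1
    calc _ = ENNReal.ofReal η * (K * μ (A N)) := by ring
      _ ≤ _ := h1
  set a := ENNReal.ofReal η * μ (A N) with ha
  have hat : a ≠ ⊤ := by finiteness
  have hb : μ U ≠ ⊤ := by finiteness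
  rw [← ENNReal.toReal_le_toReal hat hb]
  have key' : ∀ K : ℕ, K * (a.toReal - (μ U).toReal) ≤ N * (μ U).toReal := by
    intro K
    have := ENNReal.toReal_mono (by finiteness) (key K)
    rw [ENNReal.toReal_mul (a := (K : ℝ≥0∞)) (b := a), ENNReal.toReal_mul (a := (K : ℝ≥0∞) + N), ENNReal.toReal_add (by finiteness) (by finiteness)] at this
    simp only [ENNReal.toReal_natCast] at this
    linarith
  by_contra hcon
  push Not at hcon
  obtain ⟨K, hK⟩ := exists_nat_gt (N * (μ U).toReal / (a.toReal - (μ U).toReal))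
  rw [div_lt_iff₀ (by linarith)] at hK
  linarith [key' K]

/-- If `μ (U M) → 0`, almost every point visits some `U M` with frequency `≤ η` at all times. -/
theorem bk_freq [IsProbabilityMeasure μ] (hμ : MeasurePreserving T μ μ) {U : ℕ → Set Y}
    (hU : ∀ M, MeasurableSet (U M)) (h0 : Tendsto (fun M => μ (U M)) atTop (nhds 0))
    {η : ℝ} (hη : 0 < η) :
    ∀ᵐ x ∂μ, ∃ M, ∀ n, (bkCnt T (U M) n x : ℝ) ≤ η * n := by
  rw [ae_iff]
  have hb : ∀ M, μ {x | ¬ ∃ M, ∀ n, (bkCnt T (U M) n x : ℝ) ≤ η * n}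
      ≤ μ (U M) / ENNReal.ofReal η := by
    intro M
    rw [ENNReal.le_div_iff_mul_le (by simp [hη]) (by simp), mul_comm]
    refine le_trans ?_ (bk_maximal hμ (hU M) hη)
    gcongr
    rename_i x
    intro hx
    simp only [not_exists, not_forall, not_le] at hx
    exact hx M
  have hlim : Tendsto (fun M => μ (U M) / ENNReal.ofReal η) atTop (nhds 0) := by
    have := ENNReal.Tendsto.div_const h0 (b := ENNReal.ofReal η) (by simp [hη])
    simpa using this
  exact le_antisymm (ge_of_tendsto' hlim hb) (zero_le)

end meas

/-! ### Words and cylinders -/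

/-- the `p`-name of `x` of length `n` -/
def bkWord {Y ι : Type*} (T : Y → Y) (p : Y → ι) (n : ℕ) (x : Y) : Fin n → ι :=
  fun i => p (T^[(i : ℕ)] x)

/-- measure of a cylinder -/
noncomputable def bkCm {Y ι : Type*} [MeasurableSpace Y] (μ : Measure Y) (T : Y → Y) (p : Y → ι)
    (n : ℕ) (w : Fin n → ι) : ℝ≥0∞ := μ {x | bkWord T p n x = w}

/-- measure of the cylinder containing `x` -/
noncomputable def bkJ {Y ι : Type*} [MeasurableSpace Y] (μ : Measure Y) (T : Y → Y) (p : Y → ι)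
    (n : ℕ) (x : Y) : ℝ≥0∞ := bkCm μ T p n (bkWord T p n x)

section words
variable {Y ι : Type*} [MeasurableSpace Y] {μ : Measure Y} {T : Y → Y} {p : Y → ι}

theorem bk_cyl_meas (hT : Measurable T) (hp : ∀ a, MeasurableSet (p ⁻¹' {a})) (n : ℕ)
    (w : Fin n → ι) : MeasurableSet {x | bkWord T p n x = w} := by
  have : {x | bkWord T p n x = w} = ⋂ i : Fin n, T^[(i : ℕ)] ⁻¹' (p ⁻¹' {w i}) := by
    ext x; simp [bkWord, funext_iff]
  rw [this]
  exact MeasurableSet.iInter fun i => (hT.iterate i) (hp _)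

theorem bk_setOf_word_meas [Fintype ι] (hT : Measurable T) (hp : ∀ a, MeasurableSet (p ⁻¹' {a}))
    (n : ℕ) (s : Set (Fin n → ι)) : MeasurableSet {x | bkWord T p n x ∈ s} := by
  have : {x | bkWord T p n x ∈ s} = ⋃ w ∈ s, {x | bkWord T p n x = w} := by
    ext x; simp
  rw [this]
  exact MeasurableSet.biUnion (to_countable s) fun w _ => bk_cyl_meas hT hp n w

theorem bk_measure_word [Fintype ι] (hT : Measurable T) (hp : ∀ a, MeasurableSet (p ⁻¹' {a}))
    (n : ℕ) (s : Finset (Fin n → ι)) :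
    μ {x | bkWord T p n x ∈ s} = ∑ w ∈ s, bkCm μ T p n w := by
  have : {x | bkWord T p n x ∈ s} = ⋃ w ∈ s, {x | bkWord T p n x = w} := by
    ext x; simp
  rw [this, measure_biUnion_finset]
  · rfl
  · intro a _ b _ hab
    refine Set.disjoint_left.2 fun x h1 h2 => hab ?_
    rw [← h1, ← h2]
  · exact fun w _ => bk_cyl_meas hT hp n w

theorem bk_sum_cm [Fintype ι] [IsProbabilityMeasure μ] (hT : Measurable T)
    (hp : ∀ a, MeasurableSet (p ⁻¹' {a})) (n : ℕ) :
    ∑ w, bkCm μ T p n w = 1 := by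
  rw [← bk_measure_word hT hp]; simp

theorem bkCm_le_one [IsProbabilityMeasure μ] (n : ℕ) (w : Fin n → ι) : bkCm μ T p n w ≤ 1 :=
  prob_le_one

theorem bkJ_le_one [IsProbabilityMeasure μ] (n : ℕ) (x : Y) : bkJ μ T p n x ≤ 1 :=
  prob_le_one

theorem bkJ_ne_top [IsProbabilityMeasure μ] (n : ℕ) (x : Y) : bkJ μ T p n x ≠ ⊤ :=
  ne_top_of_le_ne_top one_ne_top (bkJ_le_one n x)

theorem bk_fun_word_meas [Fintype ι] (hT : Measurable T) (hp : ∀ a, MeasurableSet (p ⁻¹' {a}))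
    (n : ℕ) (f : (Fin n → ι) → ℝ≥0∞) : Measurable fun x => f (bkWord T p n x) := by
  intro s _
  exact bk_setOf_word_meas hT hp n (f ⁻¹' s)

/-- Markov + Borel–Cantelli. -/
theorem bk_bc [Fintype ι] (hT : Measurable T) (hp : ∀ a, MeasurableSet (p ⁻¹' {a}))
    (Φ : ∀ n, (Fin n → ι) → ℝ≥0∞) (r : ℕ → ℝ≥0∞) (hr : ∑' n, r n ≠ ⊤)
    (hΦ : ∀ n, ∑ w, Φ n w ≤ r n) :
    ∀ᵐ x ∂μ, ∀ᶠ n in atTop, Φ n (bkWord T p n x) ≤ bkJ μ T p n x := by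
  classical
  have hB : ∀ n, μ {x | bkCm μ T p n (bkWord T p n x) < Φ n (bkWord T p n x)} ≤ r n := by
    intro n
    have := bk_measure_word (μ := μ) hT hp n
      (Finset.univ.filter fun w => bkCm μ T p n w < Φ n w)
    simp only [Finset.mem_filter, Finset.mem_univ, true_and] at this
    rw [this]
    calc _ ≤ ∑ w ∈ Finset.univ.filter (fun w => bkCm μ T p n w < Φ n w), Φ n w :=
          Finset.sum_le_sum fun w hw => (Finset.mem_filter.1 hw).2.le
      _ ≤ ∑ w, Φ n w := Finset.sum_le_sum_of_subset (Finset.filter_subset _ _)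
      _ ≤ r n := hΦ n
  have := measure_setOfPred_frequently_eq_zero
    (ne_top_of_le_ne_top hr (ENNReal.tsum_le_tsum hB))
  rw [ae_iff]
  simpa [Filter.Frequently, bkJ] using this

theorem bk_tsum_exp {γ : ℝ} (hγ : 0 < γ) :
    ∑' n : ℕ, ENNReal.ofReal (Real.exp (-(n * γ))) ≠ ⊤ := by
  have : ∀ n : ℕ, ENNReal.ofReal (Real.exp (-(n * γ)))
      = ENNReal.ofReal (Real.exp (-γ)) ^ n := by
    intro n
    rw [← ENNReal.ofReal_pow (Real.exp_pos _).le, ← Real.exp_nat_mul]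
    ring_nf
  simp_rw [this]
  rw [ENNReal.tsum_geometric]
  simp only [ne_eq, ENNReal.inv_eq_top, tsub_eq_zero_iff_le, not_le, ENNReal.ofReal_lt_one]
  exact Real.exp_lt_one_iff.2 (by linarith)

end words

open Filter Metric Set MeasureTheory ENNReal

/-! ### A renewal-type sub-probability on words -/

/-- weight of a block of length `m + 1` -/
noncomputable def bkLam (m : ℕ) : ℝ≥0∞ := ENNReal.ofReal (1 / ((m + 1) * (m + 2)))

theorem bkLam_sum (n : ℕ) : ∑ m ∈ Finset.range n, bkLam m ≤ 1 := by
  unfold bkLam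
  rw [← ENNReal.ofReal_sum_of_nonneg (fun i _ => by positivity)]
  have : ∑ i ∈ Finset.range n, (1 / (((i : ℝ) + 1) * (i + 2))) = 1 - 1 / (n + 1) := by
    induction n with
    | zero => simp
    | succ n ih =>
      rw [Finset.sum_range_succ, ih]
      push_cast
      field_simp
      ring
  rw [this]
  have : (0 : ℝ) ≤ 1 / (n + 1) := by positivity
  exact ENNReal.ofReal_le_one.2 (by linarith)

theorem bkLam_large {ε : ℝ} (hε : 0 < ε) :
    ∃ L : ℕ, ∀ m, L ≤ m → ENNReal.ofReal (Real.exp (-((m + 1 : ℕ) * ε))) ≤ bkLam m := by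
  obtain ⟨L, hL⟩ := exists_nat_gt (12 / ε ^ 3)
  refine ⟨L, fun m hm => ENNReal.ofReal_le_ofReal ?_⟩
  have h1 : (12 : ℝ) / ε ^ 3 < m + 1 := by
    have : (L : ℝ) ≤ m := by exact_mod_cast hm
    linarith
  have hx : (0 : ℝ) ≤ (m + 1) * ε := by positivity
  have h2 := Real.pow_div_factorial_le_exp _ hx 3
  rw [div_lt_iff₀ (by positivity)] at h1
  have h3 : ((m : ℝ) + 1) * (m + 2) ≤ Real.exp ((m + 1) * ε) := by
    refine le_trans ?_ h2
    have : ((3).factorial : ℝ) = 6 := by norm_num [Nat.factorial]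
    rw [this, le_div_iff₀ (by norm_num)]
    have h4 : ((m : ℝ) + 1) * (m + 2) * 6 ≤ (m + 1) ^ 2 * 12 := by
      nlinarith [(by positivity : (0:ℝ) ≤ m)]
    have h5 : (m + 1 : ℝ) ^ 2 * 12 ≤ (m + 1) ^ 2 * ((m + 1) * ε ^ 3) := by gcongr
    calc _ ≤ _ := h4
      _ ≤ _ := h5
      _ = _ := by ring
  rw [Real.exp_neg, one_div]
  push_cast
  gcongr

/-- total weight of all parsings of a word -/
noncomputable def bkZ {ι : Type*} (ml : List ι → ℝ≥0∞) : ℕ → List ι → ℝ≥0∞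
  | 0, _ => 1
  | n + 1, l => ∑ m ∈ Finset.range (n + 1),
      bkLam m * ml (l.take (m + 1)) * bkZ ml (n - m) (l.drop (m + 1))
termination_by n => n
decreasing_by omega

theorem bk_sum_split {ι : Type*} [Fintype ι] (f : List ι → ℝ≥0∞) {N m k : ℕ} (h : N = m + k) :
    ∑ w : Fin N → ι, f (List.ofFn w)
      = ∑ u : Fin m → ι, ∑ v : Fin k → ι, f (List.ofFn u ++ List.ofFn v) := by
  subst h
  rw [← Fintype.sum_prod_type', ← (Fin.appendEquiv m k).sum_comp]
  refine Finset.sum_congr rfl fun uv _ => ?_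
  rw [← List.ofFn_fin_append]
  rfl

theorem bkZ_sum {ι : Type*} [Fintype ι] (ml : List ι → ℝ≥0∞)
    (hml : ∀ m, ∑ w : Fin m → ι, ml (List.ofFn w) ≤ 1) :
    ∀ n, ∑ w : Fin n → ι, bkZ ml n (List.ofFn w) ≤ 1 := by
  intro n
  induction n using Nat.strong_induction_on with
  | _ n ih =>
    rcases n with _ | n
    · simp [bkZ]
    simp_rw [bkZ]
    rw [Finset.sum_comm]
    refine le_trans (Finset.sum_le_sum (g := bkLam) fun m hm => ?_) (bkLam_sum (n + 1))
    have hm' : m < n + 1 := Finset.mem_range.1 hm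
    rw [bk_sum_split (fun l => bkLam m * ml (l.take (m + 1)) * bkZ ml (n - m) (l.drop (m + 1)))
      (show n + 1 = (m + 1) + (n - m) by omega)]
    have : ∀ (u : Fin (m + 1) → ι) (v : Fin (n - m) → ι),
        bkLam m * ml ((List.ofFn u ++ List.ofFn v).take (m + 1))
          * bkZ ml (n - m) ((List.ofFn u ++ List.ofFn v).drop (m + 1))
        = bkLam m * ml (List.ofFn u) * bkZ ml (n - m) (List.ofFn v) := by
      intro u v
      rw [List.take_left' (by simp), List.drop_left' (by simp)]
    simp_rw [this, ← Finset.mul_sum, ← Finset.sum_mul]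
    rw [← Finset.mul_sum]
    calc _ ≤ bkLam m * 1 * 1 := by
          refine mul_le_mul' (mul_le_mul' le_rfl (hml _)) (ih (n - m) (by omega))
      _ = _ := by simp

/-- cylinder measure, on lists -/
noncomputable def bkMl {Y ι : Type*} [MeasurableSpace Y] (μ : Measure Y) (T : Y → Y) (p : Y → ι)
    (l : List ι) : ℝ≥0∞ := μ {x | ∀ i (h : i < l.length), p (T^[i] x) = l[i]}

theorem bkMl_ofFn {Y ι : Type*} [MeasurableSpace Y] (μ : Measure Y) (T : Y → Y) (p : Y → ι)
    {n : ℕ} (w : Fin n → ι) : bkMl μ T p (List.ofFn w) = bkCm μ T p n w := by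
  unfold bkMl bkCm
  congr 1
  ext x
  simp only [List.length_ofFn, List.getElem_ofFn, mem_ofPred_eq, funext_iff, bkWord]
  exact ⟨fun h i => h i i.2, fun h i hi => h ⟨i, hi⟩⟩

theorem bkWord_take {Y ι : Type*} (T : Y → Y) (p : Y → ι) (m k : ℕ) (x : Y) :
    (List.ofFn (bkWord T p (m + k) x)).take m = List.ofFn (bkWord T p m x) := by
  refine List.ext_getElem (by simp) fun i h1 h2 => ?_
  simp [bkWord]

theorem bkWord_drop {Y ι : Type*} (T : Y → Y) (p : Y → ι) (m k : ℕ) (x : Y) :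
    (List.ofFn (bkWord T p (m + k) x)).drop m = List.ofFn (bkWord T p k (T^[m] x)) := by
  refine List.ext_getElem (by simp) fun i h1 h2 => ?_
  simp only [List.getElem_drop, List.getElem_ofFn, bkWord]
  rw [← Function.iterate_add_apply, add_comm]

theorem bkZ_step {Y ι : Type*} [MeasurableSpace Y] (μ : Measure Y) (T : Y → Y) (p : Y → ι)
    (m k : ℕ) (x : Y) :
    bkLam m * bkJ μ T p (m + 1) x * bkZ (bkMl μ T p) k (List.ofFn (bkWord T p k (T^[m + 1] x)))
      ≤ bkZ (bkMl μ T p) (m + 1 + k) (List.ofFn (bkWord T p (m + 1 + k) x)) := by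
  conv_rhs => rw [show m + 1 + k = (m + k) + 1 by omega, bkZ]
  refine le_trans (le_of_eq ?_) (Finset.single_le_sum
    (f := fun j => bkLam j * bkMl μ T p ((List.ofFn (bkWord T p (m + k + 1) x)).take (j + 1))
      * bkZ (bkMl μ T p) (m + k - j) ((List.ofFn (bkWord T p (m + k + 1) x)).drop (j + 1)))
    (fun _ _ => zero_le) (Finset.mem_range.2 (show m < m + k + 1 by omega)))
  have e : m + k + 1 = (m + 1) + k := by omega
  have e2 : m + k - m = k := by omega
  have h1 : ∀ N, N = m + 1 + k →
      (List.ofFn (bkWord T p N x)).take (m + 1) = List.ofFn (bkWord T p (m + 1) x) := by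
    rintro _ rfl; exact bkWord_take T p _ _ x
  have h2 : ∀ N, N = m + 1 + k →
      (List.ofFn (bkWord T p N x)).drop (m + 1) = List.ofFn (bkWord T p k (T^[m + 1] x)) := by
    rintro _ rfl; exact bkWord_drop T p _ _ x
  simp only [h1 _ e, h2 _ e, e2]
  rw [bkMl_ofFn, bkJ]

/-- greedy parsing -/
theorem bk_greedy {Y : Type*} (T : Y → Y) (q : ℕ → Y → ℝ≥0∞) (z : ℕ → Y → ℝ≥0∞)
    (hz0 : ∀ y, 1 ≤ z 0 y)
    (hz : ∀ m k y, q (m + 1) y * z k (T^[m + 1] y) ≤ z (m + 1 + k) y)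
    {C b : ℝ} (hC0 : 0 ≤ C) (hb : 0 ≤ b) (U : Set Y) (M : ℕ) (x : Y)
    (hC : ∀ i, ENNReal.ofReal (Real.exp (-C)) ≤ q 1 (T^[i] x))
    (hU : ∀ i, T^[i] x ∉ U → ∃ m, m + 1 ≤ M ∧
      ENNReal.ofReal (Real.exp (-((m + 1 : ℕ) * b))) ≤ q (m + 1) (T^[i] x)) :
    ∀ (n i : ℕ), ENNReal.ofReal (Real.exp (-(n * b + C * bkCnt T U n (T^[i] x) + C * M)))
      ≤ z n (T^[i] x) := by
  have comb : ∀ {s t : ℝ} {m k : ℕ} {y : Y}, ENNReal.ofReal (Real.exp (-s)) ≤ q (m + 1) y →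
      ENNReal.ofReal (Real.exp (-t)) ≤ z k (T^[m + 1] y) →
      ENNReal.ofReal (Real.exp (-(s + t))) ≤ z (m + 1 + k) y := by
    intro s t m k y h1 h2
    refine le_trans ?_ (hz m k y)
    rw [neg_add, Real.exp_add, ENNReal.ofReal_mul (Real.exp_pos _).le]
    exact mul_le_mul' h1 h2
  have base : ∀ (n i : ℕ), ENNReal.ofReal (Real.exp (-(C * n))) ≤ z n (T^[i] x) := by
    intro n
    induction n with
    | zero => intro i; simpa using hz0 _
    | succ n ih =>
      intro i
      have h2 := ih (0 + 1 + i)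
      rw [Function.iterate_add_apply] at h2
      have := comb (m := 0) (hC i) h2
      rw [show 0 + 1 + n = n + 1 by omega] at this
      convert this using 4
      push_cast; ring
  have mono : ∀ {s t : ℝ}, s ≤ t →
      ENNReal.ofReal (Real.exp (-t)) ≤ ENNReal.ofReal (Real.exp (-s)) := by
    intro s t h
    exact ENNReal.ofReal_le_ofReal (Real.exp_le_exp.2 (by linarith))
  intro n
  induction n using Nat.strong_induction_on with
  | _ n ih =>
    intro i
    rcases Nat.eq_zero_or_pos n with rfl | hn
    · refine le_trans (mono ?_) (base 0 i)
      simp only [CharP.cast_eq_zero, mul_zero, zero_mul, zero_add]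
      positivity
    by_cases hi : T^[i] x ∈ U
    · obtain ⟨k, rfl⟩ := Nat.exists_eq_add_of_le hn
      have h2 := ih k (by omega) (0 + 1 + i)
      rw [Function.iterate_add_apply] at h2
      have := comb (m := 0) (hC i) h2
      simp only [zero_add] at this
      refine le_trans (mono ?_) this
      rw [bkCnt_add, bkCnt_one]
      simp only [hi, indicator_of_mem]
      push_cast
      nlinarith
    · obtain ⟨m, hm, hq⟩ := hU i hi
      by_cases hmn : m + 1 ≤ n
      · obtain ⟨k, rfl⟩ := Nat.exists_eq_add_of_le hmn
        have h2 := ih k (by omega) (m + 1 + i)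
        rw [Function.iterate_add_apply] at h2
        refine le_trans (mono ?_) (comb hq h2)
        rw [bkCnt_add]
        push_cast
        have : (0 : ℝ) ≤ C * bkCnt T U (m + 1) (T^[i] x) := by positivity
        nlinarith
      · refine le_trans (mono ?_) (base n i)
        have h1 : (n : ℝ) ≤ M := by exact_mod_cast (by omega : n ≤ M)
        have h2 : (0 : ℝ) ≤ C * bkCnt T U n (T^[i] x) := by positivity
        have h3 : C * n ≤ C * M := by gcongr
        have h4 : (0 : ℝ) ≤ n * b := by positivity
        linarith

/-! ### Shannon–McMillan–Breiman -/

/-- lower local entropy along a partition -/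
noncomputable def bkLo {Y ι : Type*} [MeasurableSpace Y] (μ : Measure Y) (T : Y → Y) (p : Y → ι)
    (x : Y) : ℝ≥0∞ := Filter.liminf (fun n : ℕ => nlog (bkJ μ T p n x) / (n : ℝ≥0∞)) atTop

/-- upper local entropy along a partition -/
noncomputable def bkHi {Y ι : Type*} [MeasurableSpace Y] (μ : Measure Y) (T : Y → Y) (p : Y → ι)
    (x : Y) : ℝ≥0∞ := Filter.limsup (fun n : ℕ => nlog (bkJ μ T p n x) / (n : ℝ≥0∞)) atTop

set_option linter.unusedSectionVars false

section smb
variable {Y ι : Type*} [MeasurableSpace Y] {μ : Measure Y} [IsProbabilityMeasure μ]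
  {T : Y → Y} {p : Y → ι}

theorem bk_liminf_shift {u v : ℕ → ℝ≥0∞} (h : ∀ n, u n ≤ v (n + 1)) :
    liminf (fun n => u n / (n : ℝ≥0∞)) atTop ≤ liminf (fun n => v n / (n : ℝ≥0∞)) atTop := by
  refine le_of_forall_gt_imp_ge_of_dense fun c hc => ?_
  obtain ⟨b, hb1, hb2⟩ := exists_between hc
  have hbt : b ≠ ⊤ := (lt_of_lt_of_le hb2 le_top).ne
  rw [← Filter.liminf_nat_add _ 1] at hb1
  have hf := Filter.frequently_lt_of_liminf_lt (by isBoundedDefault) hb1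
  refine Filter.liminf_le_of_frequently_le' ?_
  have hev : ∀ᶠ n : ℕ in atTop, b * ((n + 1 : ℕ) / (n : ℝ≥0∞)) < c := by
    have h1 : Tendsto (fun n : ℕ => ((n + 1 : ℕ) : ℝ≥0∞) / (n : ℝ≥0∞)) atTop (nhds 1) := by
      have h2 : Tendsto (fun n : ℕ => (1 : ℝ≥0∞) + (n : ℝ≥0∞)⁻¹) atTop (nhds (1 + 0)) :=
        tendsto_const_nhds.add ENNReal.tendsto_inv_nat_nhds_zero
      rw [add_zero] at h2
      refine h2.congr' ?_
      filter_upwards [eventually_gt_atTop 0] with n hn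
      push_cast
      rw [ENNReal.add_div, ENNReal.div_self (by simpa using hn.ne') (by simp), one_div]
    have h2 := ENNReal.Tendsto.const_mul h1 (a := b) (Or.inr hbt)
    rw [mul_one] at h2
    exact h2.eventually (gt_mem_nhds hb2)
  refine (hf.and_eventually (hev.and (eventually_gt_atTop 0))).mono ?_
  rintro n ⟨h1, h2, hn⟩
  refine le_trans ?_ h2.le
  have h3 : v (n + 1) ≤ b * (n + 1 : ℕ) := by
    refine (ENNReal.div_le_iff_le_mul (Or.inl ?_) (Or.inl (by simp))).1 h1.le
    simp
  calc u n / n ≤ b * (n + 1 : ℕ) / n := by gcongr; exact (h n).trans h3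
    _ = _ := by rw [mul_div_assoc]

theorem bkJ_succ (hμ : MeasurePreserving T μ μ) (hp : ∀ a, MeasurableSet (p ⁻¹' {a}))
    (n : ℕ) (x : Y) : bkJ μ T p (n + 1) x ≤ bkJ μ T p n (T x) := by
  unfold bkJ bkCm
  rw [← hμ.measure_preimage (bk_cyl_meas hμ.measurable hp n _).nullMeasurableSet]
  refine measure_mono fun y hy => ?_
  simp only [mem_ofPred_eq, funext_iff, bkWord, mem_preimage] at hy ⊢
  intro i
  have := hy i.succ
  simpa using this

theorem bkLo_T (hμ : MeasurePreserving T μ μ) (hp : ∀ a, MeasurableSet (p ⁻¹' {a})) (x : Y) :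
    bkLo μ T p (T x) ≤ bkLo μ T p x :=
  bk_liminf_shift fun n => bk_nlog_anti (bkJ_ne_top _ _) (bkJ_succ hμ hp n x)

theorem bkLo_iter (hμ : MeasurePreserving T μ μ) (hp : ∀ a, MeasurableSet (p ⁻¹' {a})) (i : ℕ)
    (x : Y) : bkLo μ T p (T^[i] x) ≤ bkLo μ T p x := by
  induction i with
  | zero => simp
  | succ i ih => rw [Function.iterate_succ_apply']; exact (bkLo_T hμ hp _).trans ih

theorem bkJ_meas [Fintype ι] (hT : Measurable T) (hp : ∀ a, MeasurableSet (p ⁻¹' {a})) (n : ℕ) :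
    Measurable (fun x => nlog (bkJ μ T p n x)) :=
  bk_fun_word_meas hT hp n fun w => nlog (bkCm μ T p n w)

theorem bkLo_meas [Fintype ι] (hT : Measurable T) (hp : ∀ a, MeasurableSet (p ⁻¹' {a})) :
    Measurable (bkLo μ T p) :=
  Measurable.liminf fun n => (bkJ_meas hT hp n).div_const _

theorem bk_ae_pos [Fintype ι] (hT : Measurable T) (hp : ∀ a, MeasurableSet (p ⁻¹' {a})) (n : ℕ) :
    ∀ᵐ x ∂μ, bkJ μ T p n x ≠ 0 := by
  classical
  rw [ae_iff]
  have := bk_measure_word (μ := μ) hT hp n (Finset.univ.filter fun w => bkCm μ T p n w = 0)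
  simp only [Finset.mem_filter, Finset.mem_univ, true_and] at this
  simp only [ne_eq, not_not, bkJ]
  rw [this]
  exact Finset.sum_eq_zero fun w hw => (Finset.mem_filter.1 hw).2

theorem bk_letter [Fintype ι] (hμ : MeasurePreserving T μ μ)
    (hp : ∀ a, MeasurableSet (p ⁻¹' {a})) :
    ∃ C : ℝ, 0 < C ∧ ∀ᵐ x ∂μ, ∀ i,
      ENNReal.ofReal (Real.exp (-C)) ≤ bkLam 0 * bkJ μ T p 1 (T^[i] x) := by
  have h1 : ∀ w : Fin 1 → ι, ∃ C : ℝ, ∀ C' ≥ C, bkCm μ T p 1 w ≠ 0 →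
      ENNReal.ofReal (Real.exp (-C')) ≤ bkLam 0 * bkCm μ T p 1 w := by
    intro w
    by_cases hw : bkCm μ T p 1 w = 0
    · exact ⟨0, fun _ _ h => absurd hw h⟩
    have hpos : 0 < bkLam 0 * bkCm μ T p 1 w := by
      refine ENNReal.mul_pos ?_ hw
      simp [bkLam]
    have hne : bkLam 0 * bkCm μ T p 1 w ≠ ⊤ := by
      refine ENNReal.mul_ne_top (by simp [bkLam]) ?_
      exact ne_top_of_le_ne_top one_ne_top (bkCm_le_one _ _)
    refine ⟨-Real.log (bkLam 0 * bkCm μ T p 1 w).toReal, fun C' hC' _ => ?_⟩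
    rw [ENNReal.ofReal_le_iff_le_toReal hne, ← Real.le_log_iff_exp_le (ENNReal.toReal_pos hpos.ne' hne)]
    linarith
  choose C hC using h1
  refine ⟨1 + ∑ w, |C w|, by positivity, ?_⟩
  rw [ae_all_iff]
  intro i
  have := (hμ.iterate i).quasiMeasurePreserving.ae (bk_ae_pos (μ := μ) hμ.measurable hp 1)
  filter_upwards [this] with x hx
  refine hC _ _ ?_ hx
  have := Finset.single_le_sum (f := fun w => |C w|) (fun _ _ => abs_nonneg _)
    (Finset.mem_univ (bkWord T p 1 (T^[i] x)))
  have h2 := le_abs_self (C (bkWord T p 1 (T^[i] x)))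
  linarith

theorem bk_smb_eps [Fintype ι] (hμ : MeasurePreserving T μ μ)
    (hp : ∀ a, MeasurableSet (p ⁻¹' {a})) {ε : ℝ} (hε : 0 < ε) :
    ∀ᵐ x ∂μ, bkHi μ T p x ≤ bkLo μ T p x + ENNReal.ofReal (5 * ε) := by
  obtain ⟨L, hL⟩ := bkLam_large hε
  obtain ⟨C, hC0, hC⟩ := bk_letter (p := p) hμ hp
  set U : ℕ → Set Y := fun M => {y | ∀ m, L ≤ m → m + 1 ≤ M →
    ¬ (nlog (bkJ μ T p (m + 1) y) ≤ (m + 1 : ℕ) * (bkLo μ T p y + ENNReal.ofReal ε))} with hUdef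
  have hUm : ∀ M, MeasurableSet (U M) := by
    intro M
    have : U M = ⋂ m, ⋂ (_ : L ≤ m), ⋂ (_ : m + 1 ≤ M),
      {y | nlog (bkJ μ T p (m + 1) y) ≤ (m + 1 : ℕ) * (bkLo μ T p y + ENNReal.ofReal ε)}ᶜ := by
      ext y; simp [hUdef]
    rw [this]
    refine MeasurableSet.iInter fun m => MeasurableSet.iInter fun _ => MeasurableSet.iInter
      fun _ => (measurableSet_le (bkJ_meas hμ.measurable hp _) ?_).compl
    exact ((bkLo_meas hμ.measurable hp).add_const _).const_mul _
  have hUanti : Antitone U := by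
    intro M N hMN y hy m h1 h2
    exact hy m h1 (h2.trans hMN)
  have hUemp : ⋂ M, U M = ∅ := by
    rw [eq_empty_iff_forall_notMem]
    intro y hy
    rw [mem_iInter] at hy
    have hy' : ∀ m, L ≤ m →
        ¬ (nlog (bkJ μ T p (m + 1) y) ≤ (m + 1 : ℕ) * (bkLo μ T p y + ENNReal.ofReal ε)) :=
      fun m hm => hy (m + 1) m hm le_rfl
    by_cases ht : bkLo μ T p y = ⊤
    · refine hy' L le_rfl ?_
      rw [ht, top_add, ENNReal.mul_top (by simp)]
      exact le_top
    · have hlt : bkLo μ T p y < bkLo μ T p y + ENNReal.ofReal ε :=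
        ENNReal.lt_add_right ht (by simpa using hε)
      have hf := Filter.frequently_lt_of_liminf_lt (by isBoundedDefault) hlt
      obtain ⟨n, hn, h1⟩ := (Filter.frequently_atTop.1 hf) (L + 1)
      obtain ⟨m, rfl⟩ : ∃ m, n = m + 1 := ⟨n - 1, by omega⟩
      refine hy' m (by omega) ?_
      rw [mul_comm]
      exact (ENNReal.div_le_iff_le_mul (Or.inl (by simp)) (Or.inl (by simp))).1 h1.le
  have hU0 : Tendsto (fun M => μ (U M)) atTop (nhds 0) := by
    have := tendsto_measure_iInter_atTop (μ := μ) (fun M => (hUm M).nullMeasurableSet) hUanti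
      ⟨0, by finiteness⟩
    rwa [hUemp, measure_empty] at this
  have hbc := bk_bc (μ := μ) hμ.measurable hp
    (fun n w => ENNReal.ofReal (Real.exp (-(n * ε))) * bkZ (bkMl μ T p) n (List.ofFn w))
    (fun n => ENNReal.ofReal (Real.exp (-(n * ε)))) (bk_tsum_exp hε) (by
      intro n
      rw [← Finset.mul_sum]
      refine mul_le_of_le_one_right (zero_le) (bkZ_sum _ ?_ n)
      intro m
      simp_rw [bkMl_ofFn]
      exact (bk_sum_cm hμ.measurable hp m).le)
  filter_upwards [hC, hbc, bk_freq hμ hUm hU0 (show 0 < ε / C by positivity)] with x hCx hbcx hfx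
  by_cases ht : bkLo μ T p x = ⊤
  · simp [ht]
  obtain ⟨M, hM⟩ := hfx
  set a := (bkLo μ T p x).toReal with ha
  have ha' : bkLo μ T p x = ENNReal.ofReal a := (ENNReal.ofReal_toReal ht).symm
  have ha0 : 0 ≤ a := ENNReal.toReal_nonneg
  have hgr := bk_greedy T (fun m y => bkLam (m - 1) * bkJ μ T p m y)
    (fun n y => bkZ (bkMl μ T p) n (List.ofFn (bkWord T p n y)))
    (fun y => by simp [bkZ]) (fun m k y => bkZ_step μ T p m k y) hC0.le
    (show 0 ≤ a + 2 * ε by positivity) (U M) M x hCx (by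
      intro i hi
      simp only [hUdef, mem_ofPred_eq, not_forall, not_not] at hi
      obtain ⟨m, hLm, hmM, hle⟩ := hi
      refine ⟨m, hmM, ?_⟩
      have h1 : nlog (bkJ μ T p (m + 1) (T^[i] x)) ≤ ENNReal.ofReal ((m + 1 : ℕ) * (a + ε)) := by
        refine hle.trans ?_
        rw [ENNReal.ofReal_mul (by positivity), ENNReal.ofReal_natCast, ENNReal.ofReal_add ha0 hε.le,
          ← ha']
        gcongr
        exact bkLo_iter hμ hp i x
      rw [bk_nlog_le_iff (bkJ_ne_top _ _) (by positivity)] at h1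
      have h2 := mul_le_mul' (hL m hLm) h1
      rw [← ENNReal.ofReal_mul (Real.exp_pos _).le, ← Real.exp_add] at h2
      refine le_trans (le_of_eq ?_) h2
      congr 2; ring)
  rw [ha', ← ENNReal.ofReal_add ha0 (by positivity)]
  refine Filter.limsup_le_of_le (by isBoundedDefault) ?_
  obtain ⟨N, hN⟩ := exists_nat_gt (C * M / ε)
  filter_upwards [hbcx, eventually_ge_atTop N, eventually_gt_atTop 0] with n h1 hnN hn
  rw [ENNReal.div_le_iff_le_mul (Or.inl (by simpa using hn.ne')) (Or.inl (by simp)),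
    ← ENNReal.ofReal_natCast, ← ENNReal.ofReal_mul (by positivity),
    bk_nlog_le_iff (bkJ_ne_top _ _) (by positivity)]
  refine le_trans ?_ h1
  have h2 := hgr n 0
  simp only [Function.iterate_zero, id_eq] at h2
  refine le_trans ?_ (mul_le_mul_right h2 _)
  rw [← ENNReal.ofReal_mul (Real.exp_pos _).le, ← Real.exp_add]
  refine ENNReal.ofReal_le_ofReal (Real.exp_le_exp.2 ?_)
  have h3 : C * (bkCnt T (U M) n x : ℝ) ≤ ε * n := by
    have := mul_le_mul_of_nonneg_left (hM n) hC0.le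
    rwa [← mul_assoc, mul_div_cancel₀ _ hC0.ne'] at this
  have h4 : C * M ≤ n * ε := by
    rw [div_lt_iff₀ hε] at hN
    have : (N : ℝ) ≤ n := by exact_mod_cast hnN
    nlinarith
  linarith

theorem bk_smb [Fintype ι] (hμ : MeasurePreserving T μ μ)
    (hp : ∀ a, MeasurableSet (p ⁻¹' {a})) : ∀ᵐ x ∂μ, bkHi μ T p x = bkLo μ T p x := by
  have h : ∀ᵐ x ∂μ, ∀ k : ℕ,
      bkHi μ T p x ≤ bkLo μ T p x + ENNReal.ofReal (5 * (1 / ((k : ℝ) + 1))) := by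
    rw [ae_all_iff]
    intro k
    exact bk_smb_eps hμ hp (by positivity)
  filter_upwards [h] with x hx
  refine le_antisymm ?_ (Filter.liminf_le_limsup)
  have h1 : Tendsto (fun k : ℕ => bkLo μ T p x + ENNReal.ofReal (5 * (1 / ((k : ℝ) + 1)))) atTop
      (nhds (bkLo μ T p x + ENNReal.ofReal (5 * 0))) :=
    tendsto_const_nhds.add (ENNReal.tendsto_ofReal
      (tendsto_one_div_add_atTop_nhds_zero_nat.const_mul 5))
  simp only [mul_zero, ENNReal.ofReal_zero, add_zero] at h1
  exact ge_of_tendsto' h1 hx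

end smb

open Filter Metric Set MeasureTheory ENNReal
set_option linter.unusedSectionVars false

/-! ### Integral of the local entropy along a partition -/

/-- entropy of the refined partition -/
noncomputable def bkH {Y ι : Type*} [Fintype ι] [MeasurableSpace Y] (μ : Measure Y) (T : Y → Y)
    (p : Y → ι) (n : ℕ) : ℝ := ∑ w, Real.negMulLog (bkCm μ T p n w).toReal

section integ
variable {Y ι : Type*} [Fintype ι] [MeasurableSpace Y] {μ : Measure Y} [IsProbabilityMeasure μ]
  {T : Y → Y} {p : Y → ι}

theorem bk_lintegral_word (hT : Measurable T) (hp : ∀ a, MeasurableSet (p ⁻¹' {a}))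
    (n : ℕ) (f : (Fin n → ι) → ℝ≥0∞) :
    ∫⁻ x, f (bkWord T p n x) ∂μ = ∑ w, bkCm μ T p n w * f w := by
  classical
  have : ∀ x, f (bkWord T p n x)
      = ∑ w, {x | bkWord T p n x = w}.indicator (fun _ => f w) x := by
    intro x
    rw [Finset.sum_eq_single (bkWord T p n x)]
    · simp
    · intro b _ hb
      simp [hb.symm]
    · simp
  simp_rw [this]
  rw [lintegral_finsetSum]
  · refine Finset.sum_congr rfl fun w _ => ?_
    rw [lintegral_indicator (bk_cyl_meas hT hp n w)]
    simp [bkCm, mul_comm]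
  · exact fun w _ => measurable_const.indicator (bk_cyl_meas hT hp n w)

theorem bk_mul_nlog {a : ℝ≥0∞} (ha : a ≤ 1) :
    a * nlog a = ENNReal.ofReal (Real.negMulLog a.toReal) := by
  have hat : a ≠ ⊤ := ne_top_of_le_ne_top one_ne_top ha
  by_cases h0 : a = 0
  · simp [h0]
  · simp only [nlog, h0, if_false, Real.negMulLog]
    rw [neg_mul, ← mul_neg, ENNReal.ofReal_mul ENNReal.toReal_nonneg, ENNReal.ofReal_toReal hat]

theorem bk_negMulLog_nonneg (n : ℕ) (w : Fin n → ι) :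
    0 ≤ Real.negMulLog (bkCm μ T p n w).toReal :=
  Real.negMulLog_nonneg ENNReal.toReal_nonneg
    (by simpa using ENNReal.toReal_mono one_ne_top (bkCm_le_one (μ := μ) n w))

theorem bk_lintegral_nlog (hT : Measurable T) (hp : ∀ a, MeasurableSet (p ⁻¹' {a})) {n : ℕ}
    (hn : 0 < n) :
    ∫⁻ x, nlog (bkJ μ T p n x) / (n : ℝ≥0∞) ∂μ = ENNReal.ofReal (bkH μ T p n / n) := by
  have h1 : ∫⁻ x, nlog (bkJ μ T p n x) ∂μ = ENNReal.ofReal (bkH μ T p n) := by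
    rw [bkH, ENNReal.ofReal_sum_of_nonneg (fun w _ => bk_negMulLog_nonneg n w)]
    refine (bk_lintegral_word hT hp n fun w => nlog (bkCm μ T p n w)).trans ?_
    exact Finset.sum_congr rfl fun w _ => bk_mul_nlog (bkCm_le_one _ _)
  simp_rw [div_eq_mul_inv]
  rw [lintegral_mul_const _ (bkJ_meas hT hp n), h1, ← div_eq_mul_inv, ← div_eq_mul_inv,
    ENNReal.ofReal_div_of_pos (by exact_mod_cast hn), ENNReal.ofReal_natCast]

theorem bk_word_append (T : Y → Y) (p : Y → ι) {m n : ℕ} (u : Fin m → ι) (v : Fin n → ι) :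
    {x | bkWord T p (m + n) x = Fin.append u v}
      = {x | bkWord T p m x = u} ∩ T^[m] ⁻¹' {x | bkWord T p n x = v} := by
  ext x
  simp only [mem_ofPred_eq, mem_inter_iff, mem_preimage]
  have e : bkWord T p (m + n) x = Fin.append (bkWord T p m x) (bkWord T p n (T^[m] x)) := by
    funext i
    refine Fin.addCases (fun i => ?_) (fun i => ?_) i
    · simp [bkWord]
    · simp only [bkWord, Fin.append_right, Fin.val_natAdd]
      rw [← Function.iterate_add_apply, add_comm]
  rw [e]
  constructor
  · intro h
    have := (Fin.appendEquiv m n).injective (a₁ := (bkWord T p m x, bkWord T p n (T^[m] x)))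
      (a₂ := (u, v)) h
    exact Prod.mk.inj this
  · rintro ⟨rfl, rfl⟩; rfl

theorem bk_marg_left (hμ : MeasurePreserving T μ μ) (hp : ∀ a, MeasurableSet (p ⁻¹' {a}))
    {m n : ℕ} (u : Fin m → ι) :
    ∑ v : Fin n → ι, bkCm μ T p (m + n) (Fin.append u v) = bkCm μ T p m u := by
  have hT := hμ.measurable
  have hA := bk_cyl_meas hT hp m u
  have h := bk_measure_word (μ := (μ.restrict {x | bkWord T p m x = u}).map T^[m]) hT hp n
    Finset.univ
  simp only [Finset.mem_univ] at h
  rw [show {x : Y | True} = univ from rfl, Measure.map_apply (hT.iterate m) MeasurableSet.univ,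
    preimage_univ, Measure.restrict_apply_univ] at h
  rw [bkCm, h]
  refine Finset.sum_congr rfl fun v _ => ?_
  rw [bkCm, bkCm, bk_word_append, Measure.map_apply (hT.iterate m) (bk_cyl_meas hT hp n v),
    Measure.restrict_apply ((hT.iterate m) (bk_cyl_meas hT hp n v)), inter_comm]

theorem bk_marg_right (hμ : MeasurePreserving T μ μ) (hp : ∀ a, MeasurableSet (p ⁻¹' {a}))
    {m n : ℕ} (v : Fin n → ι) :
    ∑ u : Fin m → ι, bkCm μ T p (m + n) (Fin.append u v) = bkCm μ T p n v := by
  have hT := hμ.measurable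
  have hA := bk_cyl_meas hT hp n v
  have h := bk_measure_word (μ := μ.restrict (T^[m] ⁻¹' {x | bkWord T p n x = v})) hT hp m
    Finset.univ
  simp only [Finset.mem_univ] at h
  rw [show {x : Y | True} = univ from rfl, Measure.restrict_apply_univ,
    (hμ.iterate m).measure_preimage hA.nullMeasurableSet] at h
  rw [bkCm, h]
  refine Finset.sum_congr rfl fun u _ => ?_
  rw [bkCm, bkCm, bk_word_append, Measure.restrict_apply (bk_cyl_meas hT hp m u)]

theorem bk_gibbs {P a b : ℝ} (hP : 0 ≤ P) (ha : P ≤ a) (hb : P ≤ b) :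
    Real.negMulLog P ≤ -(P * Real.log a) - P * Real.log b + (a * b - P) := by
  rcases hP.eq_or_lt with rfl | hP
  · simp; positivity
  have ha' : 0 < a := hP.trans_le ha
  have hb' : 0 < b := hP.trans_le hb
  have h := Real.log_le_sub_one_of_pos (show 0 < a * b / P by positivity)
  rw [Real.log_div (by positivity) hP.ne', Real.log_mul ha'.ne' hb'.ne'] at h
  have h2 := mul_le_mul_of_nonneg_left h hP.le
  have h3 : P * (a * b / P - 1) = a * b - P := by field_simp
  rw [Real.negMulLog]
  linarith

theorem bk_subadd (hμ : MeasurePreserving T μ μ) (hp : ∀ a, MeasurableSet (p ⁻¹' {a})) :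
    Subadditive (bkH μ T p) := by
  intro m n
  have hT := hμ.measurable
  set P : (Fin m → ι) → (Fin n → ι) → ℝ := fun u v => (bkCm μ T p (m + n) (Fin.append u v)).toReal
    with hPdef
  set a : (Fin m → ι) → ℝ := fun u => (bkCm μ T p m u).toReal with hadef
  set b : (Fin n → ι) → ℝ := fun v => (bkCm μ T p n v).toReal with hbdef
  have hfin : ∀ {k} (w : Fin k → ι), bkCm μ T p k w ≠ ⊤ := fun w =>
    ne_top_of_le_ne_top one_ne_top (bkCm_le_one _ w)
  have hP0 : ∀ u v, 0 ≤ P u v := fun _ _ => ENNReal.toReal_nonneg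
  have hl : ∀ u, ∑ v, P u v = a u := by
    intro u
    simp only [hadef]
    rw [← bk_marg_left (n := n) hμ hp u, ENNReal.toReal_sum (fun _ _ => hfin _)]
  have hr : ∀ v, ∑ u, P u v = b v := by
    intro v
    simp only [hbdef]
    rw [← bk_marg_right (m := m) hμ hp v, ENNReal.toReal_sum (fun _ _ => hfin _)]
  have hPa : ∀ u v, P u v ≤ a u := fun u v => by
    rw [← hl u]; exact Finset.single_le_sum (fun v _ => hP0 u v) (Finset.mem_univ v)
  have hPb : ∀ u v, P u v ≤ b v := fun u v => by
    rw [← hr v]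
    exact Finset.single_le_sum (f := fun u => P u v) (fun u _ => hP0 u v) (Finset.mem_univ u)
  have hsa : ∑ u, a u = 1 := by
    rw [hadef, ← ENNReal.toReal_sum (fun _ _ => hfin _), bk_sum_cm hT hp]; simp
  have hsb : ∑ v, b v = 1 := by
    rw [hbdef, ← ENNReal.toReal_sum (fun _ _ => hfin _), bk_sum_cm hT hp]; simp
  have e : bkH μ T p (m + n) = ∑ u, ∑ v, Real.negMulLog (P u v) := by
    rw [bkH, ← (Fin.appendEquiv m n).sum_comp, Fintype.sum_prod_type]
    rfl
  rw [e]
  calc _ ≤ ∑ u, ∑ v, (-(P u v * Real.log (a u)) - P u v * Real.log (b v) + (a u * b v - P u v)) :=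
        Finset.sum_le_sum fun u _ => Finset.sum_le_sum fun v _ => bk_gibbs (hP0 u v) (hPa u v) (hPb u v)
    _ = (∑ u, ∑ v, -(P u v * Real.log (a u))) - (∑ u, ∑ v, P u v * Real.log (b v))
          + ((∑ u, ∑ v, a u * b v) - ∑ u, ∑ v, P u v) := by
        simp only [Finset.sum_add_distrib, Finset.sum_sub_distrib]
    _ = bkH μ T p m + bkH μ T p n := by
        have h1 : ∑ u, ∑ v, -(P u v * Real.log (a u)) = bkH μ T p m := by
          rw [bkH]
          refine Finset.sum_congr rfl fun u _ => ?_
          rw [Finset.sum_neg_distrib, ← Finset.sum_mul, hl, Real.negMulLog]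
          simp [hadef]
        have h2 : ∑ u, ∑ v, P u v * Real.log (b v) = - bkH μ T p n := by
          rw [bkH, Finset.sum_comm, ← Finset.sum_neg_distrib]
          refine Finset.sum_congr rfl fun u _ => ?_
          rw [← Finset.sum_mul, hr, Real.negMulLog]
          simp [hbdef]
        have h3 : ∑ u, ∑ v, a u * b v = 1 := by
          simp_rw [← Finset.mul_sum, hsb, mul_one, hsa]
        have h4 : ∑ u, ∑ v, P u v = 1 := by simp_rw [hl, hsa]
        rw [h1, h2, h3, h4]; ring

theorem bk_int_le (hμ : MeasurePreserving T μ μ) (hp : ∀ a, MeasurableSet (p ⁻¹' {a})) :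
    ∫⁻ x, bkLo μ T p x ∂μ ≤ ⨅ n : ℕ, ENNReal.ofReal (bkH μ T p (n + 1) / (n + 1)) := by
  have hT := hμ.measurable
  refine le_iInf fun k => ?_
  have hbdd : BddBelow (range fun n => bkH μ T p n / n) := by
    refine ⟨0, ?_⟩
    rintro _ ⟨n, rfl⟩
    have : 0 ≤ bkH μ T p n := Finset.sum_nonneg fun w _ => bk_negMulLog_nonneg n w
    positivity
  have hlim := (bk_subadd (p := p) hμ hp).tendsto_lim hbdd
  have hle : (bk_subadd (p := p) hμ hp).lim ≤ bkH μ T p (k + 1) / (k + 1) := by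
    have := (bk_subadd (p := p) hμ hp).lim_le_div hbdd (n := k + 1) (by omega)
    simpa using this
  have h1 : ∫⁻ x, bkLo μ T p x ∂μ ≤ ENNReal.ofReal (bk_subadd (p := p) hμ hp).lim := by
    have hlim' := (ENNReal.tendsto_ofReal hlim)
    rw [← hlim'.liminf_eq]
    refine (lintegral_liminf_le fun n => (bkJ_meas hT hp n).div_const _).trans ?_
    refine le_of_eq (Filter.liminf_congr ?_)
    filter_upwards [eventually_gt_atTop 0] with n hn
    exact bk_lintegral_nlog hT hp hn
  exact h1.trans (ENNReal.ofReal_le_ofReal hle)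

theorem bk_tail {a : ℝ≥0∞} (ha : a ≤ 1) {r : ℝ} (hr : 0 ≤ r) (h : ENNReal.ofReal r < nlog a) :
    a * nlog a ≤ ENNReal.ofReal (2 * Real.exp (-(r / 2))) := by
  have hat : a ≠ ⊤ := ne_top_of_le_ne_top one_ne_top ha
  rw [bk_mul_nlog ha]
  refine ENNReal.ofReal_le_ofReal ?_
  rcases eq_or_ne a 0 with rfl | h0
  · simp; positivity
  have hpos : 0 < a.toReal := ENNReal.toReal_pos h0 hat
  rw [← not_le, bk_nlog_le_iff hat hr, not_le, ENNReal.lt_ofReal_iff_toReal_lt hat] at h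
  have hs : 0 < √a.toReal := Real.sqrt_pos.2 hpos
  have h1 := Real.one_sub_inv_le_log_of_pos hs
  have h2 : Real.log a.toReal = 2 * Real.log (√a.toReal) := by
    rw [Real.log_sqrt hpos.le]; ring
  have h3 : √a.toReal ≤ Real.exp (-(r / 2)) := by
    refine Real.sqrt_le_iff.2 ⟨(Real.exp_pos _).le, ?_⟩
    rw [← Real.exp_nat_mul]
    have e : ((2 : ℕ) : ℝ) * (-(r / 2)) = -r := by push_cast; ring
    rw [e]
    first | exact h.le | (refine h.le.trans (le_of_eq ?_); simp)
  have h4 : a.toReal * (√a.toReal)⁻¹ = √a.toReal := by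
    nth_rewrite 1 [← Real.mul_self_sqrt hpos.le]
    field_simp
  rw [Real.negMulLog, h2]
  nlinarith [mul_le_mul_of_nonneg_left h1 hpos.le]

theorem bk_int_ge (hμ : MeasurePreserving T μ μ) (hp : ∀ a, MeasurableSet (p ⁻¹' {a})) :
    ⨅ n : ℕ, ENNReal.ofReal (bkH μ T p (n + 1) / (n + 1)) ≤ ∫⁻ x, bkLo μ T p x ∂μ := by
  have hT := hμ.measurable
  set D : ℝ := Real.log (Fintype.card ι + 1) + 1 with hD
  have hcard : (0 : ℝ) < Fintype.card ι + 1 := by positivity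
  have hD0 : 0 ≤ D := by
    have : 0 ≤ Real.log (Fintype.card ι + 1 : ℝ) := Real.log_nonneg (by
      have : (0 : ℝ) ≤ Fintype.card ι := by positivity
      linarith)
    positivity
  set v : ℕ → Y → ℝ≥0∞ := fun n x => nlog (bkJ μ T p n x) / (n : ℝ≥0∞) with hv
  have hvm : ∀ n, Measurable (v n) := fun n => (bkJ_meas hT hp n).div_const _
  have hup : ∀ n : ℕ, 0 < n → ∫⁻ x, v n x ∂μ ≤ ∫⁻ x, min (v n x) (ENNReal.ofReal (2 * D)) ∂μ
      + ENNReal.ofReal (2 * Real.exp (-1) ^ n) := by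
    intro n hn
    have hn0 : (n : ℝ≥0∞) ≠ 0 := by simpa using hn.ne'
    set f : (Fin n → ι) → ℝ≥0∞ := fun w =>
      if ENNReal.ofReal (n * (2 * D)) < nlog (bkCm μ T p n w) then nlog (bkCm μ T p n w) else 0
      with hf
    have h1 : ∀ x, v n x ≤ min (v n x) (ENNReal.ofReal (2 * D)) + f (bkWord T p n x) := by
      intro x
      by_cases hx : ENNReal.ofReal (n * (2 * D)) < nlog (bkCm μ T p n (bkWord T p n x))
      · refine le_trans ?_ le_add_self
        simp only [hf, hx, if_true]
        refine ENNReal.div_le_of_le_mul ?_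
        exact le_mul_of_one_le_right (zero_le) (by exact_mod_cast hn)
      · refine le_trans ?_ le_self_add
        refine le_min le_rfl ?_
        refine ENNReal.div_le_of_le_mul ?_
        rw [mul_comm, ← ENNReal.ofReal_natCast, ← ENNReal.ofReal_mul (by positivity)]
        exact not_lt.1 hx
    have h2 : ∫⁻ x, f (bkWord T p n x) ∂μ ≤ ENNReal.ofReal (2 * Real.exp (-1) ^ n) := by
      rw [bk_lintegral_word hT hp]
      have h3 : ∀ w, bkCm μ T p n w * f w ≤ ENNReal.ofReal (2 * Real.exp (-(n * D))) := by
        intro w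
        by_cases hx : ENNReal.ofReal (n * (2 * D)) < nlog (bkCm μ T p n w)
        · simp only [hf, hx, if_true]
          refine (bk_tail (bkCm_le_one _ _) (by positivity) hx).trans (le_of_eq ?_)
          congr 3; ring
        · simp only [hf, hx, if_false, mul_zero]; exact zero_le
      refine (Finset.sum_le_sum fun w _ => h3 w).trans ?_
      rw [Finset.sum_const, nsmul_eq_mul, ← ENNReal.ofReal_natCast,
        ← ENNReal.ofReal_mul (by positivity)]
      refine ENNReal.ofReal_le_ofReal ?_
      have h4 : Real.exp (-(n * D)) = ((Fintype.card ι + 1 : ℝ) ^ n)⁻¹ * Real.exp (-1) ^ n := by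
        rw [← Real.exp_nat_mul, ← Real.exp_log (pow_pos hcard n), ← Real.exp_neg, ← Real.exp_add,
          Real.log_pow, hD]
        congr 1; ring
      have h5 : ((Finset.univ : Finset (Fin n → ι)).card : ℝ) ≤ (Fintype.card ι + 1 : ℝ) ^ n := by
        simp only [Finset.card_univ, Fintype.card_pi, Finset.prod_const, Fintype.card_fin]
        push_cast
        gcongr
        linarith
      have h6 : ((Finset.univ : Finset (Fin n → ι)).card : ℝ) * ((Fintype.card ι + 1 : ℝ) ^ n)⁻¹ ≤ 1 := by
        rw [← div_eq_mul_inv]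
        exact div_le_one_of_le₀ h5 (by positivity)
      rw [h4]
      calc _ = (((Finset.univ : Finset (Fin n → ι)).card : ℝ) * ((Fintype.card ι + 1 : ℝ) ^ n)⁻¹)
            * (2 * Real.exp (-1) ^ n) := by ring
        _ ≤ 1 * (2 * Real.exp (-1) ^ n) := by gcongr
        _ = _ := one_mul _
    calc _ ≤ ∫⁻ x, (min (v n x) (ENNReal.ofReal (2 * D)) + f (bkWord T p n x)) ∂μ :=
          lintegral_mono h1
      _ = _ := lintegral_add_left ((hvm n).min measurable_const) _
      _ ≤ _ := by gcongr
  have hinf : ∀ n : ℕ, 0 < n →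
      ⨅ n : ℕ, ENNReal.ofReal (bkH μ T p (n + 1) / (n + 1)) ≤ ∫⁻ x, v n x ∂μ := by
    intro n hn
    obtain ⟨k, rfl⟩ : ∃ k, n = k + 1 := ⟨n - 1, by omega⟩
    rw [hv, bk_lintegral_nlog hT hp hn]
    refine (iInf_le _ k).trans (le_of_eq ?_)
    push_cast; rfl
  have hr : Tendsto (fun n : ℕ => ENNReal.ofReal (2 * Real.exp (-1) ^ n)) atTop (nhds 0) := by
    have h1 := tendsto_pow_atTop_nhds_zero_of_lt_one (Real.exp_pos (-1)).le
      (Real.exp_lt_one_iff.2 (by norm_num : (-1 : ℝ) < 0))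
    have := ENNReal.tendsto_ofReal (h1.const_mul 2)
    simpa using this
  set I : ℝ≥0∞ := ⨅ n : ℕ, ENNReal.ofReal (bkH μ T p (n + 1) / (n + 1)) with hI
  have hs := ENNReal.Tendsto.sub (tendsto_const_nhds (x := I) (f := atTop)) hr
    (Or.inr zero_ne_top)
  rw [tsub_zero] at hs
  calc I = limsup (fun n : ℕ => I - ENNReal.ofReal (2 * Real.exp (-1) ^ n)) atTop :=
        hs.limsup_eq.symm
    _ ≤ limsup (fun n => ∫⁻ x, min (v n x) (ENNReal.ofReal (2 * D)) ∂μ) atTop := by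
        refine Filter.limsup_le_limsup ?_
        filter_upwards [eventually_gt_atTop 0] with n hn
        exact tsub_le_iff_right.2 ((hinf n hn).trans (hup n hn))
    _ ≤ ∫⁻ x, limsup (fun n => min (v n x) (ENNReal.ofReal (2 * D))) atTop ∂μ := by
        refine limsup_lintegral_le (fun _ => ENNReal.ofReal (2 * D))
          (fun n => (hvm n).min measurable_const) (fun n => ae_of_all _ fun x => min_le_right _ _) ?_
        rw [lintegral_const]; finiteness
    _ ≤ ∫⁻ x, bkLo μ T p x ∂μ := by
        refine lintegral_mono_ae ?_
        filter_upwards [bk_smb (p := p) hμ hp] with x hx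
        rw [← hx]
        exact Filter.limsup_le_limsup (Eventually.of_forall fun n => min_le_left _ _)

theorem bk_int (hμ : MeasurePreserving T μ μ) (hp : ∀ a, MeasurableSet (p ⁻¹' {a})) :
    ∫⁻ x, bkLo μ T p x ∂μ = ⨅ n : ℕ, ENNReal.ofReal (bkH μ T p (n + 1) / (n + 1)) :=
  le_antisymm (bk_int_le hμ hp) (bk_int_ge hμ hp)

end integ

open Filter Metric Set MeasureTheory ENNReal

/-! ### Counting words -/

theorem bk_count {κι : Type*} [Fintype κι] {γ : ℝ} (hγ : 0 < γ) :
    ∃ κ : ℝ, 0 < κ ∧ ∀ (n : ℕ) (S : Finset (Fin n → Option κι)),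
      (∀ w ∈ S, ((Finset.univ.filter fun i => w i ≠ none).card : ℝ) ≤ κ * n) →
      (S.card : ℝ) ≤ Real.exp (γ * n) := by
  classical
  obtain ⟨s, hs0, hs⟩ : ∃ s : ℝ, 0 < s ∧ (Fintype.card κι : ℝ) * Real.exp (-s) ≤ γ / 2 := by
    have h1 : Tendsto (fun s : ℝ => (Fintype.card κι : ℝ) * Real.exp (-s)) atTop (nhds 0) := by
      simpa using (Real.tendsto_exp_neg_atTop_nhds_zero.const_mul (Fintype.card κι : ℝ))
    have h2 := h1.eventually (ge_mem_nhds (show (0 : ℝ) < γ / 2 by positivity))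
    obtain ⟨s, h3, h4⟩ := (h2.and (eventually_gt_atTop 0)).exists
    exact ⟨s, h4, h3⟩
  refine ⟨γ / 2 / s, by positivity, fun n S hS => ?_⟩
  set f : Option κι → ℝ := fun o => if o ≠ none then Real.exp (-s) else 1 with hf
  have hf0 : ∀ o, 0 ≤ f o := fun o => by
    simp only [hf]; split_ifs <;> positivity
  have hsum : ∑ o, f o ≤ Real.exp (γ / 2) := by
    rw [Fintype.sum_option]
    simp only [hf]
    simp only [ne_eq, not_true_eq_false, if_false, reduceCtorEq, not_false_eq_true, if_true,
      Finset.sum_const, Finset.card_univ, nsmul_eq_mul]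
    have := Real.add_one_le_exp (γ / 2)
    linarith
  have hprod : ∀ w ∈ S, Real.exp (-(γ / 2 * n)) ≤ ∏ i, f (w i) := by
    intro w hw
    simp only [hf]
    rw [Finset.prod_ite, Finset.prod_const, Finset.prod_const_one, mul_one, ← Real.exp_nat_mul]
    refine Real.exp_le_exp.2 ?_
    have h := mul_le_mul_of_nonneg_right (hS w hw) hs0.le
    have e : γ / 2 / s * n * s = γ / 2 * n := by field_simp
    rw [e] at h
    linarith
  clear_value f
  have h1 : (S.card : ℝ) * Real.exp (-(γ / 2 * n)) ≤ Real.exp (γ / 2 * n) := by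
    calc _ = ∑ w ∈ S, Real.exp (-(γ / 2 * n)) := by simp
      _ ≤ ∑ w ∈ S, ∏ i, f (w i) := Finset.sum_le_sum hprod
      _ ≤ ∑ w : Fin n → Option κι, ∏ i, f (w i) := Finset.sum_le_sum_of_subset_of_nonneg (Finset.subset_univ _)
          fun w _ _ => Finset.prod_nonneg fun i _ => hf0 _
      _ = (∑ o, f o) ^ n := (Fintype.sum_pow f n).symm
      _ ≤ Real.exp (γ / 2) ^ n := pow_le_pow_left₀ (Finset.sum_nonneg fun o _ => hf0 o) hsum n
      _ = _ := by rw [← Real.exp_nat_mul]; congr 1; ring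
  have h2 : Real.exp (γ * n) = Real.exp (γ / 2 * n) * Real.exp (γ / 2 * n) := by
    rw [← Real.exp_add]; congr 1; ring
  rw [Real.exp_neg, ← div_eq_mul_inv, div_le_iff₀ (Real.exp_pos _)] at h1
  rw [h2]; exact h1

section rel
variable {Y ι κ : Type*} [Fintype ι] [Fintype κ] [MeasurableSpace Y] {μ : Measure Y}
  [IsProbabilityMeasure μ] {T : Y → Y} {p : Y → ι} {q : Y → κ}

open Classical in
theorem bk_rel (hT : Measurable T) (hp : ∀ a, MeasurableSet (p ⁻¹' {a}))
    (hq : ∀ a, MeasurableSet (q ⁻¹' {a})) {γ : ℝ} (hγ : 0 < γ)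
    (rel : ∀ n, (Fin n → ι) → (Fin n → κ) → Prop)
    (hc : ∀ n v, ((Finset.univ.filter fun u => rel n u v).card : ℝ) ≤ Real.exp (γ * n)) :
    ∀ᵐ x ∂μ, ∀ᶠ n : ℕ in atTop, ENNReal.ofReal (Real.exp (-(2 * γ * n))) *
      ∑ v with rel n (bkWord T p n x) v, bkCm μ T q n v ≤ bkJ μ T p n x := by
  refine bk_bc hT hp (fun n u => ENNReal.ofReal (Real.exp (-(2 * γ * n))) *
      ∑ v with rel n u v, bkCm μ T q n v) _ (bk_tsum_exp hγ) fun n => ?_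
  rw [← Finset.mul_sum]
  simp_rw [Finset.sum_filter]
  rw [Finset.sum_comm]
  have h1 : ∀ v, ∑ u : Fin n → ι, (if rel n u v then bkCm μ T q n v else 0)
      ≤ ENNReal.ofReal (Real.exp (γ * n)) * bkCm μ T q n v := by
    intro v
    rw [← Finset.sum_filter, Finset.sum_const, nsmul_eq_mul]
    gcongr
    rw [← ENNReal.ofReal_natCast]
    exact ENNReal.ofReal_le_ofReal (hc n v)
  calc _ ≤ ENNReal.ofReal (Real.exp (-(2 * γ * n))) *
        ∑ v, ENNReal.ofReal (Real.exp (γ * n)) * bkCm μ T q n v := by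
          gcongr with v; exact h1 v
    _ = ENNReal.ofReal (Real.exp (-(2 * γ * n))) * ENNReal.ofReal (Real.exp (γ * n)) := by
        rw [← Finset.mul_sum, bk_sum_cm hT hq, mul_one]
    _ = _ := by
        rw [← ENNReal.ofReal_mul (Real.exp_pos _).le, ← Real.exp_add]; congr 2; ring
    
end rel

/-! ### Feldman–Katok close words -/

def bkClose {ι : Type*} (κ : ℝ) (n : ℕ) (u v : Fin n → ι) : Prop :=
  ∃ k : ℕ, (1 - κ) * n ≤ k ∧ ∃ i j : Fin k → Fin n, StrictMono i ∧ StrictMono j ∧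
    ∀ s, u (i s) = v (j s)

open Classical in
theorem bk_close_count {ι : Type*} [Fintype ι] {γ : ℝ} (hγ : 0 < γ) :
    ∃ κ : ℝ, 0 < κ ∧ ∀ (n : ℕ) (v : Fin n → ι),
      ((Finset.univ.filter fun u => bkClose κ n u v).card : ℝ) ≤ Real.exp (γ * n) := by
  obtain ⟨κ, hκ, H⟩ := bk_count (κι := Bool × Option ι) hγ
  refine ⟨κ / 2, by positivity, fun n v => ?_⟩
  have hch : ∀ u : Fin n → ι, ∃ k : ℕ, ∃ i j : Fin k → Fin n, StrictMono i ∧ StrictMono j ∧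
      (bkClose (κ / 2) n u v → (1 - κ / 2) * n ≤ k ∧ ∀ s, u (i s) = v (j s)) := by
    intro u
    by_cases h : bkClose (κ / 2) n u v
    · obtain ⟨k, hk, i, j, hi, hj, hij⟩ := h
      exact ⟨k, i, j, hi, hj, fun _ => ⟨hk, hij⟩⟩
    · exact ⟨0, Fin.elim0, Fin.elim0, fun a => a.elim0, fun a => a.elim0, fun h' => absurd h' h⟩
  choose k i j hi hj hh using hch
  set e : (Fin n → ι) → (Fin n → Option (Bool × Option ι)) := fun u t =>
    if t ∈ range (i u) ∧ t ∈ range (j u) then none else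
      some (decide (t ∈ range (j u)), if t ∈ range (i u) then none else some (u t)) with he
  set S := Finset.univ.filter fun u => bkClose (κ / 2) n u v with hS
  have hmi : ∀ u t, t ∈ range (i u) ↔ e u t = none ∨ ∃ b, e u t = some (b, none) := by
    intro u t
    simp only [he]
    by_cases h1 : t ∈ range (i u) <;> by_cases h2 : t ∈ range (j u) <;> simp [h1, h2]
  have hmj : ∀ u t, t ∈ range (j u) ↔ e u t = none ∨ ∃ b, e u t = some (true, b) := by
    intro u t
    simp only [he]
    by_cases h1 : t ∈ range (i u) <;> by_cases h2 : t ∈ range (j u) <;> simp [h1, h2]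
  have inj : Set.InjOn e S := by
    intro u hu u' hu' h
    have hu : bkClose (κ / 2) n u v := by simpa [hS] using hu
    have hu' : bkClose (κ / 2) n u' v := by simpa [hS] using hu'
    have ri : range (i u) = range (i u') := by
      ext t; rw [hmi, hmi, h]
    have rj : range (j u) = range (j u') := by
      ext t; rw [hmj, hmj, h]
    have key : ∀ (k k' : ℕ) (a b : Fin k → Fin n) (a' b' : Fin k' → Fin n), StrictMono a →
        StrictMono b → StrictMono a' → StrictMono b' → range a = range a' → range b = range b' →
        (∀ s, u (a s) = v (b s)) → (∀ s, u' (a' s) = v (b' s)) → ∀ s, u (a s) = u' (a s) := by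
      intro k k' a b a' b' ha hb ha' hb' h1 h2 h3 h4
      have hkk : k = k' := by
        have e1 := Set.card_range_of_injective ha.injective
        have e2 := Set.card_range_of_injective ha'.injective
        rw [Fintype.card_fin] at e1 e2
        rw [← e1, ← e2]
        exact Fintype.card_congr (Equiv.setCongr h1)
      subst hkk
      have h5 := (ha.range_inj ha').1 h1
      have h6 := (hb.range_inj hb').1 h2
      subst h5 h6
      intro s; rw [h3, h4]
    have hk' := key _ _ _ _ _ _ (hi u) (hj u) (hi u') (hj u') ri rj (hh u hu).2
      (hh u' hu').2
    funext t
    by_cases h1 : t ∈ range (i u)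
    · obtain ⟨s, rfl⟩ := h1; exact hk' s
    · have h2 : t ∉ range (i u') := by rwa [← ri]
      have h3 := congrFun h t
      simp only [he, h1, h2, false_and, if_false] at h3
      simp at h3
      exact h3.2
  rw [← Finset.card_image_of_injOn inj]
  refine H n _ fun w hw => ?_
  obtain ⟨u, hu, rfl⟩ := Finset.mem_image.1 hw
  have hu : bkClose (κ / 2) n u v := by simpa [hS] using hu
  have hc : ∀ (k : ℕ) (a : Fin k → Fin n), StrictMono a →
      ((Finset.univ.filter fun t => t ∉ range a).card : ℝ) = n - k := by
    intro k a ha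
    have h1 : (Finset.univ.filter fun t => t ∈ range a).card = k := by
      have : (Finset.univ.filter fun t => t ∈ range a) = Finset.univ.image a := by
        ext t; simp
      rw [this, Finset.card_image_of_injective _ ha.injective]; simp
    have h2 := Finset.card_filter_add_card_filter_not (s := (Finset.univ : Finset (Fin n)))
      (fun t => t ∈ range a)
    rw [h1, Finset.card_univ, Fintype.card_fin] at h2
    have h3 : ((k : ℝ) + (Finset.univ.filter fun t => t ∉ range a).card : ℝ) = n := by
      exact_mod_cast h2
    linarith
  have hsub : (Finset.univ.filter fun t => e u t ≠ none) ⊆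
      (Finset.univ.filter fun t => t ∉ range (i u)) ∪ (Finset.univ.filter fun t => t ∉ range (j u)) := by
    intro t ht
    simp only [Finset.mem_filter, Finset.mem_univ, true_and, Finset.mem_union] at ht ⊢
    by_contra hcon
    push Not at hcon
    apply ht
    simp only [he, hcon, and_self, if_true]
  have h1 : ((Finset.univ.filter fun t => e u t ≠ none).card : ℝ) ≤
      (Finset.univ.filter fun t => t ∉ range (i u)).card +
      (Finset.univ.filter fun t => t ∉ range (j u)).card := by
    exact_mod_cast (Finset.card_le_card hsub).trans (Finset.card_union_le _ _)
  rw [hc _ _ (hi u), hc _ _ (hj u)] at h1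
  have := (hh u hu).1
  nlinarith

open Filter Metric Set MeasureTheory ENNReal

theorem bk_fk_match {X : Type*} [MetricSpace X] {T : X → X} {n : ℕ} (hn : 0 < n) {x y : X} {δ : ℝ}
    (h : y ∈ fkBall T n x δ) :
    ∃ k : ℕ, (1 - δ) * n ≤ k ∧ ∃ i j : Fin k → Fin n, StrictMono i ∧ StrictMono j ∧
      ∀ s, dist (T^[(i s : ℕ)] x) (T^[(j s : ℕ)] y) < δ := by
  have hn' : (0 : ℝ) < n := by exact_mod_cast hn
  have hne : {δ : ℝ | 0 < δ ∧ fkF T n δ x y < δ}.Nonempty := by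
    refine ⟨2, by norm_num, ?_⟩
    have : 0 ≤ (fkFit T n 2 x y : ℝ) / n := by positivity
    unfold fkF; linarith
  obtain ⟨δ', ⟨h0, h1⟩, h2⟩ := exists_lt_of_csInf_lt hne h
  have hmem : fkFit T n δ' x y ∈ {k : ℕ | ∃ i j : Fin k → Fin n, StrictMono i ∧ StrictMono j ∧
      ∀ s, dist (T^[(i s : ℕ)] x) (T^[(j s : ℕ)] y) < δ'} := by
    refine Nat.sSup_mem ⟨0, Fin.elim0, Fin.elim0, fun a => a.elim0, fun a => a.elim0,
      fun a => a.elim0⟩ ⟨n, ?_⟩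
    rintro k ⟨i, -, hi, -⟩
    simpa using Fintype.card_le_of_injective i hi.injective
  obtain ⟨i, j, hi, hj, hij⟩ := hmem
  refine ⟨_, ?_, i, j, hi, hj, fun s => (hij s).trans h2⟩
  unfold fkF at h1
  have : 1 - δ ≤ (fkFit T n δ' x y : ℝ) / n := by linarith
  exact (le_div_iff₀ hn').1 this

section fk
variable {X ι : Type*} [MetricSpace X] [Fintype ι] [MeasurableSpace X] [BorelSpace X]
  {μ : Measure X} [IsProbabilityMeasure μ] {T : X → X} {p : X → ι}

theorem bk_fk_close {M : ℕ} {κ δ : ℝ} {n : ℕ} (hn : 0 < n) {x y : X}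
    (hcnt : (bkCnt T {x | ∃ y, dist x y < 1 / ((M : ℝ) + 1) ∧ p y ≠ p x} n x : ℝ) ≤ κ / 2 * n)
    (hδ1 : δ ≤ 1 / ((M : ℝ) + 1)) (hδ2 : δ ≤ κ / 2) (h : y ∈ fkBall T n x δ) :
    bkClose κ n (bkWord T p n x) (bkWord T p n y) := by
  classical
  obtain ⟨k, hk, i, j, hi, hj, hij⟩ := bk_fk_match hn h
  set U : Set X := {x | ∃ y, dist x y < 1 / ((M : ℝ) + 1) ∧ p y ≠ p x} with hU
  set G : Finset (Fin k) := Finset.univ.filter fun s => ¬ T^[(i s : ℕ)] x ∈ U with hG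
  set B : Finset (Fin k) := Finset.univ.filter fun s => T^[(i s : ℕ)] x ∈ U with hB
  have hBc : (B.card : ℝ) ≤ κ / 2 * n := by
    refine le_trans ?_ hcnt
    rw [bkCnt_eq_card]
    norm_cast
    refine Finset.card_le_card_of_injOn i ?_ hi.injective.injOn
    intro s hs
    simpa [hB] using hs
  have hGB : (B.card : ℝ) + G.card = k := by
    have := Finset.card_filter_add_card_filter_not (s := (Finset.univ : Finset (Fin k)))
      (fun s => T^[(i s : ℕ)] x ∈ U)
    rw [Finset.card_univ, Fintype.card_fin] at this
    exact_mod_cast this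
  refine ⟨G.card, ?_, i ∘ G.orderEmbOfFin rfl, j ∘ G.orderEmbOfFin rfl,
    hi.comp (OrderEmbedding.strictMono _), hj.comp (OrderEmbedding.strictMono _), fun s => ?_⟩
  · have hn' : (0 : ℝ) < n := by exact_mod_cast hn
    nlinarith
  · have hs := Finset.orderEmbOfFin_mem G rfl s
    have hs2 : T^[(i (G.orderEmbOfFin rfl s) : ℕ)] x ∉ U := by
      simpa only [hG, Finset.mem_filter, Finset.mem_univ, true_and] using hs
    by_contra hcon
    exact hs2 ⟨_, (hij _).trans_le hδ1, fun e => hcon e.symm⟩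

theorem bk_bad_meas (hp : ∀ a, MeasurableSet (p ⁻¹' {a})) (r : ℝ) :
    MeasurableSet {x | ∃ y, dist x y < r ∧ p y ≠ p x} := by
  have : {x | ∃ y, dist x y < r ∧ p y ≠ p x} =
      ⋃ a, (p ⁻¹' {a} ∩ thickening r {y | p y ≠ a}) := by
    ext x
    simp only [mem_iUnion, mem_inter_iff, mem_preimage, mem_singleton_iff, mem_thickening_iff]
    constructor
    · rintro ⟨y, h1, h2⟩; exact ⟨p x, rfl, y, h2, h1⟩
    · rintro ⟨a, rfl, y, h2, h1⟩; exact ⟨y, h1, h2⟩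
  rw [this]
  exact MeasurableSet.iUnion fun a => (hp a).inter isOpen_thickening.measurableSet

theorem bk_bad_tendsto (hp : ∀ a, MeasurableSet (p ⁻¹' {a}))
    (hloc : ∀ᵐ x ∂μ, ∀ᶠ y in nhds x, p y = p x) :
    Tendsto (fun M : ℕ => μ {x | ∃ y, dist x y < 1 / ((M : ℝ) + 1) ∧ p y ≠ p x}) atTop (nhds 0) := by
  have h := tendsto_measure_iInter_atTop (μ := μ)
    (s := fun M : ℕ => {x | ∃ y, dist x y < 1 / ((M : ℝ) + 1) ∧ p y ≠ p x})
    (fun M => (bk_bad_meas hp _).nullMeasurableSet) (by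
      intro M N hMN x hx
      obtain ⟨y, h1, h2⟩ := hx
      refine ⟨y, h1.trans_le ?_, h2⟩
      exact one_div_le_one_div_of_le (by positivity) (by
        have : (M : ℝ) ≤ N := by exact_mod_cast hMN
        linarith)) ⟨0, measure_ne_top _ _⟩
  have h0 : μ (⋂ M : ℕ, {x | ∃ y, dist x y < 1 / ((M : ℝ) + 1) ∧ p y ≠ p x}) = 0 := by
    rw [measure_eq_zero_iff_ae_notMem]
    filter_upwards [hloc] with x hx hmem
    obtain ⟨ε, hε, hb⟩ := Metric.eventually_nhds_iff.1 hx
    obtain ⟨M, hM⟩ := exists_nat_one_div_lt hε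
    obtain ⟨y, h1, h2⟩ := mem_iInter.1 hmem M
    exact h2 (hb (by rw [dist_comm]; exact h1.trans hM))
  rw [h0] at h
  exact h

theorem bk_fk_lower (hμ : MeasurePreserving T μ μ) (hp : ∀ a, MeasurableSet (p ⁻¹' {a}))
    (hloc : ∀ᵐ x ∂μ, ∀ᶠ y in nhds x, p y = p x) {γ : ℝ} (hγ : 0 < γ) :
    ∀ᵐ x ∂μ, ∃ δ : ℝ, 0 < δ ∧ ∀ᶠ n : ℕ in atTop,
      nlog (bkJ μ T p n x) ≤ nlog (μ (fkBall T n x δ)) + ENNReal.ofReal (2 * γ * n) := by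
  classical
  obtain ⟨κ, hκ, hc⟩ := bk_close_count (ι := ι) hγ
  have hrel := bk_rel (μ := μ) (T := T) (p := p) (q := p) hμ.measurable hp hp hγ
    (fun n u v => bkClose κ n u v) hc
  filter_upwards [hrel, bk_freq hμ (fun M => bk_bad_meas hp _) (bk_bad_tendsto (μ := μ) hp hloc)
    (half_pos hκ)] with x hx1 ⟨M, hM⟩
  have hM0 : (0 : ℝ) < 1 / ((M : ℝ) + 1) := by positivity
  refine ⟨min (1 / ((M : ℝ) + 1)) (κ / 2), lt_min hM0 (half_pos hκ), ?_⟩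
  filter_upwards [hx1, eventually_gt_atTop 0] with n h1 hn
  refine bk_nlog_le_add prob_le_one (bkJ_ne_top n x) (by positivity) (le_trans ?_ h1)
  gcongr
  rw [← bk_measure_word hμ.measurable hp]
  refine measure_mono fun y hy => ?_
  simp only [Finset.mem_filter, Finset.mem_univ, true_and, mem_ofPred_eq]
  exact bk_fk_close hn (hM n) (min_le_left _ _) (min_le_right _ _) hy

/-- liminf version -/
theorem bk_fk_lower_liminf (hμ : MeasurePreserving T μ μ) (hp : ∀ a, MeasurableSet (p ⁻¹' {a}))
    (hloc : ∀ᵐ x ∂μ, ∀ᶠ y in nhds x, p y = p x) :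
    ∀ᵐ x ∂μ, bkLo μ T p x ≤ ⨆ (δ : ℝ) (_ : 0 < δ),
      liminf (fun n : ℕ => nlog (μ (fkBall T n x δ)) / (n : ℝ≥0∞)) atTop := by
  have h : ∀ m : ℕ, _ := fun m => bk_fk_lower (μ := μ) hμ hp hloc
    (γ := 1 / ((m : ℝ) + 1)) (by positivity)
  filter_upwards [ae_all_iff.2 h] with x hx
  have key : ∀ m : ℕ, bkLo μ T p x ≤ (⨆ (δ : ℝ) (_ : 0 < δ),
      liminf (fun n : ℕ => nlog (μ (fkBall T n x δ)) / (n : ℝ≥0∞)) atTop)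
        + ENNReal.ofReal (2 * (1 / ((m : ℝ) + 1))) := by
    intro m
    obtain ⟨δ, hδ, hn⟩ := hx m
    refine le_trans ?_ (add_le_add_left (le_iSup₂ (f := fun (δ : ℝ) (_ : 0 < δ) =>
      liminf (fun n : ℕ => nlog (μ (fkBall T n x δ)) / (n : ℝ≥0∞)) atTop) δ hδ) _)
    set c := ENNReal.ofReal (2 * (1 / ((m : ℝ) + 1)))
    have hcont : liminf (fun n : ℕ => nlog (μ (fkBall T n x δ)) / (n : ℝ≥0∞)) atTop + c
        = liminf (fun n : ℕ => nlog (μ (fkBall T n x δ)) / (n : ℝ≥0∞) + c) atTop :=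
      Monotone.map_liminf_of_continuousAt (F := atTop) (f := fun a : ℝ≥0∞ => a + c)
        (fun a b h => by dsimp only; gcongr) _ (by fun_prop) (by isBoundedDefault)
        (by isBoundedDefault)
    rw [hcont]
    refine liminf_le_liminf ?_
    filter_upwards [hn, eventually_gt_atTop 0] with n h1 h0
    have hn0 : (n : ℝ≥0∞) ≠ 0 := by simpa using h0.ne'
    refine (ENNReal.div_le_div_right h1 _).trans (le_of_eq ?_)
    rw [ENNReal.add_div]
    congr 1
    rw [ENNReal.ofReal_mul (by positivity), ENNReal.ofReal_natCast,
      ENNReal.mul_div_cancel_right hn0 (by simp)]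
  refine ENNReal.le_of_forall_pos_le_add fun ε hε _ => ?_
  obtain ⟨m, hm⟩ := exists_nat_one_div_lt (show (0 : ℝ) < ε / 2 by positivity)
  refine (key m).trans ?_
  gcongr
  rw [← ENNReal.ofReal_coe_nnreal]
  exact ENNReal.ofReal_le_ofReal (by linarith)

end fk

open Filter Metric Set MeasureTheory ENNReal

section cmp
variable {X κ : Type*} [MetricSpace X] [CompactSpace X] [Fintype κ] [MeasurableSpace X] [BorelSpace X]
  {μ : Measure X} [IsProbabilityMeasure μ] {T : X → X} {q : X → κ}

theorem bk_sep (hq : ∀ a, MeasurableSet (q ⁻¹' {a})) {ε : ℝ≥0∞} (hε : ε ≠ 0) :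
    ∃ U : Set X, MeasurableSet U ∧ μ U ≤ ε ∧ ∃ r : ℝ, 0 < r ∧
      ∀ x y, x ∉ U → y ∉ U → dist x y < r → q x = q y := by
  set c : ℝ≥0∞ := ε / ((Fintype.card κ : ℝ≥0∞) + 1) with hc
  have hc0 : c ≠ 0 := ENNReal.div_ne_zero.2 ⟨hε, by finiteness⟩
  choose F hFs hFc hFm using fun a => (hq a).exists_isClosed_sdiff_lt (μ := μ)
    (measure_ne_top _ _) hc0
  refine ⟨(⋃ a, F a)ᶜ, (MeasurableSet.iUnion fun a => (hFc a).measurableSet).compl, ?_, ?_⟩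
  · have hsub : (⋃ a, F a)ᶜ ⊆ ⋃ a, (q ⁻¹' {a} \ F a) := by
      intro x hx
      simp only [mem_compl_iff, mem_iUnion, not_exists] at hx
      exact mem_iUnion.2 ⟨q x, rfl, hx _⟩
    refine (measure_mono hsub).trans ((measure_iUnion_fintype_le _ _).trans ?_)
    refine (Finset.sum_le_sum fun a _ => (hFm a).le).trans ?_
    rw [Finset.sum_const, Finset.card_univ, nsmul_eq_mul, hc, mul_comm]
    calc _ ≤ ε / ((Fintype.card κ : ℝ≥0∞) + 1) * ((Fintype.card κ : ℝ≥0∞) + 1) := by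
          gcongr; exact le_self_add
      _ ≤ ε := (ENNReal.div_mul_cancel (by simp) (by finiteness)).le
  · have h1 : ∀ a b, a ≠ b → ∀ᶠ r : ℝ in nhdsWithin 0 (Ioi 0), ∀ x ∈ F a, ∀ y ∈ F b,
        r ≤ dist x y := by
      intro a b hab
      have hdis : Disjoint (F a) (F b) := by
        refine Disjoint.mono (hFs a) (hFs b) ?_
        exact (Set.disjoint_singleton.2 hab).preimage q
      obtain ⟨r, hr, h⟩ := Metric.exists_pos_forall_lt_edist (hFc a).isCompact (hFc b) hdis
      have hr' : (0 : ℝ) < r := by exact_mod_cast hr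
      filter_upwards [Ioo_mem_nhdsGT hr'] with s hs x hx y hy
      have := h x hx y hy
      rw [edist_dist, ENNReal.lt_ofReal_iff_toReal_lt (by simp)] at this
      exact hs.2.le.trans (by simpa using this.le)
    have h2 : ∀ᶠ r : ℝ in nhdsWithin 0 (Ioi 0), ∀ a b, a ≠ b → ∀ x ∈ F a, ∀ y ∈ F b,
        r ≤ dist x y := by
      refine eventually_all.2 fun a => eventually_all.2 fun b => ?_
      by_cases hab : a = b
      · exact Eventually.of_forall fun r h => absurd hab h
      · filter_upwards [h1 a b hab] with r hr _ using hr
    obtain ⟨r, hr, hr0⟩ := (h2.and self_mem_nhdsWithin).exists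
    refine ⟨r, hr0, fun x y hx hy hd => ?_⟩
    simp only [mem_compl_iff, mem_iUnion, not_not] at hx hy
    obtain ⟨a, ha⟩ := hx
    obtain ⟨b, hb⟩ := hy
    have e1 : q x = a := hFs a ha
    have e2 : q y = b := hFs b hb
    by_contra hne
    rw [e1, e2] at hne
    exact absurd hd (not_lt.2 (hr a b hne x ha y hb))

theorem bk_cmp_rel {ι : Type*} [Fintype ι] {R : X → ι} (hT : Measurable T)
    (hq : ∀ a, MeasurableSet (q ⁻¹' {a})) (hR : ∀ a, MeasurableSet (R ⁻¹' {a})) {γ : ℝ} (hγ : 0 < γ)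
    {U : Set X} (hUR : ∀ x y, x ∉ U → y ∉ U → R x = R y → q x = q y) {η : ℝ}
    (hη : ∀ (n : ℕ) (S : Finset (Fin n → Option κ)),
      (∀ w ∈ S, ((Finset.univ.filter fun i => w i ≠ none).card : ℝ) ≤ η * n) →
      (S.card : ℝ) ≤ Real.exp (γ * n)) :
    ∀ᵐ x ∂μ, (∀ n, (bkCnt T U n x : ℝ) ≤ η * n) → ∀ᶠ n : ℕ in atTop,
      nlog (bkJ μ T q n x) ≤ nlog (bkJ μ T R n x) + ENNReal.ofReal (2 * γ * n) := by
  classical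
  set rel : ∀ n, (Fin n → κ) → (Fin n → ι) → Prop := fun n v A =>
    ∃ x, bkWord T q n x = v ∧ bkWord T R n x = A ∧ (bkCnt T U n x : ℝ) ≤ η * n with hrel
  have hcount : ∀ n A, ((Finset.univ.filter fun v => rel n v A).card : ℝ) ≤ Real.exp (γ * n) := by
    intro n A
    rcases isEmpty_or_nonempty X with hX | hX
    · have : (Finset.univ.filter fun v => rel n v A) = ∅ := by
        ext v
        simp only [hrel, Finset.mem_filter, Finset.notMem_empty, iff_false, not_and]
        rintro - ⟨x, -⟩
        exact hX.elim x
      rw [this]; simp [Real.exp_nonneg]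
    have hch : ∀ v, ∃ x, rel n v A → bkWord T q n x = v ∧ bkWord T R n x = A ∧
        (bkCnt T U n x : ℝ) ≤ η * n := by
      intro v
      by_cases h : rel n v A
      · obtain ⟨x, hx⟩ := h; exact ⟨x, fun _ => hx⟩
      · exact ⟨Classical.arbitrary X, fun h' => absurd h' h⟩
    choose z hz using hch
    set e : (Fin n → κ) → (Fin n → Option κ) := fun v t =>
      if T^[(t : ℕ)] (z v) ∈ U then some (v t) else none with he
    set S := Finset.univ.filter fun v => rel n v A with hS
    have inj : Set.InjOn e S := by
      intro v hv v' hv' h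
      have hv : rel n v A := (Finset.mem_filter.1 (Finset.mem_coe.1 hv)).2
      have hv' : rel n v' A := (Finset.mem_filter.1 (Finset.mem_coe.1 hv')).2
      obtain ⟨a1, a2, -⟩ := hz v hv
      obtain ⟨b1, b2, -⟩ := hz v' hv'
      funext t
      have ht := congrFun h t
      simp only [he] at ht
      split_ifs at ht with c1 c2 c2
      · simpa using ht
      · have c3 := hUR _ _ c1 c2 ((congrFun a2 t).trans (congrFun b2 t).symm)
        rw [← congrFun a1 t, ← congrFun b1 t]
        exact c3
    rw [← Finset.card_image_of_injOn inj]
    refine hη n _ fun w hw => ?_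
    obtain ⟨v, hv, rfl⟩ := Finset.mem_image.1 hw
    have hv : rel n v A := by
      simpa only [hS, Finset.mem_filter, Finset.mem_univ, true_and] using hv
    refine le_trans ?_ (hz v hv).2.2
    rw [bkCnt_eq_card]
    norm_cast
    refine Finset.card_le_card fun t ht => ?_
    simp only [he, Finset.mem_filter, Finset.mem_univ, true_and] at ht ⊢
    by_contra hcon
    simp [hcon] at ht
  filter_upwards [bk_rel (μ := μ) (T := T) hT hq hR hγ rel hcount] with x hx hcnt
  filter_upwards [hx] with n hn
  refine bk_nlog_le_add (bkJ_le_one n x) (bkJ_ne_top n x) (by positivity) (le_trans ?_ hn)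
  gcongr
  refine Finset.single_le_sum (f := fun v => bkCm μ T R n v) (fun _ _ => zero_le) ?_
  simp only [Finset.mem_filter, Finset.mem_univ, true_and]
  exact ⟨x, rfl, rfl, hcnt n⟩

theorem bk_cmp {ι : ℕ → Type*} [∀ k, Fintype (ι k)] {R : ∀ k, X → ι k}
    (hμ : MeasurePreserving T μ μ)
    (hq : ∀ a, MeasurableSet (q ⁻¹' {a})) (hR : ∀ k a, MeasurableSet (R k ⁻¹' {a}))
    (hfine : ∀ ε : ℝ, 0 < ε → ∃ k, ∀ x y, R k x = R k y → dist x y < ε) :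
    ∀ᵐ x ∂μ, bkHi μ T q x ≤ ⨆ k, bkHi μ T (R k) x := by
  have hstep : ∀ m : ℕ, ∀ᵐ x ∂μ, bkHi μ T q x ≤ (⨆ k, bkHi μ T (R k) x)
      + ENNReal.ofReal (2 * (1 / ((m : ℝ) + 1))) := by
    intro m
    have hγ : (0 : ℝ) < 1 / ((m : ℝ) + 1) := by positivity
    obtain ⟨η, hη0, hη⟩ := bk_count (κι := κ) hγ
    have hsep := fun M : ℕ => bk_sep (μ := μ) hq (ε := ENNReal.ofReal (1 / ((M : ℝ) + 1))) (by
      have : (0 : ℝ) < 1 / ((M : ℝ) + 1) := by positivity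
      simpa using this)
    choose U hUm hUμ r hr hU using hsep
    choose k hk using fun M => hfine (r M) (hr M)
    have hall : ∀ M, _ := fun M => bk_cmp_rel (μ := μ) (R := R (k M)) (U := U M) hμ.measurable hq
      (hR (k M)) hγ (fun x y hx hy h => hU M x y hx hy (hk M x y h)) hη
    have h0 : Tendsto (fun M => μ (U M)) atTop (nhds 0) := by
      refine tendsto_of_tendsto_of_tendsto_of_le_of_le tendsto_const_nhds ?_
        (fun _ => zero_le) hUμ
      simpa using ENNReal.tendsto_ofReal (tendsto_one_div_add_atTop_nhds_zero_nat (𝕜 := ℝ))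
    filter_upwards [ae_all_iff.2 hall, bk_freq hμ hUm h0 hη0] with x hx ⟨M, hM⟩
    refine le_trans ?_ (add_le_add_left (le_iSup (fun k => bkHi μ T (R k) x) (k M)) _)
    set c := ENNReal.ofReal (2 * (1 / ((m : ℝ) + 1)))
    have hcont : bkHi μ T (R (k M)) x + c
        = limsup (fun n : ℕ => nlog (bkJ μ T (R (k M)) n x) / (n : ℝ≥0∞) + c) atTop :=
      Monotone.map_limsup_of_continuousAt (F := atTop) (f := fun a : ℝ≥0∞ => a + c)
        (fun a b h => by dsimp only; gcongr) _ (by fun_prop) (by isBoundedDefault)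
        (by isBoundedDefault)
    rw [hcont]
    refine limsup_le_limsup ?_
    filter_upwards [hx M hM, eventually_gt_atTop 0] with n h1 h0
    have hn0 : (n : ℝ≥0∞) ≠ 0 := by simpa using h0.ne'
    refine (ENNReal.div_le_div_right h1 _).trans (le_of_eq ?_)
    rw [ENNReal.add_div]
    congr 1
    rw [ENNReal.ofReal_mul (by positivity), ENNReal.ofReal_natCast,
      ENNReal.mul_div_cancel_right hn0 (by simp)]
  filter_upwards [ae_all_iff.2 hstep] with x key
  refine ENNReal.le_of_forall_pos_le_add fun ε hε _ => ?_
  obtain ⟨m, hm⟩ := exists_nat_one_div_lt (show (0 : ℝ) < ε / 2 by positivity)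
  refine (key m).trans ?_
  gcongr
  rw [← ENNReal.ofReal_coe_nnreal]
  exact ENNReal.ofReal_le_ofReal (by linarith)

end cmp

open Filter Metric Set MeasureTheory ENNReal

theorem bk_null_sphere {X : Type*} [MetricSpace X] [MeasurableSpace X] [BorelSpace X]
    (μ : Measure X) [IsProbabilityMeasure μ] (c : X) {ε : ℝ} (hε : 0 < ε) :
    ∃ r : ℝ, 0 < r ∧ r < ε ∧ μ {x | dist x c = r} = 0 := by
  have hcount := Measure.countable_meas_level_set_pos (μ := μ) (g := fun x => dist x c)
    (by fun_prop)
  have hv : (Ioo 0 ε \ {t : ℝ | 0 < μ {a | dist a c = t}}).Nonempty := by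
    by_contra hcon
    rw [Set.not_nonempty_iff_eq_empty, sdiff_eq_empty] at hcon
    exact (Cardinal.Real.Ioo_countable_iff.1 (hcount.mono hcon)).not_gt hε
  obtain ⟨r, ⟨h1, h2⟩, h3⟩ := hv
  refine ⟨r, h1, h2, ?_⟩
  simpa using h3

theorem bk_part {X : Type*} [MetricSpace X] [CompactSpace X] [MeasurableSpace X] [BorelSpace X]
    (μ : Measure X) [IsProbabilityMeasure μ] {ε : ℝ} (hε : 0 < ε) :
    ∃ (m : ℕ) (q : X → Fin m), (∀ a, MeasurableSet (q ⁻¹' {a})) ∧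
      (∀ᵐ x ∂μ, ∀ᶠ y in nhds x, q y = q x) ∧ ∀ x y, q x = q y → dist x y < ε := by
  classical
  choose r hr0 hr1 hr2 using fun c => bk_null_sphere μ c (half_pos hε)
  obtain ⟨t, -, ht⟩ := isCompact_univ.elim_nhds_subcover (fun c : X => ball c (r c))
    (fun c _ => ball_mem_nhds c (hr0 c))
  set q' : X → (t → Bool) := fun x c => decide (dist x c < r c) with hq'
  have hm : Measurable q' := by
    refine measurable_pi_iff.2 fun c => measurable_to_bool ?_
    have : (fun x => q' x c) ⁻¹' {true} = ball (c : X) (r c) := by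
      ext x; simp [hq']
    rw [this]; exact measurableSet_ball
  have e := Fintype.equivFin (t → Bool)
  refine ⟨_, fun x => e (q' x), fun a => ?_, ?_, fun x y h => ?_⟩
  · have : (fun x => e (q' x)) ⁻¹' {a} = q' ⁻¹' {e.symm a} := by
      ext x; simp [Equiv.eq_symm_apply]
    rw [this]
    exact hm (measurableSet_singleton _)
  · have : ∀ᵐ x ∂μ, ∀ c : t, dist x (c : X) ≠ r c := by
      refine ae_all_iff.2 fun c => ?_
      rw [ae_iff]; simpa using hr2 c
    filter_upwards [this] with x hx
    have h1 : ∀ᶠ y in nhds x, ∀ c : t, q' y c = q' x c := by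
      refine eventually_all.2 fun c => ?_
      have hc : ContinuousAt (fun y => dist y (c : X)) x := by fun_prop
      rcases lt_or_gt_of_ne (hx c) with h | h
      · filter_upwards [hc.eventually (gt_mem_nhds h)] with y hy
        simp [hq', hy, h]
      · filter_upwards [hc.eventually (lt_mem_nhds h)] with y hy
        have hy' : r c < dist y (c : X) := hy
        have a1 : ¬ dist y (c : X) < r c := not_lt.2 hy'.le
        have a2 : ¬ dist x (c : X) < r c := not_lt.2 h.le
        simp only [hq', a1, a2]
    filter_upwards [h1] with y hy
    rw [funext hy]
  · have h' : q' x = q' y := e.injective h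
    obtain ⟨c, hc, hxc⟩ := mem_iUnion₂.1 (ht (mem_univ x))
    have h1 := congrFun h' ⟨c, hc⟩
    have hx : dist x c < r c := hxc
    have hy : dist y c < r c := by
      simp only [hq', hx, decide_true] at h1
      simpa using h1.symm
    have := dist_triangle_right x y c
    have := hr1 c
    linarith

/-- A refining sequence of nice finite partitions. -/
theorem bk_parts {X : Type*} [MetricSpace X] [CompactSpace X] [MeasurableSpace X] [BorelSpace X]
    (μ : Measure X) [IsProbabilityMeasure μ] :
    ∃ (m : ℕ → ℕ) (R : ∀ k : ℕ, X → (∀ i : Fin k, Fin (m i))),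
      (∀ k a, MeasurableSet (R k ⁻¹' {a})) ∧
      (∀ k, ∀ᵐ x ∂μ, ∀ᶠ y in nhds x, R k y = R k x) ∧
      (∀ ε : ℝ, 0 < ε → ∃ k, ∀ x y, R k x = R k y → dist x y < ε) ∧
      (∀ k l, k ≤ l → ∀ x y, R l x = R l y → R k x = R k y) := by
  have h := fun i : ℕ => bk_part μ (ε := 1 / ((i : ℝ) + 1)) (by positivity)
  choose m q hm hl hd using h
  refine ⟨m, fun k x i => q i x, fun k a => ?_, fun k => ?_, fun ε hε => ?_, fun k l hkl x y h => ?_⟩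
  · have : (fun x (i : Fin k) => q i x) ⁻¹' {a} = ⋂ i : Fin k, q i ⁻¹' {a i} := by
      ext x; simp [funext_iff]
    rw [this]
    exact MeasurableSet.iInter fun i => hm _ _
  · filter_upwards [ae_all_iff.2 hl] with x hx
    have : ∀ᶠ y in nhds x, ∀ i : Fin k, q i y = q i x := eventually_all.2 fun i => hx i
    filter_upwards [this] with y hy
    funext i; exact hy i
  · obtain ⟨k, hk⟩ := exists_nat_one_div_lt hε
    refine ⟨k + 1, fun x y h => (hd k x y ?_).trans hk⟩
    exact congrFun h (Fin.last k)
  · funext i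
    exact congrFun h ⟨i, i.2.trans_le hkl⟩

section bowen
variable {X : Type*} [MetricSpace X] [MeasurableSpace X] {μ : Measure X} [IsProbabilityMeasure μ]
  {T : X → X}

theorem bk_bowen_upper {ι : Type*} {p : X → ι} {δ : ℝ} (h : ∀ x y, p x = p y → dist x y < δ) (x : X) :
    limsup (fun n : ℕ => nlog (μ (bowenBall T n x δ)) / (n : ℝ≥0∞)) atTop ≤ bkHi μ T p x := by
  refine limsup_le_limsup (Eventually.of_forall fun n => ?_)
  refine ENNReal.div_le_div_right (bk_nlog_anti (measure_ne_top _ _) (measure_mono ?_)) _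
  intro y hy i hi
  exact h _ _ (congrFun (show bkWord T p n y = bkWord T p n x from hy) ⟨i, hi⟩).symm

theorem bk_bowen_sub_fk {T : X → X} {n : ℕ} (hn : 0 < n) {x : X} {δ : ℝ} :
    bowenBall T n x δ ⊆ fkBall T n x δ := by
  intro y hy
  have hne : (Finset.range n).Nonempty := ⟨0, by simpa using hn⟩
  set m := (Finset.range n).sup' hne fun i => dist (T^[i] x) (T^[i] y) with hm
  have hmδ : m < δ := (Finset.sup'_lt_iff hne).2 fun i hi => hy i (by simpa using hi)
  have hm0 : 0 ≤ m := dist_nonneg.trans (Finset.le_sup' (fun i => dist (T^[i] x) (T^[i] y))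
    (by simpa using hn : 0 ∈ Finset.range n))
  obtain ⟨δ', h1, h2⟩ := exists_between hmδ
  have hfit : n ≤ fkFit T n δ' x y := by
    refine le_csSup ⟨n, ?_⟩ ⟨id, id, strictMono_id, strictMono_id, fun s => ?_⟩
    · rintro k ⟨i, -, hi, -⟩
      simpa using Fintype.card_le_of_injective i hi.injective
    · exact (Finset.le_sup' (fun i => dist (T^[i] x) (T^[i] y)) (by simp)).trans_lt h1
  have hn' : (0 : ℝ) < n := by exact_mod_cast hn
  refine (csInf_le ⟨0, fun a ha => ha.1.le⟩ ⟨hm0.trans_lt h1, ?_⟩ : dFKn T n x y ≤ δ').trans_lt h2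
  have : (1 : ℝ) ≤ (fkFit T n δ' x y : ℝ) / n := by
    rw [le_div_iff₀ hn', one_mul]; exact_mod_cast hfit
  unfold fkF
  linarith

theorem bk_fk_mono {T : X → X} {n : ℕ} {x : X} {δ δ' : ℝ} (h : δ ≤ δ') :
    fkBall T n x δ ⊆ fkBall T n x δ' := fun _ hy => lt_of_lt_of_le hy h

theorem bk_bowen_mono {T : X → X} {n : ℕ} {x : X} {δ δ' : ℝ} (h : δ ≤ δ') :
    bowenBall T n x δ ⊆ bowenBall T n x δ' := fun _ hy i hi => (hy i hi).trans_le h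

theorem bk_tendsto_sup {f : ℝ → ℝ≥0∞} (hf : ∀ a b, a ≤ b → f b ≤ f a) :
    Tendsto f (nhdsWithin 0 (Ioi 0)) (nhds (⨆ (δ : ℝ) (_ : 0 < δ), f δ)) := by
  have h := Antitone.tendsto_nhdsGT (f := f) (fun a b h => hf a b h) 0
  rwa [sSup_image] at h

theorem bkHi_refine {ι κ : Type*} {p : X → ι} {q : X → κ} (h : ∀ x y, q x = q y → p x = p y) (x : X) :
    bkHi μ T p x ≤ bkHi μ T q x := by
  refine limsup_le_limsup (Eventually.of_forall fun n => ?_)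
  refine ENNReal.div_le_div_right (bk_nlog_anti (measure_ne_top _ _) (measure_mono ?_)) _
  intro y hy
  funext i
  exact h _ _ (congrFun (show bkWord T q n y = bkWord T q n x from hy) i)

theorem bkLo_refine {ι κ : Type*} {p : X → ι} {q : X → κ} (h : ∀ x y, q x = q y → p x = p y) (x : X) :
    bkLo μ T p x ≤ bkLo μ T q x := by
  refine liminf_le_liminf (Eventually.of_forall fun n => ?_)
  refine ENNReal.div_le_div_right (bk_nlog_anti (measure_ne_top _ _) (measure_mono ?_)) _
  intro y hy
  funext i
  exact h _ _ (congrFun (show bkWord T q n y = bkWord T q n x from hy) i)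

end bowen

open Filter Metric Set MeasureTheory ENNReal

theorem bk_dynEnt {X : Type*} [MeasurableSpace X] (μ : Measure X) (T : X → X) {k : ℕ} (q : X → Fin k)
    (n : ℕ) : dynEnt μ T (fun i => q ⁻¹' {i}) n = bkH μ T q n := by
  unfold dynEnt bkH
  refine Finset.sum_congr rfl fun w _ => ?_
  congr 3
  ext x
  simp [bkWord, funext_iff]

theorem bk_partition_fun {X : Type*} [MeasurableSpace X] {k : ℕ} {P : Fin k → Set X}
    (h : IsFinPartition P) : ∃ q : X → Fin k, P = fun i => q ⁻¹' {i} := by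
  obtain ⟨-, h2, h3⟩ := h
  have hx : ∀ x, ∃ i, x ∈ P i := fun x => mem_iUnion.1 (h3 ▸ mem_univ x)
  choose q hq using hx
  refine ⟨q, funext fun i => ?_⟩
  ext x
  constructor
  · intro hi
    by_contra hne
    exact Set.disjoint_left.1 (h2 (show q x ≠ i from hne)) (hq x) hi
  · rintro rfl; exact hq x

theorem bk_isFinPartition {X : Type*} [MeasurableSpace X] {k : ℕ} {q : X → Fin k}
    (hq : ∀ a, MeasurableSet (q ⁻¹' {a})) : IsFinPartition fun i => q ⁻¹' {i} := by
  refine ⟨hq, fun i j hij => (Set.disjoint_singleton.2 hij).preimage q, ?_⟩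
  ext x; simp

theorem bk_ks {X : Type*} [MetricSpace X] [MeasurableSpace X] [BorelSpace X] [CompactSpace X]
    {T : X → X} {μ : Measure X} [IsProbabilityMeasure μ] (hμ : MeasurePreserving T μ μ)
    {m : ℕ → ℕ} {R : ∀ k : ℕ, X → (∀ i : Fin k, Fin (m i))}
    (hR : ∀ k a, MeasurableSet (R k ⁻¹' {a}))
    (hfine : ∀ ε : ℝ, 0 < ε → ∃ k, ∀ x y, R k x = R k y → dist x y < ε)
    (hmono : ∀ k l, k ≤ l → ∀ x y, R l x = R l y → R k x = R k y) :
    ∫⁻ x, ⨆ k, bkLo μ T (R k) x ∂μ = ksEntropy μ T := by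
  have hsmb : ∀ᵐ x ∂μ, ∀ k, bkHi μ T (R k) x = bkLo μ T (R k) x :=
    ae_all_iff.2 fun k => bk_smb hμ (hR k)
  apply le_antisymm
  · rw [lintegral_iSup (fun k => bkLo_meas hμ.measurable (hR k))
      (fun k l hkl x => bkLo_refine (hmono k l hkl) x)]
    refine iSup_le fun k => ?_
    have e := Fintype.equivFin (∀ i : Fin k, Fin (m i))
    have hq : ∀ a, MeasurableSet ((fun x => e (R k x)) ⁻¹' {a}) := by
      intro a
      have : (fun x => e (R k x)) ⁻¹' {a} = R k ⁻¹' {e.symm a} := by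
        ext x; simp [Equiv.eq_symm_apply]
      rw [this]; exact hR k _
    have h1 : ∫⁻ x, bkLo μ T (R k) x ∂μ ≤ ∫⁻ x, bkLo μ T (fun x => e (R k x)) x ∂μ :=
      lintegral_mono fun x => bkLo_refine (fun x y h => e.injective h) x
    refine h1.trans ?_
    rw [bk_int hμ hq]
    unfold ksEntropy
    refine le_iSup_of_le _ (le_iSup_of_le _ (le_iSup_of_le (bk_isFinPartition hq) ?_))
    simp_rw [bk_dynEnt]
    exact le_rfl
  · unfold ksEntropy
    refine iSup_le fun k => iSup_le fun P => iSup_le fun hP => ?_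
    obtain ⟨q, rfl⟩ := bk_partition_fun hP
    have hq : ∀ a, MeasurableSet (q ⁻¹' {a}) := hP.1
    simp_rw [bk_dynEnt]
    rw [← bk_int hμ hq]
    refine lintegral_mono_ae ?_
    filter_upwards [hsmb, bk_smb hμ hq, bk_cmp (μ := μ) hμ hq hR hfine] with x h1 h2 h3
    rw [← h2]
    refine h3.trans (le_of_eq ?_)
    simp_rw [h1]

/-- Brin–Katok formula for the Feldman–Katok metric: for `μ`-a.e. `x`, the limits
as `δ → 0` of `liminf_n -(1/n) log μ(B_{d_{FK_n}}(x,δ))` and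
`limsup_n -(1/n) log μ(B_{d_{FK_n}}(x,δ))` both exist and equal the Brin–Katok
local entropy `h_μ(T,x)` (itself the common value of the corresponding limits for
Bowen balls); moreover `∫ h_μ(T,x) dμ = h_μ(T)`. -/
theorem brinKatok_FK [MeasurableSpace X] [BorelSpace X] [CompactSpace X]
    (T : X → X) (hT : Continuous T) (μ : Measure X) [IsProbabilityMeasure μ]
    (hμ : MeasurePreserving T μ μ) :
    (∀ᵐ x ∂μ,
      Tendsto (fun δ : ℝ =>
          Filter.liminf (fun n : ℕ => nlog (μ (bowenBall T n x δ)) / (n : ℝ≥0∞)) atTop)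
        (nhdsWithin 0 (Set.Ioi 0)) (nhds (localEnt μ T x)) ∧
      Tendsto (fun δ : ℝ =>
          Filter.limsup (fun n : ℕ => nlog (μ (bowenBall T n x δ)) / (n : ℝ≥0∞)) atTop)
        (nhdsWithin 0 (Set.Ioi 0)) (nhds (localEnt μ T x)) ∧
      Tendsto (fun δ : ℝ =>
          Filter.liminf (fun n : ℕ => nlog (μ (fkBall T n x δ)) / (n : ℝ≥0∞)) atTop)
        (nhdsWithin 0 (Set.Ioi 0)) (nhds (localEnt μ T x)) ∧
      Tendsto (fun δ : ℝ =>
          Filter.limsup (fun n : ℕ => nlog (μ (fkBall T n x δ)) / (n : ℝ≥0∞)) atTop)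
        (nhdsWithin 0 (Set.Ioi 0)) (nhds (localEnt μ T x))) ∧
    ∫⁻ x, localEnt μ T x ∂μ = ksEntropy μ T := by
  classical
  obtain ⟨m, R, hR, hloc, hfine, hmono⟩ := bk_parts μ
  have hae : ∀ᵐ x ∂μ,
      (⨆ (δ : ℝ) (_ : 0 < δ), liminf (fun n : ℕ => nlog (μ (bowenBall T n x δ)) / (n : ℝ≥0∞)) atTop)
        = (⨆ k, bkLo μ T (R k) x) ∧
      (⨆ (δ : ℝ) (_ : 0 < δ), limsup (fun n : ℕ => nlog (μ (bowenBall T n x δ)) / (n : ℝ≥0∞)) atTop)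
        = (⨆ k, bkLo μ T (R k) x) ∧
      (⨆ (δ : ℝ) (_ : 0 < δ), liminf (fun n : ℕ => nlog (μ (fkBall T n x δ)) / (n : ℝ≥0∞)) atTop)
        = (⨆ k, bkLo μ T (R k) x) ∧
      (⨆ (δ : ℝ) (_ : 0 < δ), limsup (fun n : ℕ => nlog (μ (fkBall T n x δ)) / (n : ℝ≥0∞)) atTop)
        = (⨆ k, bkLo μ T (R k) x) := by
    filter_upwards [ae_all_iff.2 fun k => bk_smb hμ (hR k),
      ae_all_iff.2 fun k => bk_fk_lower_liminf (μ := μ) hμ (hR k) (hloc k)] with x h1 h2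
    have hlow : (⨆ k, bkLo μ T (R k) x) ≤ ⨆ (δ : ℝ) (_ : 0 < δ),
        liminf (fun n : ℕ => nlog (μ (fkBall T n x δ)) / (n : ℝ≥0∞)) atTop := iSup_le h2
    have hup : (⨆ (δ : ℝ) (_ : 0 < δ),
        limsup (fun n : ℕ => nlog (μ (bowenBall T n x δ)) / (n : ℝ≥0∞)) atTop)
        ≤ ⨆ k, bkLo μ T (R k) x := by
      refine iSup₂_le fun δ hδ => ?_
      obtain ⟨k, hk⟩ := hfine δ hδ
      refine (bk_bowen_upper (μ := μ) (T := T) hk x).trans ?_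
      rw [h1 k]
      exact le_iSup (fun k => bkLo μ T (R k) x) k
    have hfb : ∀ δ : ℝ, ∀ᶠ n : ℕ in atTop, nlog (μ (fkBall T n x δ)) / (n : ℝ≥0∞)
        ≤ nlog (μ (bowenBall T n x δ)) / (n : ℝ≥0∞) := by
      intro δ
      filter_upwards [eventually_gt_atTop 0] with n hn
      exact ENNReal.div_le_div_right
        (bk_nlog_anti (measure_ne_top _ _) (measure_mono (bk_bowen_sub_fk hn))) _
    have h3 : (⨆ (δ : ℝ) (_ : 0 < δ),
        liminf (fun n : ℕ => nlog (μ (fkBall T n x δ)) / (n : ℝ≥0∞)) atTop) ≤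
        ⨆ (δ : ℝ) (_ : 0 < δ), liminf (fun n : ℕ => nlog (μ (bowenBall T n x δ)) / (n : ℝ≥0∞)) atTop :=
      iSup₂_mono fun δ _ => liminf_le_liminf (hfb δ)
    have h4 : (⨆ (δ : ℝ) (_ : 0 < δ),
        liminf (fun n : ℕ => nlog (μ (bowenBall T n x δ)) / (n : ℝ≥0∞)) atTop) ≤
        ⨆ (δ : ℝ) (_ : 0 < δ), limsup (fun n : ℕ => nlog (μ (bowenBall T n x δ)) / (n : ℝ≥0∞)) atTop :=
      iSup₂_mono fun δ _ => liminf_le_limsup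
    have h5 : (⨆ (δ : ℝ) (_ : 0 < δ),
        liminf (fun n : ℕ => nlog (μ (fkBall T n x δ)) / (n : ℝ≥0∞)) atTop) ≤
        ⨆ (δ : ℝ) (_ : 0 < δ), limsup (fun n : ℕ => nlog (μ (fkBall T n x δ)) / (n : ℝ≥0∞)) atTop :=
      iSup₂_mono fun δ _ => liminf_le_limsup
    have h6 : (⨆ (δ : ℝ) (_ : 0 < δ),
        limsup (fun n : ℕ => nlog (μ (fkBall T n x δ)) / (n : ℝ≥0∞)) atTop) ≤
        ⨆ (δ : ℝ) (_ : 0 < δ), limsup (fun n : ℕ => nlog (μ (bowenBall T n x δ)) / (n : ℝ≥0∞)) atTop :=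
      iSup₂_mono fun δ _ => limsup_le_limsup (hfb δ)
    exact ⟨le_antisymm (h4.trans hup) (hlow.trans h3),
      le_antisymm hup (hlow.trans (h3.trans h4)),
      le_antisymm (h3.trans (h4.trans hup)) hlow,
      le_antisymm (h6.trans hup) (hlow.trans h5)⟩
  refine ⟨?_, ?_⟩
  · filter_upwards [hae] with x hx
    obtain ⟨h1, h2, h3, h4⟩ := hx
    have hloc' : localEnt μ T x = ⨆ k, bkLo μ T (R k) x := h1
    have mB : ∀ (n : ℕ) (a b : ℝ), a ≤ b → nlog (μ (bowenBall T n x b)) / (n : ℝ≥0∞)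
        ≤ nlog (μ (bowenBall T n x a)) / (n : ℝ≥0∞) := fun n a b h =>
      ENNReal.div_le_div_right (bk_nlog_anti (measure_ne_top _ _) (measure_mono (bk_bowen_mono h))) _
    have mF : ∀ (n : ℕ) (a b : ℝ), a ≤ b → nlog (μ (fkBall T n x b)) / (n : ℝ≥0∞)
        ≤ nlog (μ (fkBall T n x a)) / (n : ℝ≥0∞) := fun n a b h =>
      ENNReal.div_le_div_right (bk_nlog_anti (measure_ne_top _ _) (measure_mono (bk_fk_mono h))) _
    rw [hloc']
    refine ⟨?_, ?_, ?_, ?_⟩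
    · rw [← h1]
      exact bk_tendsto_sup fun a b h => liminf_le_liminf (Eventually.of_forall fun n => mB n a b h)
    · rw [← h2]
      exact bk_tendsto_sup fun a b h => limsup_le_limsup (Eventually.of_forall fun n => mB n a b h)
    · rw [← h3]
      exact bk_tendsto_sup fun a b h => liminf_le_liminf (Eventually.of_forall fun n => mF n a b h)
    · rw [← h4]
      exact bk_tendsto_sup fun a b h => limsup_le_limsup (Eventually.of_forall fun n => mF n a b h)
  · rw [← bk_ks hμ hR hfine hmono]
    refine lintegral_congr_ae ?_
    filter_upwards [hae] with x hx
    exact hx.1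
end

section
/- Let (X,d,T) be a topological dynamical system and μ a T-invariant Borel probability measure. Then h_μ(T) ≤ lim_{ε→0} liminf_{n→∞} (1/n) log sp_{FK}(μ,n,ε). If moreover μ is ergodic, then h_μ(T) = lim_{ε→0} limsup_{n→∞} (1/n) log sp_{FK}(μ,n,ε) = lim_{ε→0} liminf_{n→∞} (1/n) log sp_{FK}(μ,n,ε). -/
open Filter Metric Set

variable {X : Type*} [MetricSpace X]

open MeasureTheory ENNReal

/-- `sp_{FK}(μ,n,ε)`: the minimal number of FK `(n,ε)`-balls whose union has
measure greater than `1 - ε`. -/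
noncomputable def spFKmu {Y : Type*} [MetricSpace Y] [MeasurableSpace Y]
    (μ : Measure Y) (T : Y → Y) (n : ℕ) (ε : ℝ) : ℕ :=
  sInf {m : ℕ | ∃ s : Finset Y, s.card = m ∧
    1 - ENNReal.ofReal ε < μ (⋃ x ∈ s, fkBall T n x ε)}


lemma fk_mean_ergodic {Y : Type*} [MeasurableSpace Y] {μ : Measure Y} [IsProbabilityMeasure μ]
    {T : Y → Y} (hE : Ergodic T μ) {f : Y → ℝ} (hf : MemLp f 2 μ) {η : ℝ} (hη : 0 < η) :
    Tendsto (fun n : ℕ => μ {x | (n : ℝ) * ((∫ y, f y ∂μ) + η) ≤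
      ∑ i ∈ Finset.range n, f (T^[i] x)}) atTop (nhds 0) := by
  have hmp : MeasurePreserving T μ μ := hE.toMeasurePreserving
  let U : Lp ℝ 2 μ →L[ℝ] Lp ℝ 2 μ :=
    (Lp.compMeasurePreservingₗᵢ ℝ T hmp).toContinuousLinearMap
  have hU : ‖U‖ ≤ 1 := LinearIsometry.norm_toContinuousLinearMap_le _
  set F : Lp ℝ 2 μ := hf.toLp f with hF
  have key := ContinuousLinearMap.tendsto_birkhoffAverage_orthogonalProjection U hU F
  set g0 := (U.eqLocus (1 : Lp ℝ 2 μ →L[ℝ] Lp ℝ 2 μ)).orthogonalProjectionOnto F with hg0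
  set g : Lp ℝ 2 μ := (g0 : Lp ℝ 2 μ) with hg
  have hUg : U g = g := by
    have := g0.2
    rw [LinearMap.mem_eqLocus] at this
    simpa using this
  have hUcoe : ∀ h : Lp ℝ 2 μ, (U h : Y → ℝ) =ᵐ[μ] h ∘ T := fun h =>
    Lp.coeFn_compMeasurePreserving h hmp
  obtain ⟨c, hc⟩ : ∃ c, (g : Y → ℝ) =ᵐ[μ] Function.const Y c := by
    apply hE.ae_eq_const_of_ae_eq_comp_ae (Lp.aestronglyMeasurable g)
    have := hUcoe g
    rw [hUg] at this
    exact this.symm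
  -- iterates
  have hiter : ∀ i : ℕ, ((U^[i] F : Lp ℝ 2 μ) : Y → ℝ) =ᵐ[μ] fun x => f (T^[i] x) := by
    intro i
    induction i with
    | zero => simpa using hf.coeFn_toLp
    | succ i ih =>
      rw [Function.iterate_succ_apply']
      refine (hUcoe _).trans ?_
      have := hmp.quasiMeasurePreserving.ae_eq_comp ih
      refine this.trans (Eventually.of_forall fun x => ?_)
      simp [Function.iterate_succ_apply]
  have hsum : ∀ n : ℕ, ((birkhoffAverage ℝ U _root_.id n F : Lp ℝ 2 μ) : Y → ℝ) =ᵐ[μ]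
      fun x => (n : ℝ)⁻¹ * ∑ i ∈ Finset.range n, f (T^[i] x) := by
    intro n
    have h1 : ((∑ i ∈ Finset.range n, (U^[i] F) : Lp ℝ 2 μ) : Y → ℝ) =ᵐ[μ]
        fun x => ∑ i ∈ Finset.range n, f (T^[i] x) := by
      induction n with
      | zero =>
        simp only [Finset.range_zero, Finset.sum_empty]
        exact Lp.coeFn_zero ℝ 2 μ
      | succ n ih =>
        rw [Finset.sum_range_succ]
        refine (Lp.coeFn_add _ _).trans ?_
        filter_upwards [ih, hiter n] with x h1 h2
        rw [Pi.add_apply, h1, h2, Finset.sum_range_succ]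
    have : birkhoffAverage ℝ U _root_.id n F = (n : ℝ)⁻¹ • ∑ i ∈ Finset.range n, (U^[i] F) := rfl
    rw [this]
    refine (Lp.coeFn_smul _ _).trans ?_
    filter_upwards [h1] with x hx
    rw [Pi.smul_apply, hx, smul_eq_mul]
  -- the constant
  have hintg : ∀ h : Lp ℝ 2 μ, inner ℝ (indicatorConstLp 2 MeasurableSet.univ
      (measure_ne_top μ univ) (1 : ℝ)) h = ∫ x, h x ∂μ := by
    intro h
    rw [L2.inner_indicatorConstLp_one]; simp
  have hintn : ∀ n : ℕ, 0 < n → ∫ x, (birkhoffAverage ℝ U _root_.id n F : Lp ℝ 2 μ) x ∂μ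
      = ∫ x, f x ∂μ := by
    intro n hn
    rw [integral_congr_ae (hsum n), integral_const_mul, integral_finsetSum]
    · have : ∀ i : ℕ, ∫ x, f (T^[i] x) ∂μ = ∫ x, f x ∂μ := by
        intro i
        have hm := hmp.iterate i
        have := integral_map (μ := μ) hm.measurable.aemeasurable (f := f)
          (by rw [hm.map_eq]; exact hf.1)
        rw [← this, hm.map_eq]
      simp only [this, Finset.sum_const, Finset.card_range, nsmul_eq_mul]
      field_simp
    · intro i _
      exact ((hf.comp_measurePreserving (hmp.iterate i)).integrable (by norm_num))
  have hcval : c = ∫ x, f x ∂μ := by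
    have h1 : Tendsto (fun n : ℕ => ∫ x, (birkhoffAverage ℝ U _root_.id n F : Lp ℝ 2 μ) x ∂μ)
        atTop (nhds (∫ x, g x ∂μ)) := by
      simp only [← hintg]
      exact (Filter.Tendsto.inner tendsto_const_nhds key)
    have h2 : Tendsto (fun n : ℕ => ∫ x, (birkhoffAverage ℝ U _root_.id n F : Lp ℝ 2 μ) x ∂μ)
        atTop (nhds (∫ x, f x ∂μ)) :=
      tendsto_const_nhds.congr' (by
        filter_upwards [eventually_gt_atTop 0] with n hn using (hintn n hn).symm)
    have h3 := tendsto_nhds_unique h1 h2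
    rw [integral_congr_ae hc] at h3
    simpa using h3
  have hmeas := (tendstoInMeasure_of_tendsto_Lp key)
  have := hmeas (ENNReal.ofReal η) (by simpa using hη)
  refine tendsto_of_tendsto_of_tendsto_of_le_of_le' tendsto_const_nhds this
    (Eventually.of_forall fun n => zero_le) ?_
  filter_upwards [eventually_gt_atTop 0] with n hn
  apply measure_mono_ae
  filter_upwards [hsum n, hc] with x h1 h2 hx
  change ENNReal.ofReal η ≤ edist _ _
  change (n : ℝ) * ((∫ y, f y ∂μ) + η) ≤ ∑ i ∈ Finset.range n, f (T^[i] x) at hx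
  have hg' : (g : Y → ℝ) x = c := h2
  rw [h1, hg', edist_dist]
  apply ENNReal.ofReal_le_ofReal
  rw [Real.dist_eq]
  refine le_trans ?_ (le_abs_self _)
  have hn' : (0 : ℝ) < n := by exact_mod_cast hn
  rw [← hcval] at hx
  have : (n : ℝ)⁻¹ * (n * (c + η)) ≤ (n : ℝ)⁻¹ * ∑ i ∈ Finset.range n, f (T^[i] x) := by gcongr
  rw [← mul_assoc, inv_mul_cancel₀ hn'.ne', one_mul] at this
  linarith

open Classical in
/-- Chernoff-type count of words with few nontrivial letters. -/
lemma fk_count_words {α : Type*} [Fintype α] (a0 : α) (n : ℕ) (b t : ℝ)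
    (ht0 : 0 < t) (ht1 : t ≤ 1) :
    (((Finset.univ : Finset (Fin n → α)).filter (fun c =>
      ((Finset.univ.filter (fun i => c i ≠ a0)).card : ℝ) ≤ b * n)).card : ℝ) ≤
      Real.exp (n * (b * Real.log (1 / t) + Fintype.card α * t)) := by
  set S := (Finset.univ : Finset (Fin n → α)).filter (fun c =>
      ((Finset.univ.filter (fun i => c i ≠ a0)).card : ℝ) ≤ b * n) with hS
  have h1 : ∀ c ∈ S, t ^ (b * n) ≤ ∏ i, (if c i = a0 then 1 else t) := by
    intro c hc
    have hc' := (Finset.mem_filter.1 hc).2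
    have : ∏ i, (if c i = a0 then (1 : ℝ) else t)
        = t ^ (Finset.univ.filter (fun i => c i ≠ a0)).card := by
      rw [Finset.prod_ite]; simp
    rw [this, ← Real.rpow_natCast]
    exact Real.rpow_le_rpow_of_exponent_ge ht0 ht1 hc'
  have h2 : (S.card : ℝ) * t ^ (b * n) ≤ (1 + Fintype.card α * t) ^ n := by
    calc (S.card : ℝ) * t ^ (b * n) = ∑ c ∈ S, t ^ (b * n) := by simp
      _ ≤ ∑ c ∈ S, ∏ i, (if c i = a0 then 1 else t) := Finset.sum_le_sum h1
      _ ≤ ∑ c : Fin n → α, ∏ i, (if c i = a0 then 1 else t) := by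
        apply Finset.sum_le_sum_of_subset_of_nonneg (Finset.subset_univ _)
        intro c _ _
        apply Finset.prod_nonneg
        intro i _
        split_ifs <;> linarith
      _ = (∑ a : α, (if a = a0 then 1 else t)) ^ n := by
        rw [Finset.sum_pow', Fintype.piFinset_univ]
      _ ≤ _ := by
        apply pow_le_pow_left₀
        · apply Finset.sum_nonneg; intro a _; split_ifs <;> linarith
        · calc ∑ a : α, (if a = a0 then (1 : ℝ) else t) ≤ ∑ a : α, ((if a = a0 then 1 else 0) + t) := by
                apply Finset.sum_le_sum; intro a _; split_ifs <;> linarith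
            _ = _ := by rw [Finset.sum_add_distrib]; simp
  have h3 : (1 + Fintype.card α * t) ^ n ≤ Real.exp (n * (Fintype.card α * t)) := by
    rw [Real.exp_nat_mul]
    apply pow_le_pow_left₀ (by positivity)
    have := Real.add_one_le_exp (Fintype.card α * t)
    linarith
  have h4 : t ^ (b * n) = Real.exp (- (n * (b * Real.log (1 / t)))) := by
    rw [Real.rpow_def_of_pos ht0, one_div, Real.log_inv]; congr 1; ring
  rw [h4] at h2
  have h5 : (S.card : ℝ) = (S.card * Real.exp (- (n * (b * Real.log (1 / t))))) *
      Real.exp (n * (b * Real.log (1 / t))) := by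
    rw [mul_assoc, ← Real.exp_add]; simp
  rw [h5, mul_add, Real.exp_add, mul_comm]
  gcongr
  exact h2.trans h3

/-- The Gibbs inequality, termwise. -/
lemma fk_gibbs {p q : ℝ} (hp : 0 ≤ p) (hq : 0 < q) :
    Real.negMulLog p ≤ -(p * Real.log q) + (q - p) := by
  rcases hp.eq_or_lt with rfl | hp
  · simp; exact hq.le
  · have h := Real.log_le_sub_one_of_pos (div_pos hq hp)
    rw [Real.log_div hq.ne' hp.ne'] at h
    have : p * (Real.log q - Real.log p) ≤ p * (q / p - 1) := by gcongr
    have e : p * (q / p - 1) = q - p := by field_simp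
    rw [e] at this
    rw [Real.negMulLog]; linarith

/-- Entropy bound when most mass is on a set `S` of atoms. -/
lemma fk_entropy_bound {ι : Type*} [Fintype ι] (p : ι → ℝ) (hp : ∀ i, 0 ≤ p i)
    (hp1 : ∑ i, p i = 1) (S : Finset ι) (N M β : ℝ) (hN : 1 ≤ N) (hSN : (S.card : ℝ) ≤ N)
    (hM : 1 ≤ M) (hιM : (Fintype.card ι : ℝ) ≤ M) (hβ : 1 - β ≤ ∑ i ∈ S, p i) :
    ∑ i, Real.negMulLog (p i) ≤ Real.log 2 + Real.log N + β * Real.log M := by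
  classical
  have hS : ∑ i ∈ S, p i + ∑ i ∈ Sᶜ, p i = 1 := by rw [Finset.sum_add_sum_compl, hp1]
  have hN0 : 0 < N := by linarith
  have hM0 : 0 < M := by linarith
  have hS0 : ∑ i ∈ S, p i ≤ 1 := by
    have : 0 ≤ ∑ i ∈ Sᶜ, p i := Finset.sum_nonneg fun i _ => hp i
    linarith
  have hlN := Real.log_nonneg hN
  have hlM := Real.log_nonneg hM
  have h1 : ∑ i ∈ S, Real.negMulLog (p i) ≤
      (Real.log 2 + Real.log N) * (∑ i ∈ S, p i) + (1 / 2 - ∑ i ∈ S, p i) := by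
    calc ∑ i ∈ S, Real.negMulLog (p i) ≤
        ∑ i ∈ S, (-(p i * Real.log (1 / (2 * N))) + (1 / (2 * N) - p i)) :=
          Finset.sum_le_sum fun i _ => fk_gibbs (hp i) (by positivity)
      _ = (Real.log 2 + Real.log N) * (∑ i ∈ S, p i) + (S.card / (2 * N) - ∑ i ∈ S, p i) := by
          rw [Finset.sum_add_distrib, Finset.sum_sub_distrib, Finset.sum_neg_distrib,
            ← Finset.sum_mul, one_div, Real.log_inv, Real.log_mul (by norm_num) hN0.ne']
          simp; ring
      _ ≤ _ := by
          have : (S.card : ℝ) / (2 * N) ≤ 1 / 2 := by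
            rw [div_le_div_iff₀ (by positivity) (by norm_num)]; linarith
          linarith
  have h2 : ∑ i ∈ Sᶜ, Real.negMulLog (p i) ≤
      (Real.log 2 + Real.log M) * (∑ i ∈ Sᶜ, p i) + (1 / 2 - ∑ i ∈ Sᶜ, p i) := by
    calc ∑ i ∈ Sᶜ, Real.negMulLog (p i) ≤
        ∑ i ∈ Sᶜ, (-(p i * Real.log (1 / (2 * M))) + (1 / (2 * M) - p i)) :=
          Finset.sum_le_sum fun i _ => fk_gibbs (hp i) (by positivity)
      _ = (Real.log 2 + Real.log M) * (∑ i ∈ Sᶜ, p i) + (Sᶜ.card / (2 * M) - ∑ i ∈ Sᶜ, p i) := by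
          rw [Finset.sum_add_distrib, Finset.sum_sub_distrib, Finset.sum_neg_distrib,
            ← Finset.sum_mul, one_div, Real.log_inv, Real.log_mul (by norm_num) hM0.ne']
          simp only [Finset.sum_const, nsmul_eq_mul]; ring
      _ ≤ _ := by
          have h0 : (Sᶜ.card : ℝ) ≤ M := le_trans (by exact_mod_cast Finset.card_le_univ _) hιM
          have : (Sᶜ.card : ℝ) / (2 * M) ≤ 1 / 2 := by
            rw [div_le_div_iff₀ (by positivity) (by norm_num)]; linarith
          linarith
  rw [← Finset.sum_add_sum_compl S]
  have h3 : Real.log N * (∑ i ∈ S, p i) ≤ Real.log N * 1 := by gcongr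
  have h4 : Real.log M * (∑ i ∈ Sᶜ, p i) ≤ Real.log M * β := by
    apply mul_le_mul_of_nonneg_left _ hlM; linarith
  have h5 : Real.log 2 * (∑ i ∈ S, p i) + Real.log 2 * (∑ i ∈ Sᶜ, p i) = Real.log 2 := by
    rw [← mul_add, hS, mul_one]
  nlinarith

lemma fkFit_mem (T : X → X) (n : ℕ) (δ : ℝ) (x y : X) :
    fkFit T n δ x y ∈ {k : ℕ | ∃ i j : Fin k → Fin n, StrictMono i ∧ StrictMono j ∧
    ∀ s, dist (T^[(i s : ℕ)] x) (T^[(j s : ℕ)] y) < δ} := by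
  apply Nat.sSup_mem
  · exact ⟨0, Fin.elim0, Fin.elim0, fun a => a.elim0, fun a => a.elim0, fun a => a.elim0⟩
  · refine ⟨n, ?_⟩
    rintro k ⟨i, j, hi, -, -⟩
    simpa using Fintype.card_le_of_injective i hi.injective

lemma fkFit_ge (T : X → X) (n : ℕ) (δ : ℝ) (x y : X)
    (h : ∀ i < n, dist (T^[i] x) (T^[i] y) < δ) : n ≤ fkFit T n δ x y := by
  apply le_csSup
  · refine ⟨n, ?_⟩
    rintro k ⟨i, j, hi, -, -⟩
    simpa using Fintype.card_le_of_injective i hi.injective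
  · exact ⟨id, id, strictMono_id, strictMono_id, fun s => h s s.2⟩

lemma fk_ball_match {T : X → X} {n : ℕ} (hn : 0 < n) {x y : X} {ε : ℝ}
    (h : y ∈ fkBall T n x ε) : ∃ k : ℕ, (1 - ε) * n < k ∧ ∃ i j : Fin k → Fin n,
      StrictMono i ∧ StrictMono j ∧ ∀ s, dist (T^[(i s : ℕ)] x) (T^[(j s : ℕ)] y) < ε := by
  have h' : sInf {δ : ℝ | 0 < δ ∧ fkF T n δ x y < δ} < ε := h
  have hn' : (0 : ℝ) < n := by exact_mod_cast hn
  have hne : {δ : ℝ | 0 < δ ∧ fkF T n δ x y < δ}.Nonempty := by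
    refine ⟨2, by norm_num, ?_⟩
    have : (0 : ℝ) ≤ (fkFit T n 2 x y : ℝ) / n := by positivity
    unfold fkF; linarith
  obtain ⟨δ, ⟨hδ0, hδ⟩, hδε⟩ := exists_lt_of_csInf_lt hne h'
  obtain ⟨i, j, hi, hj, hij⟩ := fkFit_mem T n δ x y
  refine ⟨_, ?_, i, j, hi, hj, fun s => (hij s).trans hδε⟩
  unfold fkF at hδ
  have : (1 - ε) < (fkFit T n δ x y : ℝ) / n := by linarith
  rwa [lt_div_iff₀ hn'] at this

lemma fk_mem_ball {T : X → X} {n : ℕ} (hn : 0 < n) {x y : X} {ε δ : ℝ} (hδ : 0 < δ) (hδε : δ < ε)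
    (h : ∀ i < n, dist (T^[i] x) (T^[i] y) < δ) : y ∈ fkBall T n x ε := by
  have hn' : (0 : ℝ) < n := by exact_mod_cast hn
  have h1 : (n : ℝ) ≤ fkFit T n δ x y := by exact_mod_cast fkFit_ge T n δ x y h
  have h2 : fkF T n δ x y < δ := by
    have : 1 ≤ (fkFit T n δ x y : ℝ) / n := by rwa [le_div_iff₀ hn', one_mul]
    unfold fkF; linarith
  have h3 : dFKn T n x y ≤ δ := csInf_le ⟨0, fun z hz => hz.1.le⟩ ⟨hδ, h2⟩
  exact lt_of_le_of_lt h3 hδε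

section
variable [MeasurableSpace X] [CompactSpace X]
    {T : X → X} {μ : Measure X} [IsProbabilityMeasure μ]

lemma fk_sp_mem (hT : Continuous T) {n : ℕ} (hn : 0 < n) {ε : ℝ} (hε : 0 < ε) :
    ∃ s : Finset X, s.card = spFKmu μ T n ε ∧
    1 - ENNReal.ofReal ε < μ (⋃ x ∈ s, fkBall T n x ε) := by
  have hne : {m : ℕ | ∃ s : Finset X, s.card = m ∧
    1 - ENNReal.ofReal ε < μ (⋃ x ∈ s, fkBall T n x ε)}.Nonempty := by
    let V : X → Set X := fun x => {y | ∀ i ∈ Finset.range n, dist (T^[i] x) (T^[i] y) < ε / 2}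
    have hV : ∀ x, IsOpen (V x) := by
      intro x
      have : V x = ⋂ i ∈ Finset.range n, {y | dist (T^[i] x) (T^[i] y) < ε / 2} := by
        ext y; simp [V]
      rw [this]
      apply isOpen_biInter_finset
      intro i _
      exact isOpen_lt (continuous_const.dist (hT.iterate i)) continuous_const
    obtain ⟨s, hs⟩ := isCompact_univ.elim_finite_subcover V hV
      (fun x _ => mem_iUnion.2 ⟨x, fun i _ => by simpa using hε⟩)
    refine ⟨s.card, s, rfl, ?_⟩
    have : (⋃ x ∈ s, fkBall T n x ε) = univ := by
      apply eq_univ_of_univ_subset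
      refine hs.trans (iUnion₂_mono fun x _ y hy => ?_)
      exact fk_mem_ball hn (half_pos hε) (half_lt_self hε) (fun i hi => hy i (Finset.mem_range.2 hi))
    rw [this, measure_univ]
    exact ENNReal.sub_lt_self ENNReal.one_ne_top one_ne_zero (by simpa using hε)
  exact Nat.sInf_mem hne


lemma fk_sp_pos (hT : Continuous T) {n : ℕ} (hn : 0 < n) {ε : ℝ} (hε : 0 < ε) :
    1 ≤ spFKmu μ T n ε := by
  obtain ⟨s, hs, h⟩ := fk_sp_mem (μ := μ) hT hn hε
  rw [← hs]
  by_contra hcon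
  have : s = ∅ := Finset.card_eq_zero.1 (by omega)
  subst this
  simp at h

lemma fk_sp_anti (hT : Continuous T) {n : ℕ} (hn : 0 < n) {ε ε' : ℝ} (hε : 0 < ε) (h : ε ≤ ε') :
    spFKmu μ T n ε' ≤ spFKmu μ T n ε := by
  obtain ⟨s, hs, hs'⟩ := fk_sp_mem (μ := μ) hT hn hε
  apply Nat.sInf_le
  refine ⟨s, hs, ?_⟩
  refine lt_of_le_of_lt (tsub_le_tsub_left (ENNReal.ofReal_le_ofReal h) _) (hs'.trans_le ?_)
  exact measure_mono (iUnion₂_mono fun x _ y hy => lt_of_lt_of_le hy h)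

lemma fk_sp_le_code {n : ℕ} (hn : 0 < n) {ε δ : ℝ} (hδ : 0 < δ) (hδε : δ < ε)
    {κ : Type*} (C : Finset κ) (code : X → κ) (G : Set X) (hG : 1 - ENNReal.ofReal ε < μ G)
    (hC : ∀ y ∈ G, code y ∈ C)
    (hcode : ∀ y ∈ G, ∀ y' ∈ G, code y = code y' → ∀ i < n, dist (T^[i] y) (T^[i] y') < δ) :
    spFKmu μ T n ε ≤ C.card := by
  classical
  have hGne : G.Nonempty := by
    by_contra hcon
    rw [not_nonempty_iff_eq_empty] at hcon
    subst hcon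
    simp at hG
  let rep : κ → X := fun c => if h : ∃ y ∈ G, code y = c then h.choose else hGne.some
  have hrep : ∀ y ∈ G, rep (code y) ∈ G ∧ code (rep (code y)) = code y := by
    intro y hy
    have h : ∃ z ∈ G, code z = code y := ⟨y, hy, rfl⟩
    simp only [rep, dif_pos h]
    exact h.choose_spec
  refine le_trans (Nat.sInf_le ⟨C.image rep, rfl, ?_⟩) Finset.card_image_le
  refine hG.trans_le (measure_mono fun y hy => ?_)
  simp only [mem_iUnion]
  refine ⟨rep (code y), Finset.mem_image_of_mem _ (hC y hy), ?_⟩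
  exact fk_mem_ball hn hδ hδε (hcode _ (hrep y hy).1 _ hy (hrep y hy).2)

end

section
variable {Y : Type*} [MeasurableSpace Y]

lemma fk_label {k : ℕ} {P : Fin k → Set Y} (hP : IsFinPartition P) :
    ∃ lab : Y → Fin k, Measurable lab ∧ ∀ x a, x ∈ P a ↔ lab x = a := by
  obtain ⟨h1, h2, h3⟩ := hP
  have : ∀ x, ∃ a, x ∈ P a := fun x => by
    have : x ∈ ⋃ i, P i := by rw [h3]; trivial
    simpa using this
  choose lab hlab using this
  have hl : ∀ x a, x ∈ P a ↔ lab x = a := by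
    intro x a
    constructor
    · intro hx
      by_contra hne
      exact Set.disjoint_left.1 (h2 hne) (hlab x) hx
    · rintro rfl; exact hlab x
  refine ⟨lab, ?_, hl⟩
  apply measurable_to_countable'
  intro a
  have : lab ⁻¹' {a} = P a := by ext x; simp [hl]
  rw [this]; exact h1 a

/-- Itinerary. -/
def fkName {k : ℕ} (T : Y → Y) (lab : Y → Fin k) (n : ℕ) (y : Y) : Fin n → Fin k :=
  fun i => lab (T^[(i : ℕ)] y)

lemma fkName_meas {k : ℕ} {T : Y → Y} (hT : Measurable T) {lab : Y → Fin k} (hl : Measurable lab)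
    (n : ℕ) : Measurable (fkName T lab n) :=
  measurable_pi_lambda _ fun i => hl.comp (hT.iterate i)

lemma fk_dynEnt {k : ℕ} {P : Fin k → Set Y} (T : Y → Y) {lab : Y → Fin k}
    (hl : ∀ x a, x ∈ P a ↔ lab x = a) (μ : Measure Y) (n : ℕ) :
    dynEnt μ T P n = ∑ f, Real.negMulLog (μ.real (fkName T lab n ⁻¹' {f})) := by
  unfold dynEnt
  refine Finset.sum_congr rfl fun f _ => ?_
  congr 2
  have : (⋂ i : Fin n, T^[(i : ℕ)] ⁻¹' P (f i)) = fkName T lab n ⁻¹' {f} := by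
    ext y
    simp only [mem_iInter, mem_preimage, hl, mem_singleton_iff, funext_iff, fkName]
  rw [this]

lemma fk_sum_real {ι : Type*} [Fintype ι] [MeasurableSpace ι] [MeasurableSingletonClass ι]
    (μ : Measure Y) [IsFiniteMeasure μ] {g : Y → ι} (hg : Measurable g) (S : Finset ι) :
    ∑ f ∈ S, μ.real (g ⁻¹' {f}) = μ.real (g ⁻¹' (S : Set ι)) :=
  sum_measureReal_preimage_singleton S (fun f _ => hg (measurableSet_singleton f))
end

/-- `c` encodes an `(n,ε)`-match of `x` and `y`, together with the letters of `y` not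
determined by the match. -/
def FkCode {k : ℕ} (T : X → X) (lab : X → Fin k) (K : Fin k → Set X) (n : ℕ) (ε : ℝ) (x y : X)
    (c : Fin n → Prop × Prop × Option (Fin k)) : Prop :=
  ∃ (r : ℕ) (i j : Fin r → Fin n), StrictMono i ∧ StrictMono j ∧
    (∀ s, dist (T^[(i s : ℕ)] x) (T^[(j s : ℕ)] y) < ε) ∧
    ∀ t, (c t).1 = (t ∈ range i) ∧ (c t).2.1 = (t ∈ range j) ∧
      ((t ∈ range j ∧ (c t).2.2 = none ∧ ∃ a, T^[(t : ℕ)] y ∈ K a) ∨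
        (c t).2.2 = some (lab (T^[(t : ℕ)] y)))

lemma fk_code_det {k : ℕ} {T : X → X} {lab : X → Fin k} {K : Fin k → Set X} {n : ℕ} {ε : ℝ}
    (hK : ∀ a, ∀ u ∈ K a, lab u = a)
    (hsep : ∀ a b, a ≠ b → ∀ u ∈ K a, ∀ v ∈ K b, 2 * ε ≤ dist u v) {x y y' : X}
    {c : Fin n → Prop × Prop × Option (Fin k)} (h : FkCode T lab K n ε x y c)
    (h' : FkCode T lab K n ε x y' c) : fkName T lab n y = fkName T lab n y' := by
  obtain ⟨r, i, j, hi, hj, hd, hc⟩ := h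
  obtain ⟨r', i', j', hi', hj', hd', hc'⟩ := h'
  have hri : range i = range i' := by
    ext t
    have := (hc t).1.symm.trans (hc' t).1
    exact iff_of_eq this
  have hrj : range j = range j' := by
    ext t
    have := (hc t).2.1.symm.trans (hc' t).2.1
    exact iff_of_eq this
  have hr : r = r' := by
    have h1 := Set.ncard_range_of_injective hi.injective
    have h2 := Set.ncard_range_of_injective hi'.injective
    rw [hri, h2] at h1
    simpa using h1.symm
  subst hr
  have hii : i = i' := (StrictMono.range_inj hi hi').1 hri
  have hjj : j = j' := (StrictMono.range_inj hj hj').1 hrj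
  subst hii hjj
  funext t
  change lab (T^[(t : ℕ)] y) = lab (T^[(t : ℕ)] y')
  rcases (hc t).2.2 with ⟨⟨s, rfl⟩, h1, a, ha⟩ | h1
  · rcases (hc' (j s)).2.2 with ⟨-, h2, b, hb⟩ | h2
    · rw [hK a _ ha, hK b _ hb]
      by_contra hab
      have h3 := hsep a b hab _ ha _ hb
      have h4 := hd s
      have h5 := hd' s
      have h6 := dist_triangle_left (T^[(j s : ℕ)] y) (T^[(j s : ℕ)] y') (T^[(i s : ℕ)] x)
      linarith
    · rw [h1] at h2; simp at h2
  · rcases (hc' t).2.2 with ⟨-, h2, -⟩ | h2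
    · rw [h1] at h2; simp at h2
    · rw [h1] at h2; simpa using h2

open Classical in
lemma fk_code_exists {k : ℕ} {T : X → X} (lab : X → Fin k) (K : Fin k → Set X) {n : ℕ} (hn : 0 < n)
    {ε b : ℝ} {x y : X} (hxy : y ∈ fkBall T n x ε) (hε : ε ≤ b / 4)
    (hy : ((Finset.univ.filter (fun t : Fin n => ¬ ∃ a, T^[(t : ℕ)] y ∈ K a)).card : ℝ) ≤ b / 2 * n) :
    ∃ c : Fin n → Prop × Prop × Option (Fin k), FkCode T lab K n ε x y c ∧
      ((Finset.univ.filter (fun t => c t ≠ (True, True, none))).card : ℝ) ≤ b * n := by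
  obtain ⟨r, hr, i, j, hi, hj, hd⟩ := fk_ball_match hn hxy
  refine ⟨fun t => (t ∈ range i, t ∈ range j,
    if t ∈ range j ∧ ∃ a, T^[(t : ℕ)] y ∈ K a then none else some (lab (T^[(t : ℕ)] y))),
    ⟨r, i, j, hi, hj, hd, fun t => ⟨rfl, rfl, ?_⟩⟩, ?_⟩
  · by_cases h : t ∈ range j ∧ ∃ a, T^[(t : ℕ)] y ∈ K a
    · left; exact ⟨h.1, if_pos h, h.2⟩
    · right; exact if_neg h
  · have hcard : ∀ i : Fin r → Fin n, StrictMono i →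
        ((Finset.univ.filter (fun t => t ∉ range i)).card : ℝ) ≤ ε * n := by
      intro i hi
      have h1 : (Finset.univ.filter (fun t => t ∈ range i)).card = r := by
        have : Finset.univ.filter (fun t => t ∈ range i) = Finset.univ.image i := by
          ext t; simp
        rw [this, Finset.card_image_of_injective _ hi.injective]; simp
      have h2 := Finset.card_filter_add_card_filter_not (s := (Finset.univ : Finset (Fin n)))
        (fun t => t ∈ range i)
      rw [h1] at h2
      have h3 : (r : ℝ) + ((Finset.univ.filter (fun t => t ∉ range i)).card : ℝ) = n := by
        have : r + (Finset.univ.filter (fun t => t ∉ range i)).card = n := by simpa using h2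
        exact_mod_cast this
      linarith
    have hsub : (Finset.univ.filter (fun t : Fin n => ((t ∈ range i, t ∈ range j,
        if t ∈ range j ∧ ∃ a, T^[(t : ℕ)] y ∈ K a then none else some (lab (T^[(t : ℕ)] y))) :
        Prop × Prop × Option (Fin k)) ≠ (True, True, none))) ⊆
        (Finset.univ.filter (fun t => t ∉ range i)) ∪ (Finset.univ.filter (fun t => t ∉ range j)) ∪
        (Finset.univ.filter (fun t : Fin n => ¬ ∃ a, T^[(t : ℕ)] y ∈ K a)) := by
      intro t ht
      by_contra hcon
      simp only [Finset.mem_union, Finset.mem_filter, Finset.mem_univ, true_and, not_or,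
        not_not] at hcon ht
      obtain ⟨⟨h1, h2⟩, h3⟩ := hcon
      apply ht
      rw [if_pos ⟨h2, h3⟩, eq_true h1, eq_true h2]
    have h1 := (Finset.card_le_card hsub).trans ((Finset.card_union_le _ _).trans
      (Nat.add_le_add_right (Finset.card_union_le _ _) _))
    have h2 : ((Finset.univ.filter (fun t : Fin n => ((t ∈ range i, t ∈ range j,
        if t ∈ range j ∧ ∃ a, T^[(t : ℕ)] y ∈ K a then none else some (lab (T^[(t : ℕ)] y))) :
        Prop × Prop × Option (Fin k)) ≠ (True, True, none))).card : ℝ) ≤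
        ((Finset.univ.filter (fun t => t ∉ range i)).card : ℝ) +
        (Finset.univ.filter (fun t => t ∉ range j)).card +
        (Finset.univ.filter (fun t : Fin n => ¬ ∃ a, T^[(t : ℕ)] y ∈ K a)).card := by
      exact_mod_cast h1
    have h3 := hcard i hi
    have h4 := hcard j hj
    have h5 : ε * n ≤ b / 4 * n := by gcongr
    linarith

open Classical in
lemma fk_names_count [Nonempty X] {k : ℕ} {T : X → X} (lab : X → Fin k) (K : Fin k → Set X) {n : ℕ} (hn : 0 < n)
    {ε b t : ℝ} (ht0 : 0 < t) (ht1 : t ≤ 1)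
    (hK : ∀ a, ∀ u ∈ K a, lab u = a)
    (hsep : ∀ a b, a ≠ b → ∀ u ∈ K a, ∀ v ∈ K b, 2 * ε ≤ dist u v)
    (hε : ε ≤ b / 4) (s : Finset X) :
    ((Finset.univ.filter (fun f : Fin n → Fin k => ∃ y, fkName T lab n y = f ∧
      y ∈ (⋃ x ∈ s, fkBall T n x ε) ∧
      ((Finset.univ.filter (fun t : Fin n => ¬ ∃ a, T^[(t : ℕ)] y ∈ K a)).card : ℝ) ≤ b / 2 * n)).card
      : ℝ) ≤ s.card * Real.exp (n * (b * Real.log (1 / t) +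
        Fintype.card (Prop × Prop × Option (Fin k)) * t)) := by
  set S := Finset.univ.filter (fun f : Fin n → Fin k => ∃ y, fkName T lab n y = f ∧
      y ∈ (⋃ x ∈ s, fkBall T n x ε) ∧
      ((Finset.univ.filter (fun t : Fin n => ¬ ∃ a, T^[(t : ℕ)] y ∈ K a)).card : ℝ) ≤ b / 2 * n)
  set C := (Finset.univ : Finset (Fin n → Prop × Prop × Option (Fin k))).filter (fun c =>
      ((Finset.univ.filter (fun i => c i ≠ (True, True, none))).card : ℝ) ≤ b * n)
  have hC : (C.card : ℝ) ≤ Real.exp (n * (b * Real.log (1 / t) +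
        Fintype.card (Prop × Prop × Option (Fin k)) * t)) := by
    convert fk_count_words
      ((True, True, none) : Prop × Prop × Option (Fin k)) n b t ht0 ht1
  have hex : ∀ f ∈ S, ∃ p : X × (Fin n → Prop × Prop × Option (Fin k)), p ∈ s ×ˢ C ∧
      ∃ y, fkName T lab n y = f ∧ FkCode T lab K n ε p.1 y p.2 := by
    intro f hf
    obtain ⟨y, hyf, hyU, hyK⟩ := (Finset.mem_filter.1 hf).2
    simp only [mem_iUnion] at hyU
    obtain ⟨x, hxs, hxy⟩ := hyU
    obtain ⟨c, hc, hc'⟩ := fk_code_exists lab K hn hxy hε hyK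
    exact ⟨(x, c), Finset.mem_product.2 ⟨hxs, Finset.mem_filter.2 ⟨Finset.mem_univ _, hc'⟩⟩,
      y, hyf, hc⟩
  choose! g hg hg' using hex
  have hcard : S.card ≤ (s ×ˢ C).card := by
    apply Finset.card_le_card_of_injOn g hg
    intro f hf f' hf' heq
    obtain ⟨y, hy, hc⟩ := hg' f hf
    obtain ⟨y', hy', hc'⟩ := hg' f' hf'
    rw [← heq] at hc'
    rw [← hy, ← hy']
    exact fk_code_det hK hsep hc hc'
  rw [Finset.card_product] at hcard
  calc (S.card : ℝ) ≤ s.card * C.card := by exact_mod_cast hcard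
    _ ≤ _ := by gcongr

open Classical in
lemma fk_markov {Y : Type*} [MeasurableSpace Y] {μ : Measure Y} [IsProbabilityMeasure μ]
    {T : Y → Y} (hT : MeasurePreserving T μ μ) {O : Set Y} (hO : MeasurableSet O)
    {n : ℕ} (hn : 0 < n) {b : ℝ} (hb : 0 < b) (hOb : μ.real O ≤ b ^ 2 / 4) :
    μ.real {y | b / 2 * n ≤ ((Finset.univ.filter (fun t : Fin n => T^[(t : ℕ)] y ∈ O)).card : ℝ)}
      ≤ b / 2 := by
  have hn' : (0 : ℝ) < n := by exact_mod_cast hn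
  let F : Y → ℝ := fun y => ∑ t : Fin n, (T^[(t : ℕ)] ⁻¹' O).indicator (fun _ => (1 : ℝ)) y
  have hm : ∀ t : ℕ, MeasurableSet (T^[t] ⁻¹' O) := fun t => (hT.iterate t).measurable hO
  have hFe : ∀ y, F y = ((Finset.univ.filter (fun t : Fin n => T^[(t : ℕ)] y ∈ O)).card : ℝ) := by
    intro y
    simp only [F, indicator, mem_preimage, Finset.sum_boole]
  have hintg : ∀ t : Fin n, Integrable ((T^[(t : ℕ)] ⁻¹' O).indicator (fun _ => (1 : ℝ))) μ :=
    fun t => (integrable_const (1 : ℝ)).indicator (hm t)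
  have hF : Integrable F μ := integrable_finsetSum _ fun t _ => hintg t
  have h0 : 0 ≤ᵐ[μ] F := Eventually.of_forall fun y => by
    change 0 ≤ F y
    rw [hFe]; positivity
  have h1 := mul_meas_ge_le_integral_of_nonneg h0 hF (b / 2 * n)
  have h2 : ∫ y, F y ∂μ = n * μ.real O := by
    simp only [F]
    rw [integral_finsetSum _ (fun t _ => hintg t)]
    have : ∀ t : Fin n, ∫ y, (T^[(t : ℕ)] ⁻¹' O).indicator (fun _ => (1 : ℝ)) y ∂μ = μ.real O := by
      intro t
      rw [integral_indicator (hm t)]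
      simp only [integral_const, smul_eq_mul, mul_one, measureReal_restrict_apply_univ]
      exact (hT.iterate t).measureReal_preimage hO.nullMeasurableSet
    simp [this]
  rw [h2] at h1
  simp only [hFe] at h1
  set m := μ.real {y | b / 2 * n ≤
    ((Finset.univ.filter (fun t : Fin n => T^[(t : ℕ)] y ∈ O)).card : ℝ)}
  have h3 : b / 2 * n * m ≤ b / 2 * n * (b / 2) := by
    calc b / 2 * n * m ≤ n * μ.real O := h1
      _ ≤ n * (b ^ 2 / 4) := by gcongr
      _ = _ := by ring
  exact le_of_mul_le_mul_left h3 (by positivity)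

lemma fk_lower [MeasurableSpace X] [BorelSpace X] [CompactSpace X]
    {T : X → X} (hT : Continuous T) {μ : Measure X} [IsProbabilityMeasure μ]
    (hμ : MeasurePreserving T μ μ) {k : ℕ} {P : Fin k → Set X} (hP : IsFinPartition P)
    {c : ℝ} (hc : 0 < c) :
    ∀ᶠ ε in nhdsWithin (0 : ℝ) (Ioi 0), ∀ᶠ n : ℕ in atTop,
      dynEnt μ T P n / n ≤ Real.log (spFKmu μ T n ε) / n + c := by
  classical
  obtain ⟨lab, hlm, hl⟩ := fk_label hP
  have hXne : Nonempty X := by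
    by_contra h
    rw [not_nonempty_iff] at h
    have h1 : μ univ = 1 := measure_univ
    rw [univ_eq_empty_iff.2 h] at h1
    simp at h1
  have hk : (1 : ℝ) ≤ k := by
    have : 0 < k := Fin.pos (lab hXne.some)
    exact_mod_cast this
  have hlk : 0 ≤ Real.log k := Real.log_nonneg hk
  set A : ℝ := (Fintype.card (Prop × Prop × Option (Fin k)) : ℝ) with hA
  have hA0 : 0 ≤ A := by positivity
  obtain ⟨t, ht0, ht1, htA⟩ : ∃ t : ℝ, 0 < t ∧ t ≤ 1 ∧ A * t ≤ c / 4 := by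
    refine ⟨min 1 (c / 4 / (A + 1)), by positivity, min_le_left _ _, ?_⟩
    calc A * min 1 (c / 4 / (A + 1)) ≤ (A + 1) * (c / 4 / (A + 1)) := by
          gcongr
          · linarith
          · exact min_le_right _ _
      _ = c / 4 := by field_simp
  have hlt : 0 ≤ Real.log (1 / t) := Real.log_nonneg (by rw [le_div_iff₀ ht0]; linarith)
  obtain ⟨b, hb0, hb1⟩ : ∃ b : ℝ, 0 < b ∧ b * (Real.log (1 / t) + Real.log k) ≤ c / 4 := by
    refine ⟨c / 4 / (Real.log (1 / t) + Real.log k + 1), by positivity, ?_⟩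
    rw [div_mul_eq_mul_div, div_le_iff₀ (by positivity)]
    apply mul_le_mul_of_nonneg_left _ (by positivity); linarith
  -- compact approximations
  have hcomp : ∀ a : Fin k, ∃ K, K ⊆ P a ∧ IsCompact K ∧
      μ (P a \ K) < ENNReal.ofReal (b ^ 2 / 4 / k) := fun a =>
    (hP.1 a).exists_isCompact_sdiff_lt (measure_ne_top _ _) (by
      have : 0 < b ^ 2 / 4 / k := by positivity
      simpa using this)
  choose K hKP hKc hKμ using hcomp
  have hKm : MeasurableSet (⋃ a, K a) := MeasurableSet.iUnion fun a => (hKc a).measurableSet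
  have hO : μ.real (⋃ a, K a)ᶜ ≤ b ^ 2 / 4 := by
    have hsub : (⋃ a, K a)ᶜ ⊆ ⋃ a, (P a \ K a) := by
      intro y hy
      simp only [mem_compl_iff, mem_iUnion, not_exists] at hy
      exact mem_iUnion.2 ⟨lab y, (hl _ _).2 rfl, hy _⟩
    calc μ.real (⋃ a, K a)ᶜ ≤ μ.real (⋃ a, (P a \ K a)) := measureReal_mono hsub
      _ ≤ ∑ a, μ.real (P a \ K a) := measureReal_iUnion_fintype_le _
      _ ≤ ∑ a : Fin k, b ^ 2 / 4 / k := by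
        apply Finset.sum_le_sum
        intro a _
        exact ENNReal.toReal_le_of_le_ofReal (by positivity) (hKμ a).le
      _ = b ^ 2 / 4 := by
        simp; field_simp
  have hlabK : ∀ a, ∀ u ∈ K a, lab u = a := fun a u hu => (hl _ _).1 (hKP a hu)
  have hsep : ∀ᶠ ε in nhdsWithin (0 : ℝ) (Ioi 0),
      ∀ a b, a ≠ b → ∀ u ∈ K a, ∀ v ∈ K b, 2 * ε ≤ dist u v := by
    rw [eventually_all]; intro a
    rw [eventually_all]; intro b
    rw [eventually_imp_distrib_left]
    intro hab
    obtain ⟨r, hr, h⟩ := exists_pos_forall_lt_edist (hKc a) (hKc b).isClosed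
      ((hP.2.1 hab).mono (hKP a) (hKP b))
    have hr' : (0 : ℝ) < r := by exact_mod_cast hr
    filter_upwards [Ioo_mem_nhdsGT (half_pos hr')] with ε hε u hu v hv
    have h1 := h u hu v hv
    rw [edist_nndist] at h1
    have h2 : r < nndist u v := by exact_mod_cast h1
    have h3 : (r : ℝ) < dist u v := by exact_mod_cast h2
    have := hε.2
    linarith
  filter_upwards [hsep, Ioo_mem_nhdsGT (show (0 : ℝ) < b / 4 by positivity)] with ε hε1 hε2
  have hn2 : ∀ᶠ n : ℕ in atTop, Real.log 2 / n < c / 4 := by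
    have := tendsto_const_div_atTop_nhds_zero_nat (Real.log 2)
    exact this.eventually_lt_const (by positivity)
  filter_upwards [eventually_gt_atTop 0, hn2] with n hn hn2
  have hn' : (0 : ℝ) < n := by exact_mod_cast hn
  obtain ⟨s, hs, hsμ⟩ := fk_sp_mem (μ := μ) hT hn hε2.1
  have hsp := fk_sp_pos (μ := μ) hT hn hε2.1
  have hcount := fk_names_count (T := T) lab K hn ht0 ht1 hlabK hε1 hε2.2.le s
  set S := Finset.univ.filter (fun f : Fin n → Fin k => ∃ y, fkName T lab n y = f ∧
      y ∈ (⋃ x ∈ s, fkBall T n x ε) ∧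
      ((Finset.univ.filter (fun t : Fin n => ¬ ∃ a, T^[(t : ℕ)] y ∈ K a)).card : ℝ) ≤ b / 2 * n)
    with hS
  set B := {y | b / 2 * n ≤
    ((Finset.univ.filter (fun t : Fin n => T^[(t : ℕ)] y ∈ (⋃ a, K a)ᶜ)).card : ℝ)} with hB
  have hmk : μ.real B ≤ b / 2 := by
    convert fk_markov hμ hKm.compl hn hb0 hO
  have hsub : (⋃ x ∈ s, fkBall T n x ε) ⊆ fkName T lab n ⁻¹' (S : Set (Fin n → Fin k)) ∪ B := by
    intro y hy
    by_cases hyB : y ∈ B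
    · exact Or.inr hyB
    · left
      simp only [mem_preimage, Finset.mem_coe]
      refine Finset.mem_filter.2 ⟨Finset.mem_univ _, y, rfl, hy, ?_⟩
      simp only [hB, mem_ofPred_eq, not_le, mem_compl_iff, mem_iUnion] at hyB
      exact hyB.le
  have hmass : 1 - b ≤ ∑ f ∈ S, μ.real (fkName T lab n ⁻¹' {f}) := by
    rw [fk_sum_real μ (fkName_meas hμ.measurable hlm n)]
    have h1 : μ.real (⋃ x ∈ s, fkBall T n x ε) ≤ _ := measureReal_mono hsub
    have h2 := measureReal_union_le (μ := μ) (fkName T lab n ⁻¹' (S : Set (Fin n → Fin k))) B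
    have h3 : 1 - ε ≤ μ.real (⋃ x ∈ s, fkBall T n x ε) := by
      have h4 : (1 : ℝ≥0∞) ≤ μ (⋃ x ∈ s, fkBall T n x ε) + ENNReal.ofReal ε :=
        tsub_le_iff_right.1 hsμ.le
      have h5 := ENNReal.toReal_mono (ENNReal.add_ne_top.2 ⟨measure_ne_top _ _, ENNReal.ofReal_ne_top⟩) h4
      rw [ENNReal.toReal_add (measure_ne_top _ _) ENNReal.ofReal_ne_top, ENNReal.toReal_ofReal hε2.1.le] at h5
      simp only [ENNReal.toReal_one] at h5
      change 1 - ε ≤ (μ (⋃ x ∈ s, fkBall T n x ε)).toReal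
      linarith
    have := hε2.2
    linarith
  have hp1 : ∑ f, μ.real (fkName T lab n ⁻¹' {f}) = 1 := by
    rw [fk_sum_real μ (fkName_meas hμ.measurable hlm n)]
    simp
  have hsp' : (1 : ℝ) ≤ spFKmu μ T n ε := by exact_mod_cast hsp
  set E := n * (b * Real.log (1 / t) + A * t) with hE
  have hE0 : 0 ≤ E := by positivity
  have hH := fk_entropy_bound (fun f => μ.real (fkName T lab n ⁻¹' {f}))
    (fun f => measureReal_nonneg) hp1 S (spFKmu μ T n ε * Real.exp E) ((k : ℝ) ^ n) b
    (by have := Real.one_le_exp hE0; nlinarith) (by rw [← hs]; exact hcount)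
    (one_le_pow₀ hk) (by simp) hmass
  rw [fk_dynEnt T hl]
  rw [Real.log_mul (by positivity) (by positivity), Real.log_exp, Real.log_pow] at hH
  rw [div_le_iff₀ hn', add_mul, div_mul_cancel₀ _ hn'.ne']
  rw [div_lt_iff₀ hn'] at hn2
  refine hH.trans ?_
  have h6 : n * (b * (Real.log (1 / t) + Real.log k)) ≤ n * (c / 4) := by gcongr
  have h7 : n * (A * t) ≤ n * (c / 4) := by gcongr
  have h8 : 0 ≤ n * c := by positivity
  rw [hE]
  nlinarith

lemma fk_sum_blocks (g : ℕ → ℝ) (m N : ℕ) :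
    ∑ i ∈ Finset.range (N * m), g i =
      ∑ r ∈ Finset.range m, ∑ j ∈ Finset.range N, g (j * m + r) := by
  induction N with
  | zero => simp
  | succ N ih =>
    rw [Nat.succ_mul, Finset.sum_range_add, ih, ← Finset.sum_add_distrib]
    exact Finset.sum_congr rfl fun r _ => (Finset.sum_range_succ _ _).symm

open Classical in
lemma fk_count_typical {B : Type*} [Fintype B] (q : B → ℝ) (hq : ∀ b, 0 < q b) {η L : ℝ}
    (hZ : ∑ b, q b ≤ Real.exp η) (N : ℕ) :
    (((Finset.univ : Finset (Fin N → B)).filter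
      (fun w => ∑ j, -Real.log (q (w j)) ≤ L)).card : ℝ) ≤ Real.exp (L + N * η) := by
  set W := (Finset.univ : Finset (Fin N → B)).filter (fun w => ∑ j, -Real.log (q (w j)) ≤ L)
  have h1 : ∀ w ∈ W, Real.exp (-L) ≤ ∏ j, q (w j) := by
    intro w hw
    have hw' := (Finset.mem_filter.1 hw).2
    have : ∏ j, q (w j) = Real.exp (- ∑ j, -Real.log (q (w j))) := by
      rw [Finset.sum_neg_distrib, neg_neg, Real.exp_sum]
      exact Finset.prod_congr rfl fun j _ => (Real.exp_log (hq _)).symm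
    rw [this]
    exact Real.exp_le_exp.2 (by linarith)
  have h2 : (W.card : ℝ) * Real.exp (-L) ≤ Real.exp (N * η) := by
    calc (W.card : ℝ) * Real.exp (-L) = ∑ w ∈ W, Real.exp (-L) := by simp
      _ ≤ ∑ w ∈ W, ∏ j, q (w j) := Finset.sum_le_sum h1
      _ ≤ ∑ w : Fin N → B, ∏ j, q (w j) :=
        Finset.sum_le_sum_of_subset_of_nonneg (Finset.subset_univ _)
          fun w _ _ => Finset.prod_nonneg fun j _ => (hq _).le
      _ = (∑ b, q b) ^ N := by rw [Finset.sum_pow', Fintype.piFinset_univ]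
      _ ≤ (Real.exp η) ^ N :=
        pow_le_pow_left₀ (Finset.sum_nonneg fun b _ => (hq b).le) hZ N
      _ = Real.exp (N * η) := by rw [Real.exp_nat_mul]
  have h3 : (W.card : ℝ) = (W.card * Real.exp (-L)) * Real.exp L := by
    rw [mul_assoc, ← Real.exp_add]; simp
  rw [h3, Real.exp_add, mul_comm]
  gcongr

lemma fk_upper [MeasurableSpace X] [BorelSpace X] [CompactSpace X]
    {T : X → X} (hT : Continuous T) {μ : Measure X} [IsProbabilityMeasure μ]
    (hE : Ergodic T μ) {k : ℕ} {P : Fin k → Set X} (hP : IsFinPartition P)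
    {ε δ : ℝ} (hδ : 0 < δ) (hδε : δ < ε) (hε1 : ε < 1)
    (hdiam : ∀ a, ∀ u ∈ P a, ∀ v ∈ P a, dist u v < δ) {m : ℕ} (hm : 0 < m)
    {c : ℝ} (hc : 0 < c) :
    ∀ᶠ n : ℕ in atTop, Real.log (spFKmu μ T n ε) / n ≤ dynEnt μ T P m / m + c := by
  classical
  obtain ⟨lab, hlm, hl⟩ := fk_label hP
  have hlabd : ∀ u v, lab u = lab v → dist u v < δ := fun u v h =>
    hdiam (lab v) u ((hl _ _).2 h) v ((hl _ _).2 rfl)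
  have hXne : Nonempty X := by
    by_contra h
    rw [not_nonempty_iff] at h
    have h1 : μ univ = 1 := measure_univ
    rw [univ_eq_empty_iff.2 h] at h1
    simp at h1
  have hk0 : 0 < k := Fin.pos (lab hXne.some)
  have hμ : MeasurePreserving T μ μ := hE.toMeasurePreserving
  have hm' : (1 : ℝ) ≤ m := by exact_mod_cast hm
  rw [fk_dynEnt T hl]
  set nm := fkName T lab m with hnm
  have hnmm : Measurable nm := fkName_meas hμ.measurable hlm m
  set p : (Fin m → Fin k) → ℝ := fun b => μ.real (nm ⁻¹' {b}) with hp
  have hp0 : ∀ b, 0 ≤ p b := fun b => measureReal_nonneg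
  have hp1 : ∑ b, p b = 1 := by
    rw [hp, fk_sum_real μ hnmm]; simp
  set H := ∑ b, Real.negMulLog (p b) with hH
  have hp1' : ∀ b, p b ≤ 1 := fun b => measureReal_le_one
  have hH0 : 0 ≤ H := Finset.sum_nonneg fun b _ => Real.negMulLog_nonneg (hp0 b) (hp1' b)
  obtain ⟨η, hη0, hηc⟩ : ∃ η : ℝ, 0 < η ∧ 3 * η ≤ c / 2 := ⟨c / 6, by positivity, by linarith⟩
  set M : ℝ := ((Fintype.card (Fin m → Fin k) : ℕ) : ℝ) with hM
  have hM0 : 0 ≤ M := by positivity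
  set s : ℝ := η / (M + 1) with hs
  have hs0 : 0 < s := by positivity
  set q : (Fin m → Fin k) → ℝ := fun b => p b + s with hq
  have hq0 : ∀ b, 0 < q b := fun b => by have := hp0 b; simp only [hq]; linarith
  have hZ : ∑ b, q b ≤ Real.exp η := by
    have h1 : ∑ b, q b = 1 + M * s := by
      simp only [hq]; rw [Finset.sum_add_distrib, hp1]; simp [hM]
    have h2 : M * s ≤ η := by
      rw [hs, mul_div_assoc', div_le_iff₀ (by positivity)]; nlinarith
    have := Real.add_one_le_exp η
    linarith
  set φ : (Fin m → Fin k) → ℝ := fun b => -Real.log (q b) with hφ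
  set f : X → ℝ := fun y => φ (nm y) with hf
  have hfm : Measurable f := (measurable_of_finite φ).comp hnmm
  have hfL : MemLp f 2 μ := by
    refine MemLp.of_bound hfm.aestronglyMeasurable (∑ b, |φ b|) (Eventually.of_forall fun y => ?_)
    rw [Real.norm_eq_abs]
    exact Finset.single_le_sum (f := fun b => |φ b|) (fun b _ => abs_nonneg _)
      (Finset.mem_univ (nm y))
  have hfint : ∫ y, f y ∂μ ≤ H := by
    have h1 : ∫ y, f y ∂μ = ∫ b, φ b ∂(μ.map nm) :=
      (integral_map hnmm.aemeasurable (measurable_of_finite φ).aestronglyMeasurable).symm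
    have : IsProbabilityMeasure (μ.map nm) := Measure.isProbabilityMeasure_map hnmm.aemeasurable
    rw [h1, integral_fintype (Integrable.of_finite)]
    apply Finset.sum_le_sum
    intro b _
    have h2 : (μ.map nm).real {b} = p b := by
      rw [map_measureReal_apply hnmm (measurableSet_singleton b)]
    rw [h2, smul_eq_mul]
    rcases (hp0 b).eq_or_lt with h0 | h0
    · rw [← h0]; simp
    · have h3 : Real.log (p b) ≤ Real.log (q b) := Real.log_le_log h0 (by simp only [hq]; linarith)
      simp only [hφ, Real.negMulLog]
      nlinarith
  have hNt : Tendsto (fun n : ℕ => (n / m + 1) * m) atTop atTop := by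
    apply tendsto_atTop_mono (f := fun n => n) _ tendsto_id
    intro n
    exact (Nat.lt_div_mul_add hm).le.trans (by rw [Nat.add_mul, one_mul])
  have hbad := (fk_mean_ergodic hE hfL hη0).comp hNt
  have hbad' := hbad.eventually_lt_const (show (0 : ℝ≥0∞) < ENNReal.ofReal ε by
    simpa using hδ.trans hδε)
  set C0 : ℝ := Real.log m + Real.log M + (H + 2 * η) with hC0
  have hC0t : ∀ᶠ n : ℕ in atTop, C0 / n < c / 2 :=
    (tendsto_const_div_atTop_nhds_zero_nat C0).eventually_lt_const (by positivity)
  filter_upwards [hbad', hC0t, eventually_gt_atTop 0] with n hb hCn hn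
  have hn' : (0 : ℝ) < n := by exact_mod_cast hn
  set N := n / m + 1 with hN
  have hNm : n < N * m := by
    rw [hN, Nat.add_mul, one_mul]; exact Nat.lt_div_mul_add hm
  set G : Set X := {y | ∑ i ∈ Finset.range (N * m), f (T^[i] y) <
    ((N * m : ℕ) : ℝ) * (H + η)} with hG
  have hGμ : 1 - ENNReal.ofReal ε < μ G := by
    have h1 : (1 : ℝ≥0∞) ≤ μ G + μ {x | ((N * m : ℕ) : ℝ) * ((∫ y, f y ∂μ) + η) ≤
      ∑ i ∈ Finset.range (N * m), f (T^[i] x)} := by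
      rw [← measure_univ (μ := μ)]
      refine le_trans (measure_mono ?_) (measure_union_le _ _)
      intro y _
      by_cases hy : y ∈ G
      · exact Or.inl hy
      · right
        simp only [hG, mem_ofPred_eq, not_lt] at hy
        refine le_trans ?_ hy
        gcongr
    have h2 : (1 : ℝ≥0∞) < μ G + ENNReal.ofReal ε :=
      h1.trans_lt (ENNReal.add_lt_add_left (measure_ne_top _ _) hb)
    have h3 : ENNReal.ofReal ε ≤ 1 := by
      rw [← ENNReal.ofReal_one]; exact ENNReal.ofReal_le_ofReal hε1.le
    exact (ENNReal.sub_lt_iff_lt_right ENNReal.ofReal_ne_top h3).2 h2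
  have hr : ∀ y, ∃ r : Fin m, y ∈ G →
      ∑ j : Fin N, φ (nm (T^[(j : ℕ) * m + r] y)) ≤ N * (H + η) := by
    intro y
    by_cases hy : y ∈ G
    · have h1 : ∑ i ∈ Finset.range (N * m), f (T^[i] y) <
        ((N * m : ℕ) : ℝ) * (H + η) := hy
      rw [fk_sum_blocks (fun i => f (T^[i] y))] at h1
      have h2 : ((N * m : ℕ) : ℝ) * (H + η) = ∑ r ∈ Finset.range m, N * (H + η) := by
        simp; ring
      rw [h2] at h1
      obtain ⟨r, hr, h3⟩ := Finset.exists_lt_of_sum_lt h1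
      refine ⟨⟨r, Finset.mem_range.1 hr⟩, fun _ => ?_⟩
      rw [Finset.sum_range] at h3
      exact h3.le
    · exact ⟨⟨0, hm⟩, fun h => absurd h hy⟩
  choose r hr using hr
  have hsp : spFKmu μ T n ε ≤ _ := fk_sp_le_code (μ := μ) (T := T) hn hδ hδε
    ((Finset.univ : Finset (Fin m)) ×ˢ ((Finset.univ : Finset (Fin m → Fin k)) ×ˢ
      ((Finset.univ : Finset (Fin N → Fin m → Fin k)).filter
        (fun w => ∑ j, -Real.log (q (w j)) ≤ N * (H + η)))))
    (fun y => (r y, nm y, fun j : Fin N => nm (T^[(j : ℕ) * m + r y] y))) G hGμ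
    (by
      intro y hy
      simp only [Finset.mem_product, Finset.mem_univ, true_and, Finset.mem_filter]
      exact hr y hy)
    (by
      intro y _ y' _ heq i hi
      simp only [Prod.mk.injEq] at heq
      obtain ⟨h1, h2, h3⟩ := heq
      apply hlabd
      by_cases hir : i < r y
      · exact congrFun h2 ⟨i, hir.trans (r y).2⟩
      · have hj : (i - r y) / m < N := by
          rw [Nat.div_lt_iff_lt_mul hm]; omega
        have h4 := congrFun (congrFun h3 ⟨(i - r y) / m, hj⟩) ⟨(i - r y) % m, Nat.mod_lt _ hm⟩
        simp only [hnm, fkName, ← Function.iterate_add_apply, ← h1] at h4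
        have h5 : (i - r y) % m + ((i - r y) / m * m + r y) = i := by
          have := Nat.mod_add_div' (i - r y) m
          omega
        rwa [h5] at h4)
  rw [Finset.card_product, Finset.card_product] at hsp
  have hW := fk_count_typical q hq0 hZ N (L := N * (H + η))
  have hM1 : (1 : ℝ) ≤ M := by
    have : Nonempty (Fin k) := ⟨⟨0, hk0⟩⟩
    have : 0 < Fintype.card (Fin m → Fin k) := Fintype.card_pos
    rw [hM]; exact_mod_cast this
  have hspR : (spFKmu μ T n ε : ℝ) ≤ m * (M * Real.exp (N * (H + η) + N * η)) := by
    have h0 := (Nat.cast_le (α := ℝ)).2 hsp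
    rw [Nat.cast_mul, Nat.cast_mul, Finset.card_univ, Finset.card_univ, Fintype.card_fin] at h0
    refine h0.trans ?_
    rw [hM]
    gcongr
  have hsp1 : (1 : ℝ) ≤ spFKmu μ T n ε := by
    exact_mod_cast fk_sp_pos (μ := μ) hT hn (hδ.trans hδε)
  have hlog := Real.log_le_log (by linarith) hspR
  rw [Real.log_mul (by positivity) (by positivity), Real.log_mul (by positivity) (by positivity),
    Real.log_exp] at hlog
  have hNr : (N : ℝ) ≤ n / m + 1 := by
    rw [hN]; push_cast; gcongr; exact Nat.cast_div_le
  have h1 : N * (H + η) + N * η ≤ (n / m + 1) * (H + 2 * η) := by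
    have : (N : ℝ) * (H + 2 * η) ≤ (n / m + 1) * (H + 2 * η) := by gcongr
    linarith
  rw [div_le_iff₀ hn']
  rw [div_lt_iff₀ hn'] at hCn
  have h2 : (n : ℝ) / m * (2 * η) ≤ n * (2 * η) := by
    gcongr
    exact div_le_self hn'.le hm'
  have h3 : (n : ℝ) / m * H = H / m * n := by ring
  have h4 : (n : ℝ) * (3 * η) ≤ n * (c / 2) := by gcongr
  have h5 : 0 < (n : ℝ) * η := by positivity
  nlinarith

lemma fk_partition [MeasurableSpace X] [BorelSpace X] [CompactSpace X] {δ : ℝ} (hδ : 0 < δ) :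
    ∃ (k : ℕ) (P : Fin k → Set X), IsFinPartition P ∧
      ∀ a, ∀ u ∈ P a, ∀ v ∈ P a, dist u v < δ := by
  obtain ⟨t, -, htf, ht⟩ := finite_cover_balls_of_compact (isCompact_univ (X := X)) (half_pos hδ)
  obtain ⟨k, f, hf⟩ : ∃ (k : ℕ) (f : Fin k → X), Set.range f = t := by
    refine ⟨htf.toFinset.card, fun a => (htf.toFinset.equivFin.symm a : X), ?_⟩
    ext x
    constructor
    · rintro ⟨a, rfl⟩
      exact htf.mem_toFinset.1 (htf.toFinset.equivFin.symm a).2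
    · intro hx
      exact ⟨htf.toFinset.equivFin ⟨x, htf.mem_toFinset.2 hx⟩, by simp⟩
  refine ⟨k, fun a => ball (f a) (δ / 2) \ ⋃ b ∈ {b : Fin k | b < a}, ball (f b) (δ / 2),
    ⟨?_, ?_, ?_⟩, ?_⟩
  · intro a
    refine isOpen_ball.measurableSet.diff ?_
    exact (isOpen_biUnion fun _ _ => isOpen_ball).measurableSet
  · intro a b hab
    rw [Function.onFun, Set.disjoint_left]
    rintro x ⟨h1, h2⟩ ⟨h3, h4⟩
    rcases lt_or_gt_of_ne hab with h | h
    · exact h4 (Set.mem_biUnion (show a ∈ {c : Fin k | c < b} from h) h1)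
    · exact h2 (Set.mem_biUnion (show b ∈ {c : Fin k | c < a} from h) h3)
  · classical
    rw [Set.eq_univ_iff_forall]
    intro x
    have hne : (Finset.univ.filter fun a : Fin k => x ∈ ball (f a) (δ / 2)).Nonempty := by
      have hx := ht (Set.mem_univ x)
      rw [← hf, Set.mem_iUnion₂] at hx
      obtain ⟨_, ⟨a, rfl⟩, hx⟩ := hx
      exact ⟨a, by simpa using hx⟩
    refine Set.mem_iUnion.2 ⟨Finset.min' _ hne, (Finset.mem_filter.1 (Finset.min'_mem _ hne)).2, ?_⟩
    intro hx
    obtain ⟨b, hb, hx⟩ := Set.mem_iUnion₂.1 hx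
    exact absurd (Finset.min'_le _ b (Finset.mem_filter.2 ⟨Finset.mem_univ _, hx⟩)) (not_le.2 hb)
  · intro a u hu v hv
    have h1 := mem_ball.1 hu.1
    have h2 := mem_ball'.1 hv.1
    linarith [dist_triangle u (f a) v]

lemma fk_rate_anti [MeasurableSpace X] [CompactSpace X] {T : X → X} (hT : Continuous T)
    {μ : Measure X} [IsProbabilityMeasure μ] {ε ε' : ℝ} (hε : 0 < ε) (h : ε ≤ ε') :
    ∀ᶠ n : ℕ in atTop, ENNReal.ofReal (Real.log (spFKmu μ T n ε') / n) ≤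
      ENNReal.ofReal (Real.log (spFKmu μ T n ε) / n) := by
  filter_upwards [eventually_gt_atTop 0] with n hn
  have h1 : 1 ≤ spFKmu μ T n ε' := fk_sp_pos (μ := μ) hT hn (hε.trans_le h)
  have h2 := fk_sp_anti (μ := μ) hT hn hε h
  have h3 : (0 : ℝ) < spFKmu μ T n ε' := by exact_mod_cast h1
  gcongr

/-- Katok's entropy formula for the Feldman–Katok metric:
`h_μ(T) ≤ lim_{ε→0} liminf_n (1/n) log sp_{FK}(μ,n,ε)`, with equality (for both
`liminf` and `limsup`) when `μ` is ergodic. -/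
theorem katok_formula_FK [MeasurableSpace X] [BorelSpace X] [CompactSpace X]
    (T : X → X) (hT : Continuous T) (μ : Measure X) [IsProbabilityMeasure μ]
    (hμ : MeasurePreserving T μ μ) :
    (∃ A : ℝ≥0∞,
      Tendsto (fun ε : ℝ =>
          Filter.liminf (fun n : ℕ =>
            ENNReal.ofReal (Real.log (spFKmu μ T n ε) / n)) atTop)
        (nhdsWithin 0 (Set.Ioi 0)) (nhds A) ∧ ksEntropy μ T ≤ A) ∧
    (Ergodic T μ →
      Tendsto (fun ε : ℝ =>
          Filter.liminf (fun n : ℕ =>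
            ENNReal.ofReal (Real.log (spFKmu μ T n ε) / n)) atTop)
        (nhdsWithin 0 (Set.Ioi 0)) (nhds (ksEntropy μ T)) ∧
      Tendsto (fun ε : ℝ =>
          Filter.limsup (fun n : ℕ =>
            ENNReal.ofReal (Real.log (spFKmu μ T n ε) / n)) atTop)
        (nhdsWithin 0 (Set.Ioi 0)) (nhds (ksEntropy μ T))) := by
  set R : ℝ → ℕ → ℝ≥0∞ := fun ε n => ENNReal.ofReal (Real.log (spFKmu μ T n ε) / n) with hR
  have hanti : AntitoneOn (fun ε : ℝ => Filter.liminf (R ε) atTop) (Set.Ioi 0) := by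
    intro a ha b hb hab
    exact liminf_le_liminf (fk_rate_anti hT ha hab)
  have hA : Tendsto (fun ε : ℝ => Filter.liminf (R ε) atTop) (nhdsWithin 0 (Set.Ioi 0))
      (nhds (sSup ((fun ε : ℝ => Filter.liminf (R ε) atTop) '' Set.Ioo 0 1))) := by
    have := AntitoneOn.tendsto_nhdsWithin_Ioo_right (x := (0 : ℝ)) (y := 1)
      (f := fun ε : ℝ => Filter.liminf (R ε) atTop) (by simp)
      (hanti.mono Set.Ioo_subset_Ioi_self) (OrderTop.bddAbove _)
    exact this
  set A := sSup ((fun ε : ℝ => Filter.liminf (R ε) atTop) '' Set.Ioo 0 1)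
  have hle : ksEntropy μ T ≤ A := by
    unfold ksEntropy
    refine iSup_le fun k => iSup_le fun P => iSup_le fun hP => ?_
    refine ENNReal.le_of_forall_pos_le_add fun c hc _ => ?_
    have hc' : (0 : ℝ) < c := hc
    have hlim := hA.add_const (c : ℝ≥0∞)
    refine ge_of_tendsto hlim ?_
    filter_upwards [fk_lower hT hμ hP hc'] with ε hε
    have h1 : ∀ᶠ n : ℕ in atTop, (⨅ n : ℕ, ENNReal.ofReal (dynEnt μ T P (n + 1) / (n + 1))) - c
        ≤ R ε n := by
      filter_upwards [hε, eventually_gt_atTop 0] with n hn hn0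
      rw [tsub_le_iff_right]
      obtain ⟨n', rfl⟩ : ∃ n', n = n' + 1 := ⟨n - 1, by omega⟩
      refine (iInf_le _ n').trans ?_
      have h2 := ENNReal.ofReal_le_ofReal hn
      push_cast at h2
      refine h2.trans (ENNReal.ofReal_add_le.trans ?_)
      rw [hR]
      push_cast
      gcongr
      simp
    exact tsub_le_iff_right.1 (le_liminf_of_le (by isBoundedDefault) h1)
  refine ⟨⟨A, hA, hle⟩, fun hE => ?_⟩
  have hup : ∀ᶠ ε : ℝ in nhdsWithin 0 (Set.Ioi 0), Filter.limsup (R ε) atTop ≤ ksEntropy μ T := by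
    filter_upwards [Ioo_mem_nhdsGT (zero_lt_one (α := ℝ))] with ε hε
    obtain ⟨k, P, hP, hd⟩ := fk_partition (X := X) (half_pos hε.1)
    have h1 : (⨅ n : ℕ, ENNReal.ofReal (dynEnt μ T P (n + 1) / (n + 1))) ≤ ksEntropy μ T := by
      unfold ksEntropy
      exact le_iSup_of_le k (le_iSup_of_le P (le_iSup_of_le hP le_rfl))
    refine le_trans (le_iInf fun n' => ?_) h1
    refine ENNReal.le_of_forall_pos_le_add fun c hc _ => ?_
    have hc' : (0 : ℝ) < c := hc
    refine limsup_le_of_le (by isBoundedDefault) ?_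
    filter_upwards [fk_upper hT hE hP (half_pos hε.1) (half_lt_self hε.1) hε.2 hd
      (Nat.succ_pos n') hc'] with n hn
    have h2 := ENNReal.ofReal_le_ofReal hn
    push_cast at h2
    refine h2.trans (ENNReal.ofReal_add_le.trans ?_)
    gcongr
    simp
  have hlo : ∀ ε, Filter.liminf (R ε) atTop ≤ Filter.limsup (R ε) atTop := fun ε =>
    liminf_le_limsup
  have hAle : A ≤ ksEntropy μ T := by
    refine le_of_tendsto hA ?_
    filter_upwards [hup] with ε h using (hlo ε).trans h
  have hAe : A = ksEntropy μ T := le_antisymm hAle hle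
  rw [hAe] at hA
  exact ⟨hA, tendsto_of_tendsto_of_tendsto_of_le_of_le' hA tendsto_const_nhds
    (Eventually.of_forall hlo) hup⟩
end
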